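/- arXiv:math/0609723 — 3 statements merged into one kernel-verified Lean document; each statement's English description precedes it below -/
import Mathlib

section
/- Let q be an odd prime, q ≠ p, let f be the multiplicative order of q modulo p and m = (p−1)/f, and suppose f > 1. Let 𝔮 be a prime ideal of O_K lying over q. Then, with c_i = (Σ_{j=0}^{f-1} v_{-(i+jm)})/p ∈ ℤ for 0 ≤ i ≤ m−1, the ideal ∏_{i=0}^{m-1} (σ^i(𝔮))^{c_i} is a principal ideal of O_K; that is, the polynomial P_1(σ) = Σ_{i=0}^{m-1} c_i·σ^i annihilates the ideal class of 𝔮. -/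
open NumberField Finset nonZeroDivisors
namespace Stick

/-- The cyclic weight. -/
def wt (q f n : ℕ) : ℕ := ∑ j ∈ range f, (n * q ^ j) % (q ^ f - 1)

lemma wt_add (q f a b : ℕ) : wt q f (a + b) ≤ wt q f a + wt q f b := by
  unfold wt
  rw [← sum_add_distrib]
  refine sum_le_sum fun j _ => ?_
  rw [add_mul, Nat.add_mod]
  exact Nat.mod_le _ _

lemma wt_zero (q f : ℕ) : wt q f 0 = 0 := by simp [wt]

lemma wt_sum {ι : Type*} (q f : ℕ) (s : Finset ι) (a : ι → ℕ) :
    wt q f (∑ i ∈ s, a i) ≤ ∑ i ∈ s, wt q f (a i) := by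
  classical
  induction s using Finset.induction_on with
  | empty => simp [wt_zero]
  | insert i s hi ih =>
    rw [sum_insert hi, sum_insert hi]
    exact (wt_add _ _ _ _).trans (by omega)

lemma wt_nsmul (q f d a : ℕ) : wt q f (d * a) ≤ d * wt q f a := by
  have := wt_sum q f (range d) (fun _ => a)
  simpa using this

lemma wt_mul_q (q f n : ℕ) (hq : 1 ≤ q) : wt q f (n * q) = wt q f n := by
  unfold wt
  have h : ∀ j, (n * q * q ^ j) % (q ^ f - 1) = (n * q ^ (j + 1)) % (q ^ f - 1) := by
    intro j; congr 1; ring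
  simp_rw [h]
  have h1 := Finset.sum_range_succ (fun j => (n * q ^ j) % (q ^ f - 1)) f
  have h2 := Finset.sum_range_succ' (fun j => (n * q ^ j) % (q ^ f - 1)) f
  have h3 : (n * q ^ f) % (q ^ f - 1) = (n * q ^ 0) % (q ^ f - 1) := by
    have : n * q ^ f = n + n * (q ^ f - 1) := by
      obtain ⟨k, hk⟩ := Nat.exists_eq_add_of_le (Nat.one_le_pow f q hq)
      rw [hk]; simp; ring
    rw [this, Nat.add_mul_mod_self_right]; simp
  rw [h3] at h1
  omega

lemma wt_mul_pow (q f n j : ℕ) (hq : 1 ≤ q) : wt q f (n * q ^ j) = wt q f n := by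
  induction j with
  | zero => simp
  | succ j ih => rw [pow_succ, ← mul_assoc, wt_mul_q _ _ _ hq, ih]

lemma wt_one (q f : ℕ) (hq : 1 ≤ q) : (q - 1) * wt q f 1 ≤ q ^ f - 1 := by
  have h : wt q f 1 ≤ ∑ j ∈ range f, q ^ j := by
    unfold wt
    refine sum_le_sum fun j _ => ?_
    rw [one_mul]; exact Nat.mod_le _ _
  calc (q - 1) * wt q f 1 ≤ (q - 1) * ∑ j ∈ range f, q ^ j := Nat.mul_le_mul_left _ h
    _ = q ^ f - 1 := by
      have := mul_geom_sum (q : ℤ) f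
      zify [hq, Nat.one_le_pow f q hq]
      exact this

lemma wt_digits (q f n : ℕ) (hq : 1 < q) :
    (q - 1) * wt q f n ≤ (Nat.digits q n).sum * (q ^ f - 1) := by
  induction n using Nat.strong_induction_on with
  | _ n ih =>
    rcases Nat.eq_zero_or_pos n with rfl | hn
    · simp [wt_zero]
    · rw [Nat.digits_def' hq hn, List.sum_cons]
      have h1 : wt q f n ≤ (n % q) * wt q f 1 + wt q f (n / q) := by
        conv_lhs => rw [← Nat.mod_add_div n q]
        refine (wt_add _ _ _ _).trans ?_
        have := wt_nsmul q f (n % q) 1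
        rw [mul_one] at this
        have h2 := wt_mul_q q f (n / q) hq.le
        rw [mul_comm] at h2
        omega
      have h2 := ih (n / q) (Nat.div_lt_self hn hq)
      have h3 := wt_one q f hq.le
      calc _ ≤ (q - 1) * ((n % q) * wt q f 1 + wt q f (n / q)) := Nat.mul_le_mul_left _ h1
        _ = (n % q) * ((q - 1) * wt q f 1) + (q - 1) * wt q f (n / q) := by ring
        _ ≤ (n % q) * (q ^ f - 1) + (Nat.digits q (n / q)).sum * (q ^ f - 1) := by gcongr
        _ = _ := by ring

lemma digits_M (q N : ℕ) (hq : 1 < q) : (Nat.digits q ((q - 1) * q ^ N)).sum = q - 1 := by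
  rw [mul_comm, Nat.digits_base_pow_mul hq (by omega)]
  simp only [List.sum_append, List.sum_replicate]
  rw [Nat.digits_of_lt _ _ (by omega) (by omega)]
  simp

lemma val_multinomial (q : ℕ) [Fact q.Prime] (f : ℕ) (e : ℕ → ℕ) (N : ℕ)
    (he : ∑ j ∈ range f, e j = (q - 1) * q ^ N) :
    (q - 1) * (padicValNat q (Nat.multinomial (range f) e) + 1)
      = ∑ j ∈ range f, (Nat.digits q (e j)).sum := by
  have hq : 1 < q := (Fact.out : q.Prime).one_lt
  have h := Nat.multinomial_spec (range f) e
  have hpos : Nat.multinomial (range f) e ≠ 0 := Nat.multinomial_pos _ _ |>.ne'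
  have hprod : ∀ s : Finset ℕ, (q - 1) * padicValNat q (∏ i ∈ s, (e i).factorial)
      + ∑ i ∈ s, (Nat.digits q (e i)).sum = ∑ i ∈ s, e i := by
    intro s
    induction s using Finset.induction_on with
    | empty => simp
    | insert i s hi ih =>
      rw [prod_insert hi, sum_insert hi, sum_insert hi, padicValNat.mul
        (Nat.factorial_ne_zero _) (prod_ne_zero_iff.2 fun _ _ => Nat.factorial_ne_zero _),
        mul_add, sub_one_mul_padicValNat_factorial]
      have := Nat.digit_sum_le q (e i)
      omega
  have h2 := congrArg (fun n => (q - 1) * padicValNat q n) h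
  rw [padicValNat.mul (prod_ne_zero_iff.2 fun _ _ => Nat.factorial_ne_zero _) hpos, mul_add,
    sub_one_mul_padicValNat_factorial, he, digits_M q N hq] at h2
  have h3 := hprod (range f)
  rw [he] at h3
  have h4 : q - 1 ≤ (q - 1) * q ^ N := Nat.le_mul_of_pos_right _ (Nat.pow_pos (by omega))
  rw [mul_add]
  omega

/-- Key divisibility. -/
lemma key_dvd (q p f k b C : ℕ) [Fact q.Prime] (hk : q ^ f - 1 = p * k) (hf : 0 < f)
    (hC : ∑ j ∈ range f, (b * q ^ j) % p = p * C) (e : ℕ → ℕ) (N : ℕ)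
    (he : ∑ j ∈ range f, e j = (q - 1) * q ^ N)
    (hE : ∑ j ∈ range f, e j * q ^ j ≡ b * k [MOD (q ^ f - 1)]) :
    q ^ C ∣ q * Nat.multinomial (range f) e := by
  have hq : 1 < q := (Fact.out : q.Prime).one_lt
  have hQ : 0 < q ^ f - 1 := by
    have := Nat.one_lt_pow hf.ne' hq
    omega
  have h1 : wt q f (b * k) = (q ^ f - 1) * C := by
    unfold wt
    have : ∀ j, (b * k * q ^ j) % (q ^ f - 1) = k * ((b * q ^ j) % p) := by
      intro j
      rw [hk, mul_comm p k, show b * k * q ^ j = k * (b * q ^ j) by ring, Nat.mul_mod_mul_left]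
    simp_rw [this]
    rw [← mul_sum, hC, hk]; ring
  have h2 : wt q f (∑ j ∈ range f, e j * q ^ j) = wt q f (b * k) := by
    unfold wt
    refine sum_congr rfl fun j _ => ?_
    exact Nat.ModEq.mul_right _ hE
  have h3 : (q - 1) * wt q f (b * k) ≤ (∑ j ∈ range f, (Nat.digits q (e j)).sum) * (q ^ f - 1) := by
    rw [← h2, sum_mul]
    refine (Nat.mul_le_mul_left _ (wt_sum _ _ _ _)).trans ?_
    rw [mul_sum]
    refine sum_le_sum fun j _ => ?_
    rw [wt_mul_pow _ _ _ _ hq.le]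
    exact wt_digits _ _ _ hq
  rw [h1, ← val_multinomial q f e N he] at h3
  have h4 : C ≤ padicValNat q (Nat.multinomial (range f) e) + 1 := by
    have : (q ^ f - 1) * (q - 1) * C ≤ (q ^ f - 1) * (q - 1) *
      (padicValNat q (Nat.multinomial (range f) e) + 1) := by linarith
    exact Nat.le_of_mul_le_mul_left this (Nat.mul_pos hQ (by omega))
  refine (pow_dvd_pow q h4).trans ?_
  rw [pow_succ, mul_comm]
  exact mul_dvd_mul_left _ pow_padicValNat_dvd


lemma pow_q_sub_mem {R : Type*} [CommRing R] (I : Ideal R) (q : ℕ) (hqI : (q : R) ∈ I) (x y : R)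
    (hxy : x - y ∈ I) (N : ℕ) : x ^ q ^ N - y ^ q ^ N ∈ I ^ (N + 1) := by
  induction N with
  | zero => simpa using hxy
  | succ N ih =>
    rw [pow_succ q N, pow_mul, pow_mul]
    set a := x ^ q ^ N
    set c := y ^ q ^ N
    have h1 : a - c ∈ I := Ideal.pow_le_self (by omega) ih
    rw [← (Commute.all a c).mul_geom_sum₂, pow_succ]
    refine Ideal.mul_mem_mul ih ?_
    have h2 : ∑ i ∈ range q, a ^ i * c ^ (q - 1 - i) - (q : R) * c ^ (q - 1) ∈ I := by
      have : (q : R) * c ^ (q - 1) = ∑ i ∈ range q, c ^ i * c ^ (q - 1 - i) := by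
        rw [Finset.sum_congr rfl (g := fun _ => c ^ (q - 1))]
        · simp
        · intro i hi
          rw [← pow_add]; congr 1
          have := Finset.mem_range.1 hi
          omega
      rw [this, ← sum_sub_distrib]
      refine Ideal.sum_mem _ fun i _ => ?_
      rw [← sub_mul]
      exact Ideal.mul_mem_right _ _ (Ideal.mem_of_dvd _ (sub_dvd_pow_sub_pow a c i) h1)
    have := I.add_mem h2 (I.mul_mem_right (c ^ (q - 1)) hqI)
    simpa using this

lemma isUnit_mk_pow {R : Type*} [CommRing R] (I : Ideal R) [I.IsMaximal] (N : ℕ) (x : R)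
    (hx : x ∉ I) : IsUnit (Ideal.Quotient.mk (I ^ N) x) := by
  obtain ⟨y, hy⟩ := Ideal.IsMaximal.exists_inv ‹I.IsMaximal› hx
  obtain ⟨i, hi, h⟩ := hy
  have hn : IsNilpotent (Ideal.Quotient.mk (I ^ N) i) := by
    refine ⟨N, ?_⟩
    rw [← map_pow, Ideal.Quotient.eq_zero_iff_mem]
    exact Ideal.pow_mem_pow hi N
  have h2 := hn.isUnit_one_sub
  have h3 : (1 : R ⧸ I ^ N) - Ideal.Quotient.mk (I ^ N) i = Ideal.Quotient.mk (I ^ N) y *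
      Ideal.Quotient.mk (I ^ N) x := by
    rw [← map_one (Ideal.Quotient.mk (I ^ N)), ← h]; simp
  rw [h3] at h2
  exact isUnit_of_mul_isUnit_right h2

open Classical in
lemma local_bound {R : Type*} [CommRing R] (I : Ideal R) [I.IsMaximal] (q p f k b C : ℕ)
    [Fact q.Prime] (hp : 1 < p) (hk : q ^ f - 1 = p * k) (hf : 0 < f) (hqI : (q : R) ∈ I)
    (g z : R) (hgen : ∀ n : ℕ, g ^ n - 1 ∈ I ↔ (q ^ f - 1) ∣ n)
    (hzp : z ^ p = 1) (hz : z - g ^ (k * (p - 1)) ∈ I)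
    (hT : ∀ i : ℕ, (∑ j ∈ range f, g ^ (i * q ^ j)) ∈ I ∨
      (∑ j ∈ range f, g ^ (i * q ^ j)) ^ (q - 1) - 1 ∈ I)
    (hb : ¬ p ∣ b) (hC : ∑ j ∈ range f, (b * q ^ j) % p = p * C) :
    (q : R) * ∑ i ∈ range (q ^ f - 1),
      (if (∑ j ∈ range f, g ^ (i * q ^ j)) ∈ I then z ^ (b * i) else 0) ∈ I ^ C := by
  have hq : 1 < q := (Fact.out : q.Prime).one_lt
  have hQ1 : 1 < q ^ f := Nat.one_lt_pow hf.ne' hq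
  have hkpos : 0 < k := by
    rcases Nat.eq_zero_or_pos k with h | h
    · subst h; omega
    · exact h
  set N := C with hN
  set W := q ^ (f * N) with hW
  have hWmod : (q ^ f - 1) ∣ W - 1 := by
    rw [hW, pow_mul]
    simpa using Nat.sub_dvd_pow_sub_pow (q ^ f) 1 N
  have hWpos : 1 ≤ W := Nat.one_le_pow _ _ hq.le
  obtain ⟨w, hw⟩ := hWmod
  have hW' : W = 1 + (q ^ f - 1) * w := by omega
  have hlift : ∀ x y : R, x - y ∈ I → x ^ W - y ^ W ∈ I ^ (N + 1) := by
    intro x y h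
    have := pow_q_sub_mem I q hqI x y h (f * N)
    exact Ideal.pow_le_pow_right (by have := Nat.le_mul_of_pos_left N hf; omega) this
  set π := Ideal.Quotient.mk (I ^ (N + 1)) with hπ
  have hmk : ∀ x y : R, x - y ∈ I ^ (N + 1) → π x = π y := fun x y h =>
    Ideal.Quotient.eq.2 h
  set t := π (g ^ W) with ht
  have hgQ : g ^ (q ^ f - 1) - 1 ∈ I := (hgen _).2 dvd_rfl
  have htQ : t ^ (q ^ f - 1) = 1 := by
    rw [ht, ← map_pow, ← pow_mul, mul_comm, pow_mul, ← map_one π]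
    apply hmk
    simpa using hlift _ _ hgQ
  have hgW : g ^ W - g ∈ I := by
    have : g ^ W - g = g * (g ^ ((q ^ f - 1) * w) - 1) := by
      rw [hW', pow_add]; ring
    rw [this]
    exact I.mul_mem_left _ ((hgen _).2 (dvd_mul_right _ _))
  have hzt : π z = t ^ (k * (p - 1)) := by
    have : z = z ^ W := by
      rw [hW', hk, pow_add, mul_assoc, pow_mul, hzp]; simp
    rw [ht, ← map_pow, ← pow_mul, mul_comm, pow_mul, this]
    exact hmk _ _ (hlift _ _ hz)
  have hgeom : ∀ n : ℕ, ¬ (q ^ f - 1) ∣ n → ∑ i ∈ range (q ^ f - 1), (t ^ n) ^ i = 0 := by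
    intro n hn
    have h1 : IsUnit (t ^ n - 1) := by
      have : t ^ n - 1 = π (g ^ (W * n) - 1) := by
        rw [ht, map_sub, map_one, ← map_pow, pow_mul]
      rw [this]
      apply isUnit_mk_pow
      rw [hgen, hW', add_mul, one_mul, mul_assoc]
      intro h
      exact hn ((Nat.dvd_add_left (dvd_mul_right _ _)).1 h)
    have h2 := mul_geom_sum (t ^ n) (q ^ f - 1)
    rw [← pow_mul, mul_comm n, pow_mul, htQ] at h2
    simp only [one_pow, sub_self] at h2
    exact (h1.mul_right_eq_zero).1 h2
  set M := (q - 1) * q ^ N with hM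
  have hind : ∀ i : ℕ, 1 - (∑ j ∈ range f, t ^ (i * q ^ j)) ^ M =
      if (∑ j ∈ range f, g ^ (i * q ^ j)) ∈ I then 1 else 0 := by
    intro i
    set T := ∑ j ∈ range f, g ^ (i * q ^ j) with hTd
    set T' := ∑ j ∈ range f, (g ^ W) ^ (i * q ^ j) with hTd'
    have e1 : ∑ j ∈ range f, t ^ (i * q ^ j) = π T' := by
      rw [hTd', map_sum]; simp [ht]
    have e2 : T' - T ∈ I := by
      rw [hTd, hTd', ← sum_sub_distrib]
      exact I.sum_mem fun j _ => Ideal.mem_of_dvd _ (sub_dvd_pow_sub_pow _ _ _) hgW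
    rw [e1]
    split_ifs with h
    · have h' : T' ∈ I := by simpa using I.add_mem e2 h
      have : T' ^ M ∈ I ^ (N + 1) := by
        refine Ideal.pow_le_pow_right ?_ (Ideal.pow_mem_pow h' M)
        have : N < q ^ N := Nat.lt_pow_self hq
        calc N + 1 ≤ q ^ N := this
          _ ≤ M := Nat.le_mul_of_pos_left _ (by omega)
      rw [← map_pow, Ideal.Quotient.eq_zero_iff_mem.2 this, sub_zero]
    · have h1 : T ^ (q - 1) - 1 ∈ I := (hT i).resolve_left h
      have h2 : T' ^ (q - 1) - 1 ∈ I := by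
        have := Ideal.mem_of_dvd _ (sub_dvd_pow_sub_pow T' T (q - 1)) e2
        simpa using I.add_mem this h1
      have h3 := pow_q_sub_mem I q hqI _ _ h2 N
      rw [one_pow, ← pow_mul] at h3
      have := hmk _ _ h3
      rw [map_one] at this
      rw [← map_pow, this, sub_self]
  have hkey : π ((q : R) * ∑ i ∈ range (q ^ f - 1),
      (if (∑ j ∈ range f, g ^ (i * q ^ j)) ∈ I then z ^ (b * i) else 0)) =
      - ∑ e ∈ (range f).piAntidiag M, ((q * Nat.multinomial (range f) e : ℕ) : R ⧸ I ^ (N + 1)) *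
        ∑ i ∈ range (q ^ f - 1), (t ^ (k * (p - 1) * b + ∑ j ∈ range f, e j * q ^ j)) ^ i := by
    rw [map_mul, map_sum]
    have s1 : ∀ i, π (if (∑ j ∈ range f, g ^ (i * q ^ j)) ∈ I then z ^ (b * i) else 0) =
        (t ^ (k * (p - 1) * b)) ^ i - (t ^ (k * (p - 1) * b)) ^ i *
          (∑ j ∈ range f, t ^ (i * q ^ j)) ^ M := by
      intro i
      have := hind i
      have e3 : (t ^ (k * (p - 1) * b)) ^ i = π (z ^ (b * i)) := by
        rw [map_pow, hzt, ← pow_mul, ← pow_mul]; congr 1; ring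
      rw [e3, ← mul_one_sub, this]
      split_ifs <;> simp
    simp_rw [s1]
    rw [sum_sub_distrib, hgeom, zero_sub, mul_neg]
    · congr 1
      simp_rw [Finset.sum_pow_eq_sum_piAntidiag, mul_sum]
      rw [sum_comm]
      refine sum_congr rfl fun e _ => sum_congr rfl fun i _ => ?_
      have e4 : ∏ j ∈ range f, (t ^ (i * q ^ j)) ^ e j = (t ^ (∑ j ∈ range f, e j * q ^ j)) ^ i := by
        rw [← pow_mul, sum_mul, ← prod_pow_eq_pow_sum]
        refine prod_congr rfl fun j _ => ?_
        rw [← pow_mul]; congr 1; ring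
      rw [e4, pow_add t, mul_pow, map_natCast]
      push_cast
      ring
    · rw [hk, mul_assoc, mul_comm p k]
      intro h
      have h1 := Nat.dvd_of_mul_dvd_mul_left hkpos h
      have h2 : Nat.Coprime p (p - 1) := by
        have := Nat.coprime_self_sub_right (m := 1) (n := p) hp.le
        rw [this]; simp
      exact hb (h2.dvd_of_dvd_mul_left h1)
  have hfin : π ((q : R) * ∑ i ∈ range (q ^ f - 1),
      (if (∑ j ∈ range f, g ^ (i * q ^ j)) ∈ I then z ^ (b * i) else 0)) ∈
      Ideal.map π (I ^ C) := by
    rw [hkey]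
    refine neg_mem (Ideal.sum_mem _ fun e he => ?_)
    rw [mem_piAntidiag] at he
    by_cases hd : (q ^ f - 1) ∣ k * (p - 1) * b + ∑ j ∈ range f, e j * q ^ j
    · apply Ideal.mul_mem_right
      have hmod : ∑ j ∈ range f, e j * q ^ j ≡ b * k [MOD (q ^ f - 1)] := by
        have h1 : k * (p - 1) * b + ∑ j ∈ range f, e j * q ^ j ≡ k * (p - 1) * b + b * k
            [MOD (q ^ f - 1)] := by
          refine ((Nat.modEq_zero_iff_dvd.2 hd)).trans (Nat.modEq_zero_iff_dvd.2 ?_).symm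
          rw [hk]
          refine ⟨b, ?_⟩
          obtain ⟨r, rfl⟩ : ∃ r, p = r + 1 := ⟨p - 1, by omega⟩
          simp; ring
        exact Nat.ModEq.add_left_cancel' _ h1
      obtain ⟨r, hr⟩ := key_dvd q p f k b C hk hf hC e N he.1 hmod
      rw [hr]
      have : ((q ^ C * r : ℕ) : R ⧸ I ^ (N + 1)) = π ((q : R) ^ C * r) := by simp
      rw [this]
      exact Ideal.mem_map_of_mem _ (Ideal.mul_mem_right _ _ (Ideal.pow_mem_pow hqI C))
    · rw [hgeom _ hd, mul_zero]; exact zero_mem _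
  rw [Ideal.mem_map_iff_of_surjective _ Ideal.Quotient.mk_surjective] at hfin
  obtain ⟨x, hx, hx2⟩ := hfin
  have h5 := Ideal.Quotient.eq.1 hx2
  have h6 := Ideal.pow_le_pow_right (show C ≤ N + 1 by omega) h5
  have := (I ^ C).sub_mem hx h6
  simpa using this

open Classical in
lemma gauss_eq {F : Type*} [Field F] [Fintype F] (q : ℕ) [Fact q.Prime] [Algebra (ZMod q) F]
    (χ : MulChar F ℂ) (hχ1 : χ ≠ 1) (hχ : ∀ c : ZMod q, c ≠ 0 → χ (algebraMap _ F c) = 1)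
    (ψ₀ : AddChar (ZMod q) ℂ) (hψ₀ : ψ₀.IsPrimitive) (ψ : AddChar F ℂ)
    (hψ : ∀ x, ψ x = ψ₀ (Algebra.trace (ZMod q) F x)) :
    ((q : ℂ) - 1) * gaussSum χ ψ =
      q * ∑ x : F, if Algebra.trace (ZMod q) F x = 0 then χ x else 0 := by
  have h1 : ∀ c : ZMod q, c ≠ 0 → ∑ x : F, χ x * ψ₀ (c * Algebra.trace (ZMod q) F x) =
      gaussSum χ ψ := by
    intro c hc
    have hc' : (algebraMap (ZMod q) F c) ≠ 0 := by simpa using hc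
    have := gaussSum_mulShift χ ψ (Units.mk0 _ hc')
    rw [Units.val_mk0, hχ c hc, one_mul] at this
    rw [← this, gaussSum]
    refine sum_congr rfl fun x _ => ?_
    rw [AddChar.mulShift_apply, hψ, ← Algebra.smul_def, map_smul, smul_eq_mul]
  have h2 : ∑ c : ZMod q, ∑ x : F, χ x * ψ₀ (c * Algebra.trace (ZMod q) F x) =
      q * ∑ x : F, if Algebra.trace (ZMod q) F x = 0 then χ x else 0 := by
    rw [sum_comm, mul_sum]
    refine sum_congr rfl fun x _ => ?_
    rw [← mul_sum, AddChar.sum_mulShift _ hψ₀]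
    split_ifs <;> simp [mul_comm]
  rw [← h2, ← Finset.add_sum_erase _ _ (mem_univ (0 : ZMod q))]
  have h3 : ∑ x : F, χ x * ψ₀ (0 * Algebra.trace (ZMod q) F x) = 0 := by
    simpa using MulChar.sum_eq_zero_of_ne_one hχ1
  rw [h3, zero_add, sum_congr rfl fun c hc => h1 c (Finset.ne_of_mem_erase hc)]
  rw [sum_const, card_erase_of_mem (mem_univ _), card_univ, ZMod.card, nsmul_eq_mul,
    Nat.cast_sub (Fact.out : q.Prime).one_lt.le, Nat.cast_one]

open Classical in
lemma gauss_int {F : Type*} [Field F] [Fintype F] (q : ℕ) [Fact q.Prime] [Algebra (ZMod q) F]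
    (K : Type*) [Field K] [NumberField K]
    (χ : MulChar F (𝓞 K)) (hχ1 : χ ≠ 1) (hχ : ∀ c : ZMod q, c ≠ 0 → χ (algebraMap _ F c) = 1) :
    ∃ A B : 𝓞 K,
      ((q : 𝓞 K) - 1) * A = q * (∑ x : F, if Algebra.trace (ZMod q) F x = 0 then χ x else 0) ∧
      ((q : 𝓞 K) - 1) * B = q * (∑ x : F, if Algebra.trace (ZMod q) F x = 0 then χ⁻¹ x else 0) ∧
      A * B = (Fintype.card F : 𝓞 K) := by
  have hq : 1 < q := (Fact.out : q.Prime).one_lt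
  obtain ⟨φ⟩ : Nonempty (K →+* ℂ) := inferInstance
  set ι : 𝓞 K →+* ℂ := φ.comp (algebraMap (𝓞 K) K) with hι
  have hinj : Function.Injective ι := φ.injective.comp RingOfIntegers.coe_injective
  set ψ₀ : AddChar (ZMod q) ℂ := ZMod.stdAddChar
  have hψ₀ : ψ₀.IsPrimitive := ZMod.isPrimitive_stdAddChar q
  set ψ : AddChar F ℂ := ψ₀.compAddMonoidHom (Algebra.trace (ZMod q) F).toAddMonoidHom with hψd
  have hψ : ∀ x, ψ x = ψ₀ (Algebra.trace (ZMod q) F x) := fun x => rfl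
  have hψ₀' : (ψ₀⁻¹).IsPrimitive := by
    intro a ha h
    apply hψ₀ ha
    ext x
    have := DFunLike.congr_fun h (-x)
    simpa [AddChar.mulShift_apply, AddChar.inv_apply] using this
  have hψ' : ∀ x, ψ⁻¹ x = ψ₀⁻¹ (Algebra.trace (ZMod q) F x) := fun x => by
    rw [AddChar.inv_apply, AddChar.inv_apply, hψ, map_neg]
  have hψint : ∀ x, IsIntegral ℤ (ψ x) := by
    intro x
    refine IsIntegral.of_pow (n := q) (by omega) ?_
    rw [hψ, ← AddChar.map_nsmul_eq_pow]
    simp [isIntegral_one]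
  have hqC : ((q : ℂ) - 1) ≠ 0 := by
    rw [sub_ne_zero]; exact_mod_cast hq.ne'
  have hqK : ((q : K) - 1) ≠ 0 := by
    rw [sub_ne_zero]; exact_mod_cast hq.ne'
  have main : ∀ (χ : MulChar F (𝓞 K)), χ ≠ 1 →
      (∀ c : ZMod q, c ≠ 0 → χ (algebraMap _ F c) = 1) →
      ∀ (ψ₀ : AddChar (ZMod q) ℂ), ψ₀.IsPrimitive → ∀ ψ : AddChar F ℂ,
      (∀ x, ψ x = ψ₀ (Algebra.trace (ZMod q) F x)) → (∀ x, IsIntegral ℤ (ψ x)) →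
      ∃ A : 𝓞 K, ι A = gaussSum (χ.ringHomComp ι) ψ ∧
        ((q : 𝓞 K) - 1) * A =
          q * (∑ x : F, if Algebra.trace (ZMod q) F x = 0 then χ x else 0) := by
    intro χ hχ1 hχ ψ₀ hψ₀ ψ hψ hintg
    have e1 := gauss_eq q (χ.ringHomComp ι)
      ((MulChar.ringHomComp_ne_one_iff hinj).2 hχ1)
      (fun c hc => by simp [hχ c hc]) ψ₀ hψ₀ ψ hψ
    set S := ∑ x : F, if Algebra.trace (ZMod q) F x = 0 then χ x else 0 with hS
    have e2 : (∑ x : F, if Algebra.trace (ZMod q) F x = 0 then (χ.ringHomComp ι) x else 0) = ι S := by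
      rw [hS, map_sum]
      refine sum_congr rfl fun x _ => ?_
      split_ifs <;> simp
    rw [e2] at e1
    have e3 : IsIntegral ℤ (gaussSum (χ.ringHomComp ι) ψ) := by
      rw [gaussSum]
      refine IsIntegral.sum _ fun x _ => IsIntegral.mul ?_ (hintg x)
      rw [MulChar.ringHomComp_apply]
      exact (RingOfIntegers.isIntegral (χ x)).map ι.toIntAlgHom
    have e4 : φ ((q : K) * (S : K) / ((q : K) - 1)) = gaussSum (χ.ringHomComp ι) ψ := by
      rw [map_div₀, map_mul, map_sub, map_natCast, map_one, div_eq_iff hqC, mul_comm _ ((q : ℂ) - 1),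
        e1]
      rfl
    have e5 : IsIntegral ℤ ((q : K) * (S : K) / ((q : K) - 1)) := by
      rw [← e4] at e3
      exact (isIntegral_algHom_iff φ.toIntAlgHom φ.injective).1 e3
    obtain ⟨A, hA⟩ : ∃ A : 𝓞 K, (A : K) = (q : K) * (S : K) / ((q : K) - 1) := ⟨⟨_, e5⟩, rfl⟩
    have e6 : ι A = gaussSum (χ.ringHomComp ι) ψ := by
      rw [← e4, ← hA]; rfl
    refine ⟨A, e6, ?_⟩
    apply hinj
    rw [map_mul, map_mul, map_sub, map_natCast, map_one, e6, e1]
  obtain ⟨A, hA, hA'⟩ := main χ hχ1 hχ ψ₀ hψ₀ ψ hψ hψint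
  obtain ⟨B, hB, hB'⟩ := main χ⁻¹ (inv_ne_one.2 hχ1) (fun c hc => by
    rw [MulChar.inv_apply, Ring.inverse_eq_inv']
    rw [show (algebraMap (ZMod q) F c)⁻¹ = algebraMap (ZMod q) F c⁻¹ by simp]
    exact hχ _ (inv_ne_zero hc)) ψ₀⁻¹ hψ₀' ψ⁻¹ hψ' (fun x => by
      rw [AddChar.inv_apply]; exact hψint _)
  refine ⟨A, B, hA', hB', ?_⟩
  apply hinj
  rw [map_mul, hA, hB, map_natCast, ← MulChar.ringHomComp_inv,
    gaussSum_mul_gaussSum_eq_card ((MulChar.ringHomComp_ne_one_iff hinj).2 hχ1)]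
  apply AddChar.IsPrimitive.of_ne_one
  intro h
  obtain ⟨x, hx⟩ := Algebra.trace_surjective (ZMod q) F 1
  have h1 := DFunLike.congr_fun h x
  rw [hψ, hx, AddChar.one_apply, hψ₀.zmod_char_eq_one_iff] at h1
  exact one_ne_zero h1

open Classical in
lemma sum_reindex {F R : Type*} [Field F] [Fintype F] [CommRing R] (n : ℕ) (γ : F)
    (hn : n = Fintype.card F - 1)
    (hγ : IsPrimitiveRoot γ n) (χ : MulChar F R) (P : F → Prop) :
    (∑ x : F, if P x then χ x else 0) = ∑ i ∈ (range n).filter (fun i => P (γ ^ i)), (χ γ) ^ i := by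
  have h1 : Set.InjOn (fun i => γ ^ i) (range n : Set ℕ) := by
    intro i hi j hj h
    exact hγ.pow_inj (by simpa using hi) (by simpa using hj) h
  rw [sum_filter]
  have h2 : ∑ i ∈ range n, (if P (γ ^ i) then (χ γ) ^ i else 0) =
      ∑ x ∈ (range n).image (fun i => γ ^ i), if P x then χ x else 0 := by
    rw [sum_image h1]
    refine sum_congr rfl fun i _ => ?_
    rw [map_pow]
  rw [h2]
  symm
  apply sum_subset (subset_univ _)
  intro x _ hx
  have : x = 0 := by
    by_contra h0
    apply hx
    have hn0 : NeZero n := ⟨by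
      have := Fintype.one_lt_card (α := F)
      omega⟩
    obtain ⟨i, hi, h⟩ := hγ.eq_pow_of_pow_eq_one (ξ := x) (by
      rw [hn]; exact FiniteField.pow_card_sub_one_eq_one x h0)
    exact mem_image.2 ⟨i, mem_range.2 hi, h⟩
  rw [this, MulChar.map_zero]; simp

lemma main_local (K : Type*) [Field K] [NumberField K] (𝔮 : Ideal (𝓞 K)) [𝔮.IsMaximal]
    (q p f : ℕ) [Fact q.Prime] (hp : p.Prime) (hqp : q ≠ p) (hf : 0 < f)
    (hq𝔮 : (q : 𝓞 K) ∈ 𝔮) (hcard : Nat.card (𝓞 K ⧸ 𝔮) = q ^ f)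
    (hpQ : p ∣ q ^ f - 1) (hpq : ¬ p ∣ q - 1) (ζ : 𝓞 K) (hζ : IsPrimitiveRoot ζ p) :
    ∃ (z : 𝓞 K) (s : Finset ℕ) (A B : 𝓞 K), IsPrimitiveRoot z p ∧
      ((q : 𝓞 K) - 1) * A = q * ∑ i ∈ s, z ^ i ∧
      ((q : 𝓞 K) - 1) * B = q * ∑ i ∈ s, z ^ ((p - 1) * i) ∧
      A * B = (q : 𝓞 K) ^ f ∧
      ∀ b C : ℕ, ¬ p ∣ b → ∑ j ∈ range f, (b * q ^ j) % p = p * C →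
        (q : 𝓞 K) * ∑ i ∈ s, z ^ (b * i) ∈ 𝔮 ^ C := by
  classical
  have hq : q.Prime := Fact.out
  have hQ1 : 1 < q ^ f := Nat.one_lt_pow hf.ne' hq.one_lt
  obtain ⟨k, hk⟩ := hpQ
  let : Field (𝓞 K ⧸ 𝔮) := Ideal.Quotient.field 𝔮
  have : Finite (𝓞 K ⧸ 𝔮) := Nat.finite_of_card_ne_zero (by rw [hcard]; omega)
  let : Fintype (𝓞 K ⧸ 𝔮) := Fintype.ofFinite _
  have hq0 : ((q : ℕ) : 𝓞 K ⧸ 𝔮) = 0 := by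
    rw [← map_natCast (Ideal.Quotient.mk 𝔮)]
    exact Ideal.Quotient.eq_zero_iff_mem.2 hq𝔮
  have : CharP (𝓞 K ⧸ 𝔮) q := by
    obtain ⟨r, hr⟩ := CharP.exists (𝓞 K ⧸ 𝔮)
    have h1 := (CharP.cast_eq_zero_iff (𝓞 K ⧸ 𝔮) r q).1 hq0
    rcases (Nat.dvd_prime hq).1 h1 with h | h
    · exact absurd h (CharP.char_ne_one (𝓞 K ⧸ 𝔮) r)
    · rwa [h] at hr
  let : Algebra (ZMod q) (𝓞 K ⧸ 𝔮) := ZMod.algebra _ q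
  have hcard' : Fintype.card (𝓞 K ⧸ 𝔮) = q ^ f := by rw [← hcard, Nat.card_eq_fintype_card]
  have hfr : Module.finrank (ZMod q) (𝓞 K ⧸ 𝔮) = f := by
    have := Module.card_eq_pow_finrank (K := ZMod q) (V := 𝓞 K ⧸ 𝔮)
    rw [hcard', ZMod.card] at this
    exact (Nat.pow_right_injective hq.two_le this).symm
  obtain ⟨g0, hg0⟩ := IsCyclic.exists_generator (α := (𝓞 K ⧸ 𝔮)ˣ)
  have hord : orderOf g0 = q ^ f - 1 := by
    rw [orderOf_eq_card_of_forall_mem_zpowers hg0, Nat.card_eq_fintype_card, Fintype.card_units,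
      hcard']
  have hγ : IsPrimitiveRoot (g0 : 𝓞 K ⧸ 𝔮) (q ^ f - 1) := by
    rw [IsPrimitiveRoot.coe_units_iff, ← hord]
    exact IsPrimitiveRoot.orderOf g0
  obtain ⟨g, hg⟩ := Ideal.Quotient.mk_surjective (g0 : 𝓞 K ⧸ 𝔮)
  have hgen : ∀ n : ℕ, g ^ n - 1 ∈ 𝔮 ↔ (q ^ f - 1) ∣ n := by
    intro n
    rw [← Ideal.Quotient.eq_zero_iff_mem, map_sub, map_pow, hg, map_one, sub_eq_zero]
    exact hγ.pow_eq_one_iff_dvd n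
  have htr : ∀ i : ℕ, Ideal.Quotient.mk 𝔮 (∑ j ∈ range f, g ^ (i * q ^ j)) =
      algebraMap (ZMod q) (𝓞 K ⧸ 𝔮) (Algebra.trace (ZMod q) (𝓞 K ⧸ 𝔮) ((g0 : 𝓞 K ⧸ 𝔮) ^ i)) := by
    intro i
    rw [FiniteField.algebraMap_trace_eq_sum_pow, hfr, Nat.card_zmod, map_sum]
    refine sum_congr rfl fun j _ => ?_
    rw [map_pow, hg, pow_mul]
  have htr0 : ∀ i : ℕ, (∑ j ∈ range f, g ^ (i * q ^ j)) ∈ 𝔮 ↔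
      Algebra.trace (ZMod q) (𝓞 K ⧸ 𝔮) ((g0 : 𝓞 K ⧸ 𝔮) ^ i) = 0 := by
    intro i
    rw [← Ideal.Quotient.eq_zero_iff_mem, htr]
    exact map_eq_zero _
  have hT : ∀ i : ℕ, (∑ j ∈ range f, g ^ (i * q ^ j)) ∈ 𝔮 ∨
      (∑ j ∈ range f, g ^ (i * q ^ j)) ^ (q - 1) - 1 ∈ 𝔮 := by
    intro i
    by_cases h : Algebra.trace (ZMod q) (𝓞 K ⧸ 𝔮) ((g0 : 𝓞 K ⧸ 𝔮) ^ i) = 0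
    · exact Or.inl ((htr0 i).2 h)
    · right
      rw [← Ideal.Quotient.eq_zero_iff_mem, map_sub, map_pow, htr, map_one, ← map_pow,
        ZMod.pow_card_sub_one_eq_one h, map_one, sub_self]
  have hpF : NeZero ((p : ℕ) : 𝓞 K ⧸ 𝔮) := ⟨by
    intro h
    have := (CharP.cast_eq_zero_iff (𝓞 K ⧸ 𝔮) q p).1 h
    exact hqp ((Nat.prime_dvd_prime_iff_eq hq hp).1 this)⟩
  have hy : IsPrimitiveRoot (Ideal.Quotient.mk 𝔮 ζ) p := by
    rw [← Polynomial.isRoot_cyclotomic_iff]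
    have h1 := hζ.isRoot_cyclotomic hp.pos
    rw [← Polynomial.map_cyclotomic p (Ideal.Quotient.mk 𝔮)]
    exact h1.map
  have hkpos : 0 < k := by
    rcases Nat.eq_zero_or_pos k with h | h
    · subst h; omega
    · exact h
  have : NeZero p := ⟨hp.ne_zero⟩
  obtain ⟨u, hu, hzu⟩ := hy.eq_pow_of_pow_eq_one (ξ := (g0 : 𝓞 K ⧸ 𝔮) ^ (k * (p - 1))) (by
    rw [← pow_mul, hγ.pow_eq_one_iff_dvd, hk]
    exact ⟨p - 1, by ring⟩)
  set z := ζ ^ u with hz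
  have hzp : z ^ p = 1 := by rw [hz, ← pow_mul, mul_comm, pow_mul, hζ.pow_eq_one, one_pow]
  have hzmk : Ideal.Quotient.mk 𝔮 z = (g0 : 𝓞 K ⧸ 𝔮) ^ (k * (p - 1)) := by
    rw [hz, map_pow, hzu]
  have hz1 : z ≠ 1 := by
    intro h
    rw [h, map_one] at hzmk
    have := (hγ.pow_eq_one_iff_dvd _).1 hzmk.symm
    rw [hk, mul_comm p k] at this
    have h2 := Nat.le_of_dvd (by have := hp.two_le; omega) (Nat.dvd_of_mul_dvd_mul_left hkpos this)
    have := hp.two_le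
    omega
  have : Fact p.Prime := ⟨hp⟩
  have hzprim : IsPrimitiveRoot z p := by
    rw [← orderOf_eq_prime hzp hz1]
    exact IsPrimitiveRoot.orderOf z
  have hzI : z - g ^ (k * (p - 1)) ∈ 𝔮 := by
    rw [← Ideal.Quotient.eq_zero_iff_mem, map_sub, hzmk, map_pow, hg, sub_self]
  have hzu : (Units.mkOfMulEqOne z (z ^ (p - 1)) (by
      rw [← pow_succ', Nat.sub_add_cancel hp.one_lt.le, hzp]) : (𝓞 K)ˣ) ∈
      rootsOfUnity (Fintype.card (𝓞 K ⧸ 𝔮)ˣ) (𝓞 K) := by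
    rw [mem_rootsOfUnity]
    ext
    rw [Fintype.card_units, hcard', hk, Units.val_pow_eq_pow_val, Units.val_mkOfMulEqOne,
      pow_mul, hzp, one_pow, Units.val_one]
  set χ := MulChar.ofRootOfUnity hzu hg0 with hχd
  have hχg : χ (g0 : 𝓞 K ⧸ 𝔮) = z := by
    rw [hχd, MulChar.ofRootOfUnity_spec]; rfl
  have hχ1 : χ ≠ 1 := by
    intro h
    rw [h, MulChar.one_apply_coe] at hχg
    exact hz1 hχg.symm
  have hχinv : χ⁻¹ (g0 : 𝓞 K ⧸ 𝔮) = z ^ (p - 1) := by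
    have h1 : χ⁻¹ (g0 : 𝓞 K ⧸ 𝔮) * z = 1 := by
      rw [← hχg, ← MulChar.mul_apply, inv_mul_cancel, MulChar.one_apply_coe]
    have h2 : z * z ^ (p - 1) = 1 := by
      rw [← pow_succ', Nat.sub_add_cancel hp.one_lt.le, hzp]
    calc _ = χ⁻¹ (g0 : 𝓞 K ⧸ 𝔮) * (z * z ^ (p - 1)) := by rw [h2, mul_one]
      _ = _ := by rw [← mul_assoc, h1, one_mul]
  have hχc : ∀ c : ZMod q, c ≠ 0 → χ (algebraMap _ (𝓞 K ⧸ 𝔮) c) = 1 := by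
    intro c hc
    have hc0 : algebraMap _ (𝓞 K ⧸ 𝔮) c ≠ 0 := by simpa using hc
    have h1 : (χ (algebraMap _ (𝓞 K ⧸ 𝔮) c)) ^ (q - 1) = 1 := by
      rw [← map_pow, ← map_pow, ZMod.pow_card_sub_one_eq_one hc, map_one, map_one]
    have h2 : (χ (algebraMap _ (𝓞 K ⧸ 𝔮) c)) ^ p = 1 := by
      have : NeZero (q ^ f - 1) := ⟨by omega⟩
      obtain ⟨i, -, hi⟩ := hγ.eq_pow_of_pow_eq_one (ξ := algebraMap _ (𝓞 K ⧸ 𝔮) c) (by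
        rw [← hcard']; exact FiniteField.pow_card_sub_one_eq_one _ hc0)
      rw [← hi, map_pow, hχg, ← pow_mul, mul_comm, pow_mul, hzp, one_pow]
    have h3 := pow_gcd_eq_one.2 ⟨h2, h1⟩
    rwa [(Nat.Prime.coprime_iff_not_dvd hp).2 hpq, pow_one] at h3
  obtain ⟨A, B, hA, hB, hAB⟩ := gauss_int q K χ hχ1 hχc
  refine ⟨z, (range (q ^ f - 1)).filter (fun i => (∑ j ∈ range f, g ^ (i * q ^ j)) ∈ 𝔮), A, B,
    hzprim, ?_, ?_, ?_, ?_⟩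
  · rw [hA]
    have := sum_reindex (q ^ f - 1) _ (by rw [hcard']) hγ χ
      (fun x => Algebra.trace (ZMod q) (𝓞 K ⧸ 𝔮) x = 0)
    rw [hχg] at this
    simp_rw [htr0]
    convert congrArg (fun x => (q : 𝓞 K) * x) this
  · rw [hB]
    have := sum_reindex (q ^ f - 1) _ (by rw [hcard']) hγ χ⁻¹
      (fun x => Algebra.trace (ZMod q) (𝓞 K ⧸ 𝔮) x = 0)
    rw [hχinv] at this
    simp_rw [htr0, pow_mul]
    convert congrArg (fun x => (q : 𝓞 K) * x) this
  · rw [hAB, hcard']; push_cast; rfl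
  · intro b C hb hC
    rw [sum_filter]
    have := local_bound 𝔮 q p f k b C hp.one_lt hk hf hq𝔮 g z hgen hzp hzI hT hb hC
    convert this

lemma vn_eq (p : ℕ) [Fact p.Prime] (v : ℕ) (hv0 : (v : ZMod p) ≠ 0) (vn : ℤ → ℕ)
    (hvn0 : vn 0 = 1)
    (hvnrec : ∀ n : ℤ, (vn (n + 1) : ZMod p) = (v : ZMod p) * (vn n : ZMod p)) (n : ℤ) :
    (vn n : ZMod p) = (v : ZMod p) ^ n := by
  induction n using Int.induction_on with
  | zero => simp [hvn0]
  | succ n ih => rw [hvnrec, ih, zpow_add_one₀ hv0, mul_comm]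
  | pred n ih =>
    have := hvnrec (-(n : ℤ) - 1)
    rw [sub_add_cancel, ih] at this
    rw [zpow_sub_one₀ hv0, this, mul_comm, ← mul_assoc, inv_mul_cancel₀ hv0, one_mul]

lemma sum_pow_prim {F M : Type*} [Field F] [AddCommMonoid M] (f : ℕ) (hf : 0 < f) (a b : F)
    (ha : IsPrimitiveRoot a f) (hb : IsPrimitiveRoot b f) (φ : F → M) :
    ∑ j ∈ range f, φ (a ^ j) = ∑ j ∈ range f, φ (b ^ j) := by
  classical
  have : NeZero f := ⟨hf.ne'⟩
  have key : ∀ a b : F, IsPrimitiveRoot a f → IsPrimitiveRoot b f →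
      (range f).image (fun j => a ^ j) ⊆ (range f).image (fun j => b ^ j) := by
    intro a b ha hb x hx
    obtain ⟨j, -, rfl⟩ := mem_image.1 hx
    obtain ⟨i, hi, h⟩ := hb.eq_pow_of_pow_eq_one (ξ := a ^ j) (by
      rw [← pow_mul, mul_comm, pow_mul, ha.pow_eq_one, one_pow])
    exact mem_image.2 ⟨i, mem_range.2 hi, h⟩
  have him : ∀ a : F, IsPrimitiveRoot a f →
      ∑ x ∈ (range f).image (fun j => a ^ j), φ x = ∑ j ∈ range f, φ (a ^ j) := by
    intro a ha
    rw [sum_image]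
    intro i hi j hj h
    exact ha.pow_inj (by simpa using hi) (by simpa using hj) h
  rw [← him a ha, ← him b hb, (key a b ha hb).antisymm (key b a hb ha)]

lemma coset_sum (p : ℕ) [Fact p.Prime] (v : ℕ) (hv0 : (v : ZMod p) ≠ 0)
    (hv : orderOf (v : ZMod p) = p - 1) (vn : ℤ → ℕ) (hlt : ∀ n, vn n < p)
    (hvn : ∀ n : ℤ, (vn n : ZMod p) = (v : ZMod p) ^ n)
    (q f m : ℕ) (hf0 : 0 < f) (hf : f = orderOf (q : ZMod p)) (hm : p - 1 = m * f) (i : ℕ) :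
    ∑ j ∈ range f, (vn (-(i : ℤ)) * q ^ j) % p =
      ∑ j ∈ range f, vn (-((i : ℤ) + (j : ℤ) * (m : ℤ))) := by
  have hp1 : 1 < p := (Fact.out : p.Prime).one_lt
  have h1 : IsPrimitiveRoot (q : ZMod p) f := hf ▸ IsPrimitiveRoot.orderOf _
  have h2 : IsPrimitiveRoot (((v : ZMod p) ^ m)⁻¹) f := by
    have : IsPrimitiveRoot (v : ZMod p) (p - 1) := hv ▸ IsPrimitiveRoot.orderOf _
    exact (this.pow (by omega) hm).inv
  have h3 := sum_pow_prim f hf0 _ _ h1 h2 (fun x => ((v : ZMod p) ^ (-(i : ℤ)) * x).val)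
  calc _ = ∑ j ∈ range f, ((v : ZMod p) ^ (-(i : ℤ)) * (q : ZMod p) ^ j).val := by
        refine sum_congr rfl fun j _ => ?_
        rw [← ZMod.val_natCast, Nat.cast_mul, hvn, Nat.cast_pow]
    _ = _ := h3
    _ = _ := by
        refine sum_congr rfl fun j _ => ?_
        rw [← ZMod.val_natCast_of_lt (hlt (-((i : ℤ) + (j : ℤ) * (m : ℤ)))), hvn]
        congr 1
        rw [neg_add, zpow_add₀ hv0]
        congr 1
        rw [inv_pow, ← pow_mul, ← zpow_natCast, ← zpow_neg]
        congr 1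
        push_cast
        ring

lemma neg_sum (p q f a : ℕ) (hp : p.Prime) (hqp : ¬ p ∣ q) (ha : 1 ≤ a) (hap : a < p) :
    ∑ j ∈ range f, ((p - a) * q ^ j) % p + ∑ j ∈ range f, (a * q ^ j) % p = p * f := by
  rw [← sum_add_distrib, sum_congr rfl (g := fun _ => p)]
  · simp [mul_comm]
  · intro j _
    have h1 : ¬ p ∣ a * q ^ j := by
      rw [hp.dvd_mul]
      rintro (h | h)
      · exact absurd (Nat.le_of_dvd (by omega) h) (by omega)
      · exact hqp (hp.dvd_of_dvd_pow h)
    have h2 : (p - a) * q ^ j + a * q ^ j = p * q ^ j := by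
      rw [← add_mul]; congr 1; omega
    have h3 : p ∣ ((p - a) * q ^ j) % p + (a * q ^ j) % p := by
      rw [Nat.dvd_iff_mod_eq_zero, ← Nat.add_mod, h2]; simp
    have h4 := Nat.mod_lt ((p - a) * q ^ j) hp.pos
    have h5 := Nat.mod_lt (a * q ^ j) hp.pos
    have h6 : (a * q ^ j) % p ≠ 0 := fun h => h1 (Nat.dvd_of_mod_eq_zero h)
    obtain ⟨r, hr⟩ := h3
    have : r = 1 := by
      have h7 : p * r < p * 2 := by omega
      have h8 : 0 < p * r := by omega
      have := Nat.lt_of_mul_lt_mul_left h7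
      have := Nat.pos_of_mul_pos_left h8
      omega
    rw [hr, this, mul_one]

lemma frob_of_fix {R : Type*} [CommRing R] (𝔮 : Ideal R) [𝔮.IsMaximal]
    [Finite (R ⧸ 𝔮)] (q p : ℕ) [Fact q.Prime] (hp : p.Prime) (hqp : q ≠ p)
    (hq𝔮 : (q : R) ∈ 𝔮) (z : R) (hz : IsPrimitiveRoot z p) [IsDomain R]
    (ρ : R ≃+* R) (hρ : 𝔮 = 𝔮.map (ρ : R →+* R)) (n : ℕ) (hn : ρ z = z ^ n) :
    ∃ j : ℕ, (n : ZMod p) = (q : ZMod p) ^ j := by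
  have hq : q.Prime := Fact.out
  let : Field (R ⧸ 𝔮) := Ideal.Quotient.field 𝔮
  let : Fintype (R ⧸ 𝔮) := Fintype.ofFinite _
  have hq0 : ((q : ℕ) : R ⧸ 𝔮) = 0 := by
    rw [← map_natCast (Ideal.Quotient.mk 𝔮)]
    exact Ideal.Quotient.eq_zero_iff_mem.2 hq𝔮
  have : CharP (R ⧸ 𝔮) q := by
    obtain ⟨r, hr⟩ := CharP.exists (R ⧸ 𝔮)
    have h1 := (CharP.cast_eq_zero_iff (R ⧸ 𝔮) r q).1 hq0
    rcases (Nat.dvd_prime hq).1 h1 with h | h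
    · exact absurd h (CharP.char_ne_one (R ⧸ 𝔮) r)
    · rwa [h] at hr
  let : Algebra (ZMod q) (R ⧸ 𝔮) := ZMod.algebra _ q
  have hpF : NeZero ((p : ℕ) : R ⧸ 𝔮) := ⟨by
    intro h
    have := (CharP.cast_eq_zero_iff (R ⧸ 𝔮) q p).1 h
    exact hqp ((Nat.prime_dvd_prime_iff_eq hq hp).1 this)⟩
  have hy : IsPrimitiveRoot (Ideal.Quotient.mk 𝔮 z) p := by
    rw [← Polynomial.isRoot_cyclotomic_iff]
    have h1 := hz.isRoot_cyclotomic hp.pos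
    rw [← Polynomial.map_cyclotomic p (Ideal.Quotient.mk 𝔮)]
    exact h1.map
  let τ : (R ⧸ 𝔮) ≃+* (R ⧸ 𝔮) := Ideal.quotientEquiv 𝔮 𝔮 ρ hρ
  let τ' : (R ⧸ 𝔮) ≃ₐ[ZMod q] (R ⧸ 𝔮) := AlgEquiv.ofRingEquiv (f := τ) (fun r => by
    have := RingHom.congr_fun (Subsingleton.elim ((τ : (R ⧸ 𝔮) →+* (R ⧸ 𝔮)).comp
      (algebraMap (ZMod q) (R ⧸ 𝔮))) (algebraMap (ZMod q) (R ⧸ 𝔮))) r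
    exact this)
  obtain ⟨j, hj⟩ := (FiniteField.bijective_frobeniusAlgEquivOfAlgebraic_pow
    (ZMod q) (R ⧸ 𝔮)).2 τ'
  refine ⟨j, ?_⟩
  have h1 : τ' (Ideal.Quotient.mk 𝔮 z) = (Ideal.Quotient.mk 𝔮 z) ^ n := by
    change τ (Ideal.Quotient.mk 𝔮 z) = _
    rw [Ideal.quotientEquiv_mk, hn, map_pow]
  rw [← hj] at h1
  simp only [AlgEquiv.coe_pow, FiniteField.coe_frobeniusAlgEquivOfAlgebraic_iterate,
    ZMod.card] at h1
  have h2 := (hy.isOfFinOrder hp.ne_zero).pow_eq_pow_iff_modEq.1 h1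
  rw [← hy.eq_orderOf] at h2
  have := (ZMod.natCast_eq_natCast_iff _ _ _).2 h2
  rw [← this]; push_cast; rfl

lemma assemble {R : Type*} [CommRing R] [IsDedekindDomain R] [Module.Free ℤ R]
    [Module.Finite ℤ R] (P : ℕ → Ideal R) (m f q : ℕ) (hq : 0 < q) (A B : R) (c : ℕ → ℕ)
    (hcf : ∀ i < m, c i ≤ f) (hmax : ∀ i < m, (P i).IsMaximal)
    (hinj : ∀ i < m, ∀ j < m, i < j → P i ≠ P j) (hnorm : ∀ i < m, (P i).absNorm = q ^ f)
    (hA : ∀ i < m, A ∈ P i ^ c i) (hB : ∀ i < m, B ∈ P i ^ (f - c i))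
    (hAB : A * B = (q : R) ^ f)
    (hN : (Ideal.span {(q : R) ^ f}).absNorm = q ^ (f * (m * f))) :
    (∏ i ∈ range m, P i ^ c i).IsPrincipal := by
  have hne : ∀ i < m, ∀ j < m, i ≠ j → P i ≠ P j := by
    intro i hi j hj hij
    rcases lt_or_gt_of_ne hij with h | h
    · exact hinj i hi j hj h
    · exact (hinj j hj i hi h).symm
  have hdvd : ∀ (e : ℕ → ℕ) (x : R), (∀ i < m, x ∈ P i ^ e i) →
      ∏ i ∈ range m, P i ^ e i ∣ Ideal.span {x} := by
    intro e x hx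
    apply Finset.prod_dvd_of_coprime
    · intro i hi j hj hij
      have hi' : i < m := by simpa using hi
      have hj' : j < m := by simpa using hj
      have := hmax i hi'
      have := hmax j hj'
      apply IsCoprime.pow
      rw [Ideal.isCoprime_iff_sup_eq]
      exact Ideal.IsMaximal.coprime_of_ne (hmax i hi') (hmax j hj') (hne i hi' j hj' hij)
    · intro i hi
      rw [Ideal.dvd_span_singleton]
      exact hx i (by simpa using hi)
  obtain ⟨X, hX⟩ := hdvd c A hA
  obtain ⟨Y, hY⟩ := hdvd (fun i => f - c i) B hB
  have h1 : Ideal.span {(q : R) ^ f} = (∏ i ∈ range m, P i ^ f) * (X * Y) := by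
    rw [← hAB, ← Ideal.span_singleton_mul_span_singleton, hX, hY, mul_mul_mul_comm,
      ← prod_mul_distrib]
    congr 1
    refine prod_congr rfl fun i hi => ?_
    rw [← pow_add, Nat.add_sub_cancel' (hcf i (by simpa using hi))]
  have h2 : (∏ i ∈ range m, P i ^ f).absNorm = q ^ (f * (m * f)) := by
    rw [map_prod, prod_congr rfl (g := fun _ => q ^ (f * f))]
    · rw [prod_const, card_range, ← pow_mul]; congr 1; ring
    · intro i hi
      rw [map_pow, hnorm i (by simpa using hi), ← pow_mul]
  have h3 : (X * Y).absNorm = 1 := by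
    have := congrArg Ideal.absNorm h1
    rw [map_mul, hN, h2] at this
    exact Nat.eq_of_mul_eq_mul_left (pow_pos hq _) (by rw [← this, mul_one])
  rw [map_mul] at h3
  have h4 : X = ⊤ := Ideal.absNorm_eq_one_iff.1 (Nat.eq_one_of_mul_eq_one_right h3)
  rw [h4, Ideal.mul_top] at hX
  rw [← hX]
  exact ⟨⟨A, rfl⟩⟩

lemma map_equiv_isMaximal {R : Type*} [CommRing R] (e : R ≃+* R) (I : Ideal R)
    [I.IsMaximal] : (Ideal.map e I).IsMaximal :=
  Ideal.map_isMaximal_of_equiv e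

lemma map_equiv_absNorm {R : Type*} [CommRing R] [IsDedekindDomain R] [Module.Free ℤ R]
    (e : R ≃+* R) (I : Ideal R) :
    (Ideal.map e I).absNorm = I.absNorm := by
  rw [Ideal.absNorm_apply, Ideal.absNorm_apply, Submodule.cardQuot_apply,
    Submodule.cardQuot_apply]
  exact (Nat.card_congr (Ideal.quotientEquiv I (Ideal.map e I) e rfl).toEquiv).symm

lemma q_card (p : ℕ) (hp : p.Prime) (K : Type*) [Field K] [NumberField K]
    [IsCyclotomicExtension {p} ℚ K] (q : ℕ) (hq : q.Prime) (hqp : q ≠ p)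
    (𝔮 : Ideal (𝓞 K)) [𝔮.IsPrime] (h𝔮q : ((q : 𝓞 K)) ∈ 𝔮) :
    𝔮.absNorm = q ^ orderOf (q : ZMod p) := by
  have : Fact q.Prime := ⟨hq⟩
  have : NeZero p := ⟨hp.ne_zero⟩
  have hlo : 𝔮.LiesOver (Ideal.span {(q : ℤ)}) := by
    rw [Ideal.liesOver_iff]
    have hmx : (Ideal.span {(q : ℤ)}).IsMaximal :=
      Int.ideal_span_isMaximal_of_prime q
    refine hmx.eq_of_le ?_ ?_
    · exact Ideal.comap_ne_top _ (Ideal.IsPrime.ne_top ‹_›)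
    · rw [Ideal.span_singleton_le_iff_mem, Ideal.mem_comap]
      simpa using h𝔮q
  have hnd : ¬ q ∣ p := fun h => hqp ((Nat.prime_dvd_prime_iff_eq hq hp).1 h)
  rw [← IsCyclotomicExtension.Rat.inertiaDeg_eq_of_not_dvd q K 𝔮 hnd, Ideal.pow_inertiaDeg]

lemma norm_q (p : ℕ) (hp : p.Prime) (K : Type*) [Field K] [NumberField K]
    [IsCyclotomicExtension {p} ℚ K] (q f : ℕ) :
    (Ideal.span {(q : 𝓞 K) ^ f}).absNorm = q ^ (f * (p - 1)) := by
  have : NeZero p := ⟨hp.ne_zero⟩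
  have h1 : Module.finrank ℤ (𝓞 K) = p - 1 := by
    rw [RingOfIntegers.rank, IsCyclotomicExtension.finrank (n := p) K
      (Polynomial.cyclotomic.irreducible_rat hp.pos), Nat.totient_prime hp]
  rw [Ideal.absNorm_span_singleton]
  have h2 : (q : 𝓞 K) ^ f = algebraMap ℤ (𝓞 K) ((q : ℤ) ^ f) := by simp
  rw [h2, Algebra.norm_algebraMap, h1, ← pow_mul]
  simp [Int.natAbs_pow]

lemma sigma_pow (p : ℕ) (hp : p.Prime) (v : ℕ) (K : Type*) [Field K] [NumberField K]
    (ζ : K) (hζ : IsPrimitiveRoot ζ p) (σ : K ≃ₐ[ℚ] K) (hσ : σ ζ = ζ ^ v)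
    (σ' : ℕ → (𝓞 K ≃+* 𝓞 K))
    (hσ' : ∀ (i : ℕ) (x : 𝓞 K),
      algebraMap (𝓞 K) K (σ' i x) = (σ ^ i) (algebraMap (𝓞 K) K x))
    (z : 𝓞 K) (hz : z ^ p = 1) (i : ℕ) : σ' i z = z ^ v ^ i := by
  have : NeZero p := ⟨hp.ne_zero⟩
  apply RingOfIntegers.ext
  have h1 : (algebraMap (𝓞 K) K z) ^ p = 1 := by rw [← map_pow, hz, map_one]
  obtain ⟨u, -, hu⟩ := hζ.eq_pow_of_pow_eq_one h1
  have h2 : ∀ i, (σ ^ i) ζ = ζ ^ v ^ i := by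
    intro i
    induction i with
    | zero => simp
    | succ i ih => rw [pow_succ', AlgEquiv.mul_apply, ih, map_pow, hσ, ← pow_mul, pow_succ']
  change algebraMap (𝓞 K) K _ = algebraMap (𝓞 K) K _
  rw [hσ', ← hu, map_pow, h2, map_pow, ← hu, ← pow_mul, ← pow_mul, mul_comm]

end Stick

theorem statement8
    (p : ℕ) (hp : p.Prime) (hp2 : p ≠ 2)
    (v : ℕ) (hv1 : 1 ≤ v) (hv2 : v ≤ p - 1)
    (hv : orderOf (v : ZMod p) = p - 1)
    (vn : ℤ → ℕ)
    (hvn1 : ∀ n : ℤ, 1 ≤ vn n) (hvn2 : ∀ n : ℤ, vn n ≤ p - 1)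
    (hvn0 : vn 0 = 1)
    (hvnrec : ∀ n : ℤ, (vn (n + 1) : ZMod p) = (v : ZMod p) * (vn n : ZMod p))
    (K : Type*) [Field K] [NumberField K]
    [IsCyclotomicExtension {p} ℚ K]
    (ζ : K) (hζ : IsPrimitiveRoot ζ p)
    (σ : K ≃ₐ[ℚ] K) (hσ : σ ζ = ζ ^ v)
    (q : ℕ) (hq : q.Prime) (hqodd : q ≠ 2) (hqp : q ≠ p)
    (f : ℕ) (hf : f = orderOf ((q : ZMod p))) (hf1 : 1 < f)
    (m : ℕ) (hm : m = (p - 1) / f)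
    (𝔮 : Ideal (𝓞 K)) (h𝔮prime : 𝔮.IsPrime) (h𝔮0 : 𝔮 ≠ ⊥)
    (h𝔮q : ((q : 𝓞 K)) ∈ 𝔮)
    (c : ℕ → ℤ)
    (hc : ∀ i : ℕ, (p : ℤ) * c i =
      ∑ j ∈ Finset.range f, (vn (-((i : ℤ) + (j : ℤ) * (m : ℤ))) : ℤ))
    (σ' : ℕ → (𝓞 K ≃+* 𝓞 K))
    (hσ' : ∀ (i : ℕ) (x : 𝓞 K),
      algebraMap (𝓞 K) K (σ' i x) = (σ ^ i) (algebraMap (𝓞 K) K x)) :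
    (∏ i ∈ Finset.range m, (Ideal.map (σ' i) 𝔮) ^ (c i).toNat).IsPrincipal := by
  have : Fact p.Prime := ⟨hp⟩
  have : Fact q.Prime := ⟨hq⟩
  have : NeZero p := ⟨hp.ne_zero⟩
  have hp1 := hp.one_lt
  have h𝔮max : 𝔮.IsMaximal := h𝔮prime.isMaximal h𝔮0
  have hpq : ¬ p ∣ q := fun h => hqp ((Nat.prime_dvd_prime_iff_eq hp hq).1 h).symm
  have hv0 : (v : ZMod p) ≠ 0 := by
    rw [Ne, ZMod.natCast_eq_zero_iff]
    intro h
    exact absurd (Nat.le_of_dvd (by omega) h) (by omega)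
  have hq0 : (q : ZMod p) ≠ 0 := by rwa [Ne, ZMod.natCast_eq_zero_iff]
  have hfd : f ∣ p - 1 := by
    rw [hf]; exact orderOf_dvd_of_pow_eq_one (ZMod.pow_card_sub_one_eq_one hq0)
  have hmf : p - 1 = m * f := by rw [hm, Nat.div_mul_cancel hfd]
  have hvn := Stick.vn_eq p v hv0 vn hvn0 hvnrec
  have hlt : ∀ n, vn n < p := fun n => by have := hvn2 n; omega
  have hnorm : 𝔮.absNorm = q ^ f := by rw [hf]; exact Stick.q_card p hp K q hq hqp 𝔮 h𝔮q
  have hcard : Nat.card (𝓞 K ⧸ 𝔮) = q ^ f := by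
    rw [← hnorm, Ideal.absNorm_apply, Submodule.cardQuot_apply]
  have : Finite (𝓞 K ⧸ 𝔮) :=
    Nat.finite_of_card_ne_zero (by rw [hcard]; exact (pow_pos hq.pos _).ne')
  have hcast : ∀ k, p ∣ q ^ k - 1 ↔ (q : ZMod p) ^ k = 1 := by
    intro k
    rw [← ZMod.natCast_eq_zero_iff, Nat.cast_sub (Nat.one_le_pow _ _ hq.pos), sub_eq_zero]
    simp
  have hpQ : p ∣ q ^ f - 1 := by rw [hcast, hf, pow_orderOf_eq_one]
  have hpq1 : ¬ p ∣ q - 1 := by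
    intro h
    have h1 : (q : ZMod p) ^ 1 = 1 := (hcast 1).1 (by simpa using h)
    have := Nat.le_of_dvd one_pos (orderOf_dvd_of_pow_eq_one h1)
    omega
  obtain ⟨z, s, A, B, hz, hA, hB, hAB, hloc⟩ := Stick.main_local K 𝔮 q p f hp hqp (by omega)
    h𝔮q hcard hpQ hpq1 hζ.toInteger hζ.toInteger_isPrimitiveRoot
  have hσz : ∀ i, σ' i z = z ^ v ^ i :=
    Stick.sigma_pow p hp v K ζ hζ σ hσ σ' hσ' z hz.pow_eq_one
  have hzpow : ∀ a b : ℕ, (a : ZMod p) = (b : ZMod p) → z ^ a = z ^ b := by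
    intro a b h
    rw [(hz.isOfFinOrder hp.ne_zero).pow_eq_pow_iff_modEq, ← hz.eq_orderOf]
    exact (ZMod.natCast_eq_natCast_iff _ _ _).1 h
  have hmax : ∀ i, (Ideal.map (σ' i) 𝔮).IsMaximal := fun i =>
    Stick.map_equiv_isMaximal (σ' i) 𝔮
  have hcs : ∀ i : ℕ, ∑ j ∈ range f, (vn (-(i : ℤ)) * q ^ j) % p = p * (c i).toNat := by
    intro i
    rw [Stick.coset_sum p v hv0 hv vn hlt hvn q f m (by omega) hf hmf i]
    have h1 := hc i
    have h2 : 0 ≤ c i := by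
      have : 0 ≤ (p : ℤ) * c i := by rw [h1]; positivity
      exact nonneg_of_mul_nonneg_right this (by exact_mod_cast hp.pos)
    zify
    rw [Int.toNat_of_nonneg h2, h1]
  have hns : ∀ i : ℕ, ∑ j ∈ range f, ((p - vn (-(i : ℤ))) * q ^ j) % p + p * (c i).toNat
      = p * f := by
    intro i
    rw [← hcs i]
    exact Stick.neg_sum p q f _ hp hpq (hvn1 _) (hlt _)
  have hcf : ∀ i, (c i).toNat ≤ f := fun i =>
    Nat.le_of_mul_le_mul_left (by rw [← hns i]; exact Nat.le_add_left _ _) hp.pos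
  have hns' : ∀ i : ℕ, ∑ j ∈ range f, ((p - vn (-(i : ℤ))) * q ^ j) % p
      = p * (f - (c i).toNat) := by
    intro i
    have := hns i
    rw [Nat.mul_sub]
    omega
  have hqP : ∀ i, ((q : 𝓞 K) - 1) ∉ Ideal.map (σ' i) 𝔮 := by
    intro i h
    have h1 : (q : 𝓞 K) ∈ Ideal.map (σ' i) 𝔮 := by
      have := Ideal.mem_map_of_mem (σ' i) h𝔮q
      rwa [map_natCast] at this
    apply (hmax i).ne_top
    rw [Ideal.eq_top_iff_one]
    simpa using Ideal.sub_mem _ h1 h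
  have htrans : ∀ (i b b₁ C : ℕ), ¬ p ∣ b → ((v ^ i * b : ℕ) : ZMod p) = (b₁ : ZMod p) →
      ∑ j ∈ range f, (b * q ^ j) % p = p * C →
      (q : 𝓞 K) * ∑ k ∈ s, z ^ (b₁ * k) ∈ Ideal.map (σ' i) 𝔮 ^ C := by
    intro i b b₁ C hb hbb hC
    have h1 := Ideal.mem_map_of_mem (σ' i) (hloc b C hb hC)
    rw [Ideal.map_pow, map_mul, map_natCast, map_sum] at h1
    convert h1 using 3 with k hk
    rw [map_pow, hσz, ← pow_mul, ← mul_assoc]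
    apply hzpow
    rw [Nat.cast_mul, Nat.cast_mul (v ^ i * b), hbb]
  have hvi : ∀ i : ℕ, ((v ^ i * vn (-(i : ℤ)) : ℕ) : ZMod p) = 1 := by
    intro i
    rw [Nat.cast_mul, hvn, Nat.cast_pow, zpow_neg, zpow_natCast,
      mul_inv_cancel₀ (pow_ne_zero _ hv0)]
  have hcancel : ∀ (i C : ℕ) (x : 𝓞 K), ((q : 𝓞 K) - 1) * x ∈ Ideal.map (σ' i) 𝔮 ^ C →
      x ∈ Ideal.map (σ' i) 𝔮 ^ C := by
    intro i C x h
    have := (hmax i).isPrime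
    exact (Ideal.IsPrime.mul_mem_pow _ h).resolve_left (hqP i)
  refine Stick.assemble (fun i => Ideal.map (σ' i) 𝔮) m f q hq.pos A B (fun i => (c i).toNat)
    (fun i _ => hcf i) (fun i _ => hmax i) ?_ (fun i _ => ?_) (fun i _ => ?_) (fun i _ => ?_)
    hAB (by rw [Stick.norm_q p hp K q f, hmf])
  · intro i hi j hj hij heq
    obtain ⟨d, rfl⟩ : ∃ d, j = i + d := ⟨j - i, by omega⟩
    let ρ : 𝓞 K ≃+* 𝓞 K := (σ' (i + d)).trans (σ' i).symm
    have h1 : ρ z = z ^ v ^ d := by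
      change (σ' i).symm (σ' (i + d) z) = _
      rw [RingEquiv.symm_apply_eq, map_pow, hσz, hσz, ← pow_mul, pow_add]
    have h2 : 𝔮 = 𝔮.map (ρ : 𝓞 K →+* 𝓞 K) := by
      have h3 : Ideal.map (σ' i).symm (Ideal.map (σ' i) 𝔮) = 𝔮 := Ideal.map_of_equiv (σ' i)
      have heq' : Ideal.map (σ' i) 𝔮 = Ideal.map (σ' (i + d)) 𝔮 := heq
      rw [heq'] at h3
      conv_lhs => rw [← h3]
      exact Ideal.map_map (σ' (i + d) : 𝓞 K →+* 𝓞 K) ((σ' i).symm : 𝓞 K →+* 𝓞 K)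
    obtain ⟨e, he⟩ := Stick.frob_of_fix 𝔮 q p hp hqp h𝔮q z hz ρ h2 (v ^ d) h1
    have h4 : (v : ZMod p) ^ (d * f) = 1 := by
      rw [pow_mul, ← Nat.cast_pow, he, ← pow_mul, mul_comm, pow_mul, hf, pow_orderOf_eq_one,
        one_pow]
    have h5 := orderOf_dvd_of_pow_eq_one h4
    rw [hv, hmf] at h5
    have h6 := Nat.dvd_of_mul_dvd_mul_right (by omega) h5
    have := Nat.le_of_dvd (by omega) h6
    omega
  · exact (Stick.map_equiv_absNorm (σ' i) 𝔮).trans hnorm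
  · apply hcancel
    rw [hA]
    have := htrans i (vn (-(i : ℤ))) 1 _ (fun h => absurd (Nat.le_of_dvd (hvn1 _) h)
      (by have := hlt (-(i : ℤ)); omega)) (by rw [hvi, Nat.cast_one]) (hcs i)
    simpa using this
  · apply hcancel
    rw [hB]
    refine htrans i (p - vn (-(i : ℤ))) (p - 1) _ (fun h => absurd (Nat.le_of_dvd (by
      have := hlt (-(i : ℤ)); omega) h) (by
      have := hvn1 (-(i : ℤ)); have := hlt (-(i : ℤ)); omega)) ?_ (hns' i)
    have h := hvi i
    push_cast at h
    rw [Nat.cast_mul, Nat.cast_sub (hlt _).le, Nat.cast_sub hp1.le, mul_sub]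
    simp [h]
end

section
/- Let q be an odd prime, q ≠ p, let f > 1 be the multiplicative order of q modulo p and m = (p−1)/f, let 𝔮 be a prime ideal of O_K lying over q, and set c_i = (Σ_{j=0}^{f-1} v_{-(i+jm)})/p ∈ ℤ. (1) If 𝔮 is not p-principal, then there exists an integer l with 1 ≤ l < m such that Σ_{i=0}^{m-1} c_i·v^{lfi} ≡ 0 (mod p). (2) If for every integer l with 1 ≤ l < m one has Σ_{i=0}^{m-1} c_i·v^{lfi} ≢ 0 (mod p), then 𝔮 is p-principal. -/
open NumberField Finset nonZeroDivisors

section Parta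

section StickVal

variable {A Γ κ F : Type*} [CommRing A] [IsDomain A] [LinearOrderedCommGroupWithZero Γ]
  [Field κ] [Field F] [Fintype F]

lemma stick_val_q (V : Valuation A Γ) (hV : ∀ x, V x ≤ 1) {q : ℕ} (hq : q.Prime)
    {ζ : A} (hζ : IsPrimitiveRoot ζ q) : V (q : A) = V (ζ - 1) ^ (q - 1) := by
  obtain ⟨n, rfl⟩ : ∃ n, q = n + 1 := ⟨q - 1, by have := hq.pos; omega⟩
  have h := hζ.prod_one_sub_pow_eq_order
  rw [show ((n + 1 : ℕ) : A) = (n : A) + 1 by push_cast; ring, ← h, map_prod]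
  simp only [Nat.add_sub_cancel]
  rw [Finset.prod_congr rfl (g := fun _ => V (ζ - 1)), Finset.prod_const, Finset.card_range]
  intro k hk
  have hk' := Finset.mem_range.mp hk
  have hc : (k + 1).Coprime (n + 1) := by
    rw [Nat.coprime_comm]
    exact (Nat.Prime.coprime_iff_not_dvd hq).mpr (Nat.not_dvd_of_pos_of_lt (by omega) (by omega))
  obtain ⟨u, hu⟩ := hζ.associated_sub_one_pow_sub_one_of_coprime hc
  rw [Valuation.map_sub_swap, ← hu, map_mul]
  have h1 : V (u : A) = 1 := by
    apply le_antisymm (hV _)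
    have := hV ((u⁻¹ : Aˣ) : A)
    by_contra hlt
    push Not at hlt
    have h2 : V ((u : A) * ((u⁻¹ : Aˣ) : A)) = 1 := by simp
    rw [map_mul] at h2
    have h3 : V (u : A) * V ((u⁻¹ : Aˣ) : A) < 1 :=
      lt_of_le_of_lt (mul_le_of_le_one_right' this) hlt
    exact absurd h2 h3.ne
  rw [h1, mul_one]

/-- The residue condition defining the Teichmueller character. -/
lemma stick_val_one (V : Valuation A Γ) (hV : ∀ x, V x ≤ 1)
    (ρ : A →+* κ) (hρ : ∀ x, V x < 1 ↔ ρ x = 0) {q f : ℕ} [Fact q.Prime] [Algebra (ZMod q) F]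
    (hf : 0 < f) (hq2 : q ≠ 2)
    (hcard : Fintype.card F = q ^ f) (ι : F →+* κ) (ω : MulChar F A) (hω : ∀ x, ρ (ω x) = ι x)
    {ζ : A} (hζ : IsPrimitiveRoot ζ q) (ψ : AddChar F A)
    (hψ : ∀ x, ψ x = ζ ^ (Algebra.trace (ZMod q) F x).val) :
    V (gaussSum ω⁻¹ ψ) = V (ζ - 1) ∧ V (ζ - 1) < 1 := by
  have hq : q.Prime := Fact.out
  have hq3 : 2 < q := lt_of_le_of_ne hq.two_le (Ne.symm hq2)
  have hqf : q ≤ q ^ f := Nat.le_self_pow hf.ne' q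
  have : CharP F q := charP_of_injective_algebraMap (algebraMap (ZMod q) F).injective q
  have hρq : ρ (q : A) = 0 := by
    rw [map_natCast, ← map_natCast ι, CharP.cast_eq_zero, map_zero]
  have hW : V (ζ - 1) < 1 := by
    refine lt_of_le_of_ne (hV _) fun h => ?_
    have h1 := stick_val_q V hV hq hζ
    rw [h, one_pow] at h1
    exact absurd h1 ((hρ _).mpr hρq).ne
  refine ⟨?_, hW⟩
  have hρζ : ρ ζ = 1 := by
    have := (hρ _).mp hW
    rwa [map_sub, map_one, sub_eq_zero] at this
  have hfr : Module.finrank (ZMod q) F = f := by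
    have h1 := Module.card_eq_pow_finrank (K := ZMod q) (V := F)
    rw [hcard, ZMod.card] at h1
    exact (Nat.pow_right_injective hq.two_le h1).symm
  -- the inverse of omega on residues
  have hωinv : ∀ x : F, ρ (ω⁻¹ x) = ι x⁻¹ := by
    intro x
    rw [MulChar.inv_apply', hω]
  have hne : ω⁻¹ ≠ 1 := by
    intro h
    classical
    obtain ⟨x, hx0, hx1⟩ : ∃ x : F, x ≠ 0 ∧ x ≠ 1 := by
      by_contra! hcon
      have : (Finset.univ : Finset F) ⊆ {0, 1} := by
        intro x _
        by_cases hx : x = 0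
        · simp [hx]
        · simp [hcon x hx]
      have h2 := Finset.card_le_card this
      have h3 : Finset.card ({0, 1} : Finset F) ≤ 2 := Finset.card_le_two
      rw [Finset.card_univ, hcard] at h2
      omega
    have h1 := hωinv x
    rw [h, MulChar.one_apply (isUnit_iff_ne_zero.mpr hx0), map_one] at h1
    have : ι x⁻¹ = ι 1 := by rw [← h1, map_one]
    exact hx1 (inv_eq_one.mp (ι.injective this))
  let e : F → A := fun x => ∑ j ∈ range (Algebra.trace (ZMod q) F x).val, ζ ^ j
  have hg : gaussSum ω⁻¹ ψ = (∑ x, ω⁻¹ x * e x) * (ζ - 1) := by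
    have h0 : ∑ x, ω⁻¹ x = 0 := MulChar.sum_eq_zero_of_ne_one hne
    rw [gaussSum, ← sub_zero (∑ x, ω⁻¹ x * ψ x), ← h0, ← Finset.sum_sub_distrib, Finset.sum_mul]
    refine Finset.sum_congr rfl fun x _ => ?_
    rw [hψ, mul_assoc, show e x * (ζ - 1) = ζ ^ (Algebra.trace (ZMod q) F x).val - 1 from
      geom_sum_mul ζ _]
    ring
  have hE : ρ (∑ x, ω⁻¹ x * e x) = ι (-1) := by
    have h1 : ∀ x, ρ (e x) = ι (algebraMap (ZMod q) F (Algebra.trace (ZMod q) F x)) := by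
      intro x
      simp only [e, map_sum, map_pow, hρζ, one_pow, sum_const, card_range, nsmul_eq_mul, mul_one]
      conv_rhs => rw [← ZMod.natCast_zmod_val (Algebra.trace (ZMod q) F x)]
      rw [map_natCast, map_natCast]
    rw [map_sum]
    simp only [map_mul, hωinv, h1]
    simp only [← map_mul, ← map_sum]
    congr 1
    simp only [FiniteField.algebraMap_trace_eq_sum_pow, hfr, Nat.card_zmod, Finset.mul_sum]
    rw [Finset.sum_comm]
    have h2 : ∀ i ∈ range f, ∑ x : F, x⁻¹ * x ^ q ^ i = if i = 0 then -1 else 0 := by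
      intro i hi
      have hi := mem_range.mp hi
      split_ifs with h0
      · subst h0
        simp only [pow_zero, pow_one]
        classical
        rw [Finset.sum_congr rfl (g := fun x : F => 1 - (if x = 0 then (1 : F) else 0))]
        · rw [Finset.sum_sub_distrib]
          simp [hcard, hf.ne']
        · intro x _
          by_cases hx : x = 0
          · simp [hx]
          · simp [hx]
      · have h3 : ∀ x : F, x⁻¹ * x ^ q ^ i = x ^ (q ^ i - 1) := by
          intro x
          have hqi : q ≤ q ^ i := Nat.le_self_pow h0 q
          obtain ⟨n, hn⟩ : ∃ n, q ^ i = n + 1 + 1 := ⟨q ^ i - 2, by omega⟩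
          rw [hn]
          by_cases hx : x = 0
          · simp [hx]
          · rw [pow_succ' x (n + 1), inv_mul_cancel_left₀ hx]; simp
        simp only [h3]
        apply FiniteField.sum_pow_lt_card_sub_one
        rw [hcard]
        have := Nat.pow_lt_pow_right hq.one_lt hi
        have := Nat.pow_pos (n := i) hq.pos
        omega
    rw [Finset.sum_congr rfl h2]
    simp [hf]
  have hVE : V (∑ x, ω⁻¹ x * e x) = 1 := by
    refine le_antisymm (hV _) (not_lt.mp fun h => ?_)
    rw [hρ, hE] at h
    simp at h
  rw [hg, map_mul, hVE, one_mul]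

lemma stick_psi_ne {q : ℕ} [Fact q.Prime] [Algebra (ZMod q) F] 
    {ζ : A} (hζ : IsPrimitiveRoot ζ q) (ψ : AddChar F A)
    (hψ : ∀ x, ψ x = ζ ^ (Algebra.trace (ZMod q) F x).val) : ψ ≠ 1 := by
  have hq : q.Prime := Fact.out
  intro h
  obtain ⟨x, hx⟩ := Algebra.trace_surjective (ZMod q) F 1
  have h1 := hψ x
  rw [h, hx, ZMod.val_one, pow_one] at h1
  exact hζ.ne_one hq.one_lt (by simpa using h1.symm)

/-- Frobenius invariance. -/
lemma stick_frob {q : ℕ} [Fact q.Prime] [Algebra (ZMod q) F]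
    {ζ : A} (ψ : AddChar F A)
    (hψ : ∀ x, ψ x = ζ ^ (Algebra.trace (ZMod q) F x).val) (χ : MulChar F A) :
    gaussSum (χ ^ q) ψ = gaussSum χ ψ := by
  have hq : q.Prime := Fact.out
  have : CharP F q := charP_of_injective_algebraMap (algebraMap (ZMod q) F).injective q
  have hψq : ∀ x, ψ (x ^ q) = ψ x := by
    intro x
    rw [hψ, hψ]
    congr 2
    have := Algebra.trace_eq_of_algEquiv (FiniteField.frobeniusAlgEquivOfAlgebraic (ZMod q) F) x
    simpa [ZMod.card] using this
  have hb : Function.Bijective (fun x : F => x ^ q) := bijective_frobenius F q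
  unfold gaussSum
  refine Fintype.sum_bijective _ hb _ _ fun x => ?_
  rw [hψq, MulChar.pow_apply' _ hq.ne_zero, map_pow]

lemma stick_sub (V : Valuation A Γ) (hV : ∀ x, V x ≤ 1) {ψ : AddChar F A} (hψ : ψ ≠ 1)
    (χ φ : MulChar F A) : 
    V (gaussSum χ ψ) * V (gaussSum φ ψ) ≤ V (gaussSum (χ * φ) ψ) := by
  by_cases h : χ * φ = 1
  · rw [h, gaussSum_one_left hψ]
    simpa using mul_le_one' (hV _) (hV _)
  · rw [← map_mul, ← jacobiSum_mul_nontrivial h ψ, map_mul]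
    exact mul_le_of_le_one_right' (hV _)

lemma stick_pow (V : Valuation A Γ) (hV : ∀ x, V x ≤ 1) {ψ : AddChar F A} (hψ : ψ ≠ 1)
    (χ : MulChar F A) (n : ℕ) : 
    V (gaussSum χ ψ) ^ n ≤ V (gaussSum (χ ^ n) ψ) := by
  induction n with
  | zero => rw [pow_zero, pow_zero, gaussSum_one_left hψ]; simp
  | succ n ih =>
    rw [pow_succ, pow_succ]
    exact (mul_le_mul_left ih _).trans (stick_sub V hV hψ _ _)

lemma stick_digits (V : Valuation A Γ) (hV : ∀ x, V x ≤ 1) {q : ℕ} [Fact q.Prime]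
    [Algebra (ZMod q) F] {ζ : A} (hζ : IsPrimitiveRoot ζ q) (ψ : AddChar F A)
    (hψ : ∀ x, ψ x = ζ ^ (Algebra.trace (ZMod q) F x).val) (χ : MulChar F A) (d : ℕ → ℕ) (n : ℕ) :
    V (gaussSum χ ψ) ^ (∑ i ∈ range n, d i) ≤ V (gaussSum (χ ^ (∑ i ∈ range n, d i * q ^ i)) ψ) := by
  have hψ1 := stick_psi_ne hζ ψ hψ
  have hfr : ∀ i, gaussSum (χ ^ q ^ i) ψ = gaussSum χ ψ := by
    intro i
    induction i with
    | zero => simp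
    | succ i ih => rw [pow_succ, pow_mul, stick_frob ψ hψ, ih]
  induction n with
  | zero => rw [sum_range_zero, sum_range_zero, pow_zero, pow_zero, gaussSum_one_left hψ1]; simp
  | succ n ih =>
    rw [sum_range_succ, sum_range_succ, pow_add, pow_add]
    refine le_trans (mul_le_mul' ih ?_) (stick_sub V hV hψ1 _ _)
    have := stick_pow V hV hψ1 (χ ^ q ^ n) (d n)
    rw [hfr, ← pow_mul, mul_comm] at this
    exact this

/-- digit expansion of `k (q^f-1)/p`. -/
lemma stick_expansion {p q f n k : ℕ} (hp : p.Prime) (hq : 0 < q) (hk : k < p)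
    (hn : q ^ f = p * n + 1) :
    ∃ d : ℕ → ℕ, ∑ i ∈ range f, d i * q ^ i = k * n ∧
      p * ∑ i ∈ range f, d i = (q - 1) * ∑ i ∈ range f, (k * q ^ i) % p := by
  let r : ℕ → ℕ := fun i => (k * q ^ i) % p
  have hr : ∀ i, ∃ e, q * r i = r (i + 1) + p * e := by
    intro i
    refine ⟨(q * r i) / p, ?_⟩
    have : r (i + 1) = (q * r i) % p := by
      simp only [r]
      rw [Nat.mul_mod_mod, pow_succ]
      congr 1; ring
    rw [this, Nat.mod_add_div]
  choose e he using hr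
  have hr0 : r 0 = k := by simp [r, Nat.mod_eq_of_lt hk]
  have hrf : r f = k := by
    simp only [r, hn]
    rw [mul_add, mul_one, show k * (p * n) = p * (k * n) by ring, Nat.mul_add_mod,
      Nat.mod_eq_of_lt hk]
  refine ⟨fun i => e (f - 1 - i), ?_, ?_⟩
  · rw [← Finset.sum_range_reflect]
    have h1 : ∑ j ∈ range f, e (f - 1 - (f - 1 - j)) * q ^ (f - 1 - j)
        = ∑ j ∈ range f, e j * q ^ (f - 1 - j) := by
      refine Finset.sum_congr rfl fun j hj => ?_
      have := mem_range.mp hj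
      rw [show f - 1 - (f - 1 - j) = j by omega]
    rw [h1]
    have h2 : ∀ t ≤ f, p * ∑ j ∈ range t, e j * q ^ (f - 1 - j) + q ^ (f - t) * r t = q ^ f * k := by
      intro t
      induction t with
      | zero => intro _; simp [hr0]
      | succ t ih =>
        intro ht
        rw [← ih (by omega), sum_range_succ, show f - t = (f - 1 - t) + 1 by omega,
          show f - (t + 1) = f - 1 - t by omega, pow_succ, mul_assoc, he]
        ring
    have h3 := h2 f le_rfl
    rw [Nat.sub_self, pow_zero, one_mul, hrf, hn] at h3
    apply Nat.eq_of_mul_eq_mul_left hp.pos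
    linarith
  · rw [← Finset.sum_range_reflect]
    have h1 : ∑ j ∈ range f, e (f - 1 - (f - 1 - j)) = ∑ j ∈ range f, e j := by
      refine Finset.sum_congr rfl fun j hj => ?_
      have := mem_range.mp hj
      rw [show f - 1 - (f - 1 - j) = j by omega]
    rw [h1]
    have h2 : ∑ j ∈ range f, q * r j = ∑ j ∈ range f, (r (j + 1) + p * e j) :=
      Finset.sum_congr rfl fun j _ => he j
    rw [← mul_sum, sum_add_distrib, ← mul_sum] at h2
    have h3 := Finset.sum_range_succ r f
    rw [Finset.sum_range_succ', hr0, hrf] at h3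
    have h4 : ∑ j ∈ range f, r (j + 1) = ∑ j ∈ range f, r j := by omega
    obtain ⟨s, rfl⟩ : ∃ s, q = s + 1 := ⟨q - 1, by omega⟩
    rw [h4] at h2
    simp only [Nat.add_sub_cancel]
    change _ = s * ∑ i ∈ range f, r i
    linarith

theorem stick_val (V : Valuation A Γ) (hV : ∀ x, V x ≤ 1) (hV0 : ∀ x, V x = 0 → x = 0)
    (ρ : A →+* κ) (hρ : ∀ x, V x < 1 ↔ ρ x = 0) {p q f n : ℕ} [Fact q.Prime] [Algebra (ZMod q) F]
    (hp : p.Prime) (hf : 0 < f) (hq2 : q ≠ 2) (hn : q ^ f = p * n + 1)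
    (hcard : Fintype.card F = q ^ f) (ι : F →+* κ) (ω : MulChar F A) (hω : ∀ x, ρ (ω x) = ι x)
    {ζ : A} (hζ : IsPrimitiveRoot ζ q) (ψ : AddChar F A)
    (hψ : ∀ x, ψ x = ζ ^ (Algebra.trace (ZMod q) F x).val)
    {k C : ℕ} (hk0 : 0 < k) (hkp : k < p) (hC : p * C = ∑ i ∈ range f, (k * q ^ i) % p)
    (hne : ω⁻¹ ^ (k * n) ≠ 1) :
    V (gaussSum (ω⁻¹ ^ (k * n)) ψ) = V (q : A) ^ C := by
  have hq : q.Prime := Fact.out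
  obtain ⟨hg1, hW1⟩ := stick_val_one V hV ρ hρ hf hq2 hcard ι ω hω hζ ψ hψ
  have hVq := stick_val_q V hV hq hζ
  have hψ1 := stick_psi_ne hζ ψ hψ
  have hW0 : V (ζ - 1) ≠ 0 := by
    intro h
    exact hζ.ne_one hq.one_lt (sub_eq_zero.mp (hV0 _ h))
  have key : ∀ k' C', k' < p → p * C' = ∑ i ∈ range f, (k' * q ^ i) % p →
      V (q : A) ^ C' ≤ V (gaussSum (ω⁻¹ ^ (k' * n)) ψ) := by
    intro k' C' hk' hC'
    obtain ⟨d, hd1, hd2⟩ := stick_expansion hp hq.pos hk' hn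
    rw [← hC', show (q - 1) * (p * C') = p * ((q - 1) * C') by ring] at hd2
    have hd3 := Nat.eq_of_mul_eq_mul_left hp.pos hd2
    have := stick_digits V hV hζ ψ hψ ω⁻¹ d f
    rwa [hd1, hd3, hg1, pow_mul, ← hVq] at this
  have hqp : ¬ p ∣ q := by
    intro h
    have h1 : p ∣ p * n + 1 := by rw [← hn]; exact dvd_pow h hf.ne'
    have h2 := (Nat.dvd_add_right (Dvd.intro n rfl)).mp h1
    exact hp.one_lt.ne' (Nat.dvd_one.mp h2)
  have hCle : ∑ i ∈ range f, ((p - k) * q ^ i) % p + p * C = p * f := by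
    rw [hC, ← sum_add_distrib, Finset.sum_congr rfl (g := fun _ => p)]
    · simp [mul_comm]
    · intro i _
      have h1 : ((p - k) * q ^ i) % p + (k * q ^ i) % p ≡ 0 [MOD p] := by
        have : (p - k) * q ^ i + k * q ^ i ≡ 0 [MOD p] := by
          rw [← add_mul, Nat.sub_add_cancel hkp.le]
          exact (Nat.modEq_zero_iff_dvd).mpr (Dvd.intro _ rfl)
        exact ((Nat.mod_modEq _ _).add (Nat.mod_modEq _ _)).trans this
      have h2 : 0 < (k * q ^ i) % p := by
        apply Nat.pos_of_ne_zero
        intro h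
        rcases (Nat.Prime.dvd_mul hp).mp (Nat.dvd_of_mod_eq_zero h) with h | h
        · exact Nat.not_dvd_of_pos_of_lt hk0 hkp h
        · exact hqp (hp.dvd_of_dvd_pow h)
      have h3 := Nat.mod_lt (k * q ^ i) hp.pos
      have h4 := Nat.mod_lt ((p - k) * q ^ i) hp.pos
      obtain ⟨t, ht⟩ := (Nat.modEq_zero_iff_dvd).mp h1
      rw [ht] 
      have : t = 1 := by
        have : p * t < p * 2 := by omega
        have := Nat.lt_of_mul_lt_mul_left this
        have : t ≠ 0 := by rintro rfl; omega
        omega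
      rw [this, mul_one]
  obtain ⟨C', hC'⟩ : ∃ C', p * C' = ∑ i ∈ range f, ((p - k) * q ^ i) % p := by
    have : p ∣ ∑ i ∈ range f, ((p - k) * q ^ i) % p :=
      (Nat.dvd_add_left (Dvd.intro C rfl)).mp (hCle ▸ Dvd.intro f rfl)
    obtain ⟨t, ht⟩ := this
    exact ⟨t, ht.symm⟩
  have hCC : C' + C = f := by
    rw [← hC', ← mul_add] at hCle
    exact Nat.eq_of_mul_eq_mul_left hp.pos hCle
  have h1 := key k C hkp hC
  have h2 := key (p - k) C' (by omega) hC'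
  have hinv : ω⁻¹ ^ ((p - k) * n) = (ω⁻¹ ^ (k * n))⁻¹ := by
    rw [eq_inv_iff_mul_eq_one, ← pow_add, ← add_mul, Nat.sub_add_cancel hkp.le]
    classical
    have : p * n = Fintype.card Fˣ := by
      rw [Fintype.card_units, hcard, hn]; simp
    rw [this]
    exact MulChar.pow_card_eq_one _
  have h3 := gaussSum_mul_gaussSum_eq_card hne (AddChar.IsPrimitive.of_ne_one hψ1)
  have h4 := mul_gaussSum_inv_eq_gaussSum (ω⁻¹ ^ (k * n))⁻¹ ψ
  set X := V (gaussSum (ω⁻¹ ^ (k * n)) ψ)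
  have h5 : V (gaussSum (ω⁻¹ ^ (k * n))⁻¹ ψ) ≤ V (gaussSum (ω⁻¹ ^ (k * n))⁻¹ ψ⁻¹) := by
    rw [← h4, map_mul]
    exact mul_le_of_le_one_left' (hV _)
  have h6 : X * V (q : A) ^ C' ≤ V (q : A) ^ C * V (q : A) ^ C' := by
    rw [← pow_add, add_comm C C', hCC, ← map_pow V (q : A) f]
    have : V ((q : A) ^ f) = X * V (gaussSum (ω⁻¹ ^ (k * n))⁻¹ ψ⁻¹) := by
      rw [← map_mul, h3, hcard]; push_cast; rfl
    rw [this]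
    refine mul_le_mul' le_rfl (le_trans ?_ h5)
    rw [← hinv]; exact h2
  refine le_antisymm ?_ h1
  have hpos : 0 < V (q : A) ^ C' := by
    rw [hVq]; exact zero_lt_iff.mpr (pow_ne_zero _ (pow_ne_zero _ hW0))
  exact le_of_mul_le_mul_right h6 hpos

end StickVal

end Parta

section Partb

section StickDesc

variable {A F : Type*} [CommRing A] [IsDomain A] [Field F] [Fintype F]

open Classical in
/-- The Gauss sum as an element of the smaller ring. -/
noncomputable def stickGamma (q : ℕ) [Fact q.Prime] [Algebra (ZMod q) F] (χ : MulChar F A) : A :=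
  ∑ x : F, (if Algebra.trace (ZMod q) F x = 0 then χ x else 0) -
    ∑ x : F, (if Algebra.trace (ZMod q) F x = 1 then χ x else 0)

lemma stick_descent {q : ℕ} [Fact q.Prime] [Algebra (ZMod q) F]
    {ζ : A} (hζ : IsPrimitiveRoot ζ q) (ψ : AddChar F A)
    (hψ : ∀ x, ψ x = ζ ^ (Algebra.trace (ZMod q) F x).val) (χ : MulChar F A)
    (hχ : ∀ t : ZMod q, t ≠ 0 → χ (algebraMap (ZMod q) F t) = 1) :
    gaussSum χ ψ = stickGamma q χ := by
  classical
  have hq : q.Prime := Fact.out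
  let S : ZMod q → A := fun t => ∑ x : F, (if Algebra.trace (ZMod q) F x = t then χ x else 0)
  have h1 : gaussSum χ ψ = ∑ t : ZMod q, S t * ζ ^ t.val := by
    simp only [S, gaussSum, Finset.sum_mul]
    rw [Finset.sum_comm]
    refine Finset.sum_congr rfl fun x _ => ?_
    rw [Finset.sum_eq_single (Algebra.trace (ZMod q) F x)]
    · rw [if_pos rfl, hψ]
    · intro b _ hb
      rw [if_neg (Ne.symm hb), zero_mul]
    · simp
  have h2 : ∀ t : ZMod q, t ≠ 0 → S t = S 1 := by
    intro t ht
    have ht' : algebraMap (ZMod q) F t ≠ 0 := by simpa using ht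
    symm
    refine Fintype.sum_bijective _ (mulLeft_bijective₀ _ ht') _ _ fun x => ?_
    rw [map_mul χ, hχ t ht, one_mul, ← Algebra.smul_def, map_smul, smul_eq_mul]
    congr 1
    rw [eq_iff_iff]
    constructor
    · intro h; rw [h, mul_one]
    · intro h; exact mul_left_cancel₀ ht (by rw [h, mul_one])
  have h3 : ∑ t : ZMod q, ζ ^ t.val = 0 := by
    have := AddChar.sum_eq_zero_of_ne_one (R' := A)
      (ψ := AddChar.zmodChar q hζ.pow_eq_one) (by
        intro h
        have h5 := DFunLike.congr_fun h 1
        rw [AddChar.zmodChar_apply, ZMod.val_one, pow_one] at h5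
        exact hζ.ne_one hq.one_lt (by simpa using h5))
    simpa [AddChar.zmodChar_apply] using this
  rw [← Finset.add_sum_erase _ _ (Finset.mem_univ (0 : ZMod q))] at h1 h3
  rw [h1, Finset.sum_congr rfl (g := fun t : ZMod q => S 1 * ζ ^ t.val)]
  · rw [← Finset.mul_sum]
    have h4 : ∑ x ∈ univ.erase (0 : ZMod q), ζ ^ x.val = -1 := by
      rw [ZMod.val_zero, pow_zero] at h3
      linear_combination h3
    rw [h4, ZMod.val_zero, pow_zero]
    simp only [stickGamma, S]
    ring
  · intro t ht
    rw [h2 t (Finset.ne_of_mem_erase ht)]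

lemma stickGamma_map {B : Type*} [CommRing B] [IsDomain B] (q : ℕ) [Fact q.Prime]
    [Algebra (ZMod q) F] (χ : MulChar F B) (j : B →+* A) :
    j (stickGamma q χ) = stickGamma q (χ.ringHomComp j) := by
  classical
  simp only [stickGamma, map_sub, map_sum, apply_ite j, map_zero, MulChar.ringHomComp_apply]

lemma stick_teich {κ : Type*} [Field κ] (ρ : A →+* κ) (ι : F →+* κ) {N : ℕ} [NeZero N]
    (hN : Fintype.card F = N + 1) {θ : A} (hθ : IsPrimitiveRoot θ N)
    (hρθ : IsPrimitiveRoot (ρ θ) N) :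
    ∃ ω : MulChar F A, ∀ x, ρ (ω x) = ι x := by
  classical
  obtain ⟨u, hu⟩ := IsCyclic.exists_generator (α := Fˣ)
  have hcu : Fintype.card Fˣ = N := by rw [Fintype.card_units, hN]; simp
  have h1 : (ι (u : F)) ^ N = 1 := by
    rw [← map_pow, ← Units.val_pow_eq_pow_val, ← hcu, pow_card_eq_one]; simp
  obtain ⟨i, hi, hi2⟩ := hρθ.eq_pow_of_pow_eq_one h1
  have h2 : (θ ^ i) ^ N = 1 := by rw [← pow_mul, mul_comm, pow_mul, hθ.pow_eq_one, one_pow]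
  let t : Aˣ := Units.ofPowEqOne (θ ^ i) N h2 (NeZero.ne N)
  have ht : t ∈ rootsOfUnity (Fintype.card Fˣ) A := by
    rw [hcu, mem_rootsOfUnity]
    ext
    simp [t, h2]
  refine ⟨MulChar.ofRootOfUnity ht hu, fun x => ?_⟩
  by_cases hx : x = 0
  · rw [hx, MulChar.map_zero, map_zero, map_zero]
  · obtain ⟨k, hk : u ^ k = _⟩ := (mem_powers_iff_mem_zpowers.mpr (hu (Units.mk0 x hx)))
    have hxk : x = (u : F) ^ k := by
      rw [← Units.val_pow_eq_pow_val, hk]; rfl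
    rw [hxk, map_pow, MulChar.ofRootOfUnity_spec, map_pow, map_pow, ← hi2]
    simp [t]

lemma stick_mulChar_ext {u : Fˣ} (hu : ∀ x : Fˣ, x ∈ Subgroup.zpowers u) {χ φ : MulChar F A}
    (h : χ u = φ u) : χ = φ := by
  ext x
  obtain ⟨k, hk : u ^ k = _⟩ := (mem_powers_iff_mem_zpowers.mpr (hu x))
  rw [← hk, Units.val_pow_eq_pow_val, map_pow, map_pow, h]

theorem stick_global_aux {B Γ κ : Type*} [CommRing B] [IsDomain B]
    [LinearOrderedCommGroupWithZero Γ] [Field κ]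
    (j : B →+* A) (hj : Function.Injective j)
    (V : Valuation A Γ) (hV : ∀ x, V x ≤ 1) (hV0 : ∀ x, V x = 0 → x = 0)
    (ρ : A →+* κ) (hρ : ∀ x, V x < 1 ↔ ρ x = 0) {p q f n : ℕ} [Fact q.Prime] [Algebra (ZMod q) F]
    (hp : p.Prime) (hf : 0 < f) (hq2 : q ≠ 2) (hn : q ^ f = p * n + 1) (hpq : ¬ p ∣ q - 1)
    (hcard : Fintype.card F = q ^ f) (ι : F →+* κ)
    {θ : A} (hθ : IsPrimitiveRoot θ (p * n)) (hρθ : IsPrimitiveRoot (ρ θ) (p * n))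
    {ζ : A} (hζ : IsPrimitiveRoot ζ q) {z₀ : B} (hz₀ : IsPrimitiveRoot z₀ p) :
    ∃ γ : B, γ ∣ (q : B) ^ f ∧ ∀ (τ : B →+* B) (k C : ℕ), 0 < k → k < p → τ z₀ = z₀ ^ k →
      p * C = ∑ i ∈ range f, (k * q ^ i) % p → V (j (τ γ)) = V (q : A) ^ C := by
  classical
  have hq : q.Prime := Fact.out
  have hN0 : p * n ≠ 0 := by
    intro h
    have : 1 < q ^ f := Nat.one_lt_pow hf.ne' hq.one_lt
    omega
  have : NeZero (p * n) := ⟨hN0⟩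
  have : NeZero p := ⟨hp.ne_zero⟩
  obtain ⟨ω, hω⟩ := stick_teich (F := F) ρ ι (N := p * n) (by rw [hcard, hn]) hθ hρθ
  let ψ : AddChar F A := (AddChar.zmodChar q hζ.pow_eq_one).compAddMonoidHom
    (Algebra.trace (ZMod q) F).toAddMonoidHom
  have hψ : ∀ x, ψ x = ζ ^ (Algebra.trace (ZMod q) F x).val := fun x => by
    simp [ψ, AddChar.zmodChar_apply]
  have hψ1 := stick_psi_ne hζ ψ hψ
  obtain ⟨u, hu⟩ := IsCyclic.exists_generator (α := Fˣ)
  have hcu : Fintype.card Fˣ = p * n := by rw [Fintype.card_units, hcard, hn]; simp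
  have hupow : ∀ x : F, x ≠ 0 → ∃ k : ℕ, x = (u : F) ^ k := by
    intro x hx
    obtain ⟨k, hk : u ^ k = _⟩ := (mem_powers_iff_mem_zpowers.mpr (hu (Units.mk0 x hx)))
    exact ⟨k, by rw [← Units.val_pow_eq_pow_val, hk]; rfl⟩
  have hu_prim : IsPrimitiveRoot (u : F) (p * n) := by
    rw [IsPrimitiveRoot.coe_units_iff, ← hcu, ← orderOf_eq_card_of_forall_mem_zpowers hu |>.trans
      Nat.card_eq_fintype_card]
    exact IsPrimitiveRoot.orderOf u
  have hωu : IsPrimitiveRoot (ω⁻¹ (u : F)) (p * n) := by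
    constructor
    · rw [← map_pow, hu_prim.pow_eq_one, map_one]
    · intro l hl
      rw [MulChar.inv_apply', ← map_pow] at hl
      have h2 := hω ((u : F)⁻¹ ^ l)
      rw [hl, map_one] at h2
      have h3 : (u : F)⁻¹ ^ l = 1 := ι.injective (by rw [← h2, map_one])
      rw [inv_pow, inv_eq_one] at h3
      exact hu_prim.dvd_of_pow_eq_one _ h3
  have hωn : IsPrimitiveRoot (ω⁻¹ (u : F) ^ n) p :=
    hωu.pow (Nat.pos_of_ne_zero hN0) (mul_comm p n)
  have hjz : IsPrimitiveRoot (j z₀) p := hz₀.map_of_injective hj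
  obtain ⟨i, hi, hi2⟩ := hjz.eq_pow_of_pow_eq_one hωn.pow_eq_one
  have hz : IsPrimitiveRoot (z₀ ^ i) p := by
    apply IsPrimitiveRoot.of_map_of_injective (f := j) _ hj
    rw [map_pow, hi2]; exact hωn
  have hzN : (z₀ ^ i) ^ Fintype.card Fˣ = 1 := by
    rw [hcu, pow_mul, hz.pow_eq_one, one_pow]
  let t : Bˣ := Units.ofPowEqOne (z₀ ^ i) p hz.pow_eq_one hp.ne_zero
  have ht : t ∈ rootsOfUnity (Fintype.card Fˣ) B := by
    rw [mem_rootsOfUnity]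
    ext
    simp [t, hzN]
  let χ₀ : MulChar F B := MulChar.ofRootOfUnity ht hu
  have hχu : χ₀ u = z₀ ^ i := by
    simp [χ₀, MulChar.ofRootOfUnity_spec, t]
  have hχp : χ₀ ^ p = 1 := by
    apply stick_mulChar_ext hu
    rw [MulChar.pow_apply_coe, hχu, hz.pow_eq_one, MulChar.one_apply_coe]
  have hcomp : χ₀.ringHomComp j = ω⁻¹ ^ n := by
    apply stick_mulChar_ext hu
    rw [MulChar.ringHomComp_apply, hχu, map_pow, hi2, MulChar.pow_apply_coe]
  have hcomp' : ∀ k, (χ₀ ^ k).ringHomComp j = ω⁻¹ ^ (k * n) := by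
    intro k
    rw [← MulChar.ringHomComp_pow, hcomp, ← pow_mul, mul_comm]
  have hωN : ω⁻¹ ^ (p * n) = 1 := by
    rw [← hcomp', hχp]; simp
  have hneg : ∀ k, 0 < k → k < p → ω⁻¹ ^ (k * n) ≠ 1 := by
    intro k hk hkp h
    have h1 := DFunLike.congr_fun h (u : F)
    rw [MulChar.pow_apply_coe, MulChar.one_apply_coe, mul_comm, pow_mul] at h1
    exact Nat.not_dvd_of_pos_of_lt hk hkp (hωn.dvd_of_pow_eq_one _ h1)
  have hdesc : ∀ k, j (stickGamma q (χ₀ ^ k)) = gaussSum (ω⁻¹ ^ (k * n)) ψ := by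
    intro k
    rw [stickGamma_map, hcomp', stick_descent hζ ψ hψ]
    intro s hs
    have hs' : algebraMap (ZMod q) F s ≠ 0 := by simpa using hs
    have h1 : (ω⁻¹ ^ (k * n)) (algebraMap (ZMod q) F s) ^ (q - 1) = 1 := by
      rw [← map_pow, ← map_pow, ZMod.pow_card_sub_one_eq_one hs, map_one, map_one]
    have h2 : (ω⁻¹ ^ (k * n)) (algebraMap (ZMod q) F s) ^ p = 1 := by
      rw [← MulChar.pow_apply' _ hp.ne_zero, ← pow_mul, show k * n * p = p * n * k by ring, pow_mul,
        hωN, one_pow, MulChar.one_apply (isUnit_iff_ne_zero.mpr hs')]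
    have h3 : Nat.Coprime p (q - 1) := (Nat.Prime.coprime_iff_not_dvd hp).mpr hpq
    have h4 := pow_gcd_eq_one.mpr ⟨h2, h1⟩
    rwa [h3.gcd_eq_one, pow_one] at h4
  refine ⟨stickGamma q χ₀, ?_, ?_⟩
  · refine ⟨χ₀ (-1) * stickGamma q (χ₀ ^ (p - 1)), hj ?_⟩
    have hinv : ω⁻¹ ^ ((p - 1) * n) = (ω⁻¹ ^ (1 * n))⁻¹ := by
      rw [eq_inv_iff_mul_eq_one, ← pow_add, ← add_mul, Nat.sub_add_cancel hp.one_le, hωN]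
    have h0 := hdesc 1
    rw [pow_one] at h0
    rw [map_mul, map_mul, h0, hdesc, hinv]
    have h3 := gaussSum_mul_gaussSum_eq_card (hneg 1 one_pos hp.one_lt)
      (AddChar.IsPrimitive.of_ne_one hψ1)
    have h4 := mul_gaussSum_inv_eq_gaussSum (ω⁻¹ ^ (1 * n))⁻¹ ψ
    have h5 : j (χ₀ (-1)) = (ω⁻¹ ^ (1 * n)) (-1) := by
      rw [one_mul, ← hcomp, MulChar.ringHomComp_apply]
    rw [h5, ← h4, ← mul_assoc ((ω⁻¹ ^ (1 * n)) (-1)), ← MulChar.mul_apply, mul_inv_cancel,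
      MulChar.one_apply (by simp), one_mul (gaussSum _ _), h3, hcard]
    simp
  · intro τ k C hk hkp hτ hC
    have h1 : χ₀.ringHomComp τ = χ₀ ^ k := by
      apply stick_mulChar_ext hu
      rw [MulChar.ringHomComp_apply, MulChar.pow_apply_coe, hχu, map_pow, hτ, ← pow_mul, ← pow_mul,
        mul_comm]
    rw [stickGamma_map, h1, hdesc]
    exact stick_val V hV hV0 ρ hρ hp hf hq2 hn hcard ι ω hω hζ ψ hψ hk hkp hC (hneg k hk hkp)

end StickDesc

end Partb

section Partc

theorem stick_liesOver {K : Type*} [Field K] [NumberField K] {q : ℕ} (hq : q.Prime) (𝔮 : Ideal (𝓞 K)) [h𝔮 : 𝔮.IsPrime]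
    (hmem : (q : 𝓞 K) ∈ 𝔮) : 𝔮.LiesOver (Ideal.span {(q : ℤ)}) := by
  have := Fact.mk hq
  have : (Ideal.span {(q : ℤ)}).IsMaximal := inferInstance
  rw [Ideal.liesOver_iff]
  refine this.eq_of_le ?_ ?_
  · exact Ideal.IsPrime.ne_top inferInstance
  · rw [Ideal.span_le, Set.singleton_subset_iff]
    simpa [Ideal.under, Ideal.mem_comap] using hmem

theorem stick_absNorm {K : Type*} [Field K] [NumberField K] {p q : ℕ} [NeZero p] [IsCyclotomicExtension {p} ℚ K]
    (hq : q.Prime) (hqp : ¬ q ∣ p) (𝔮 : Ideal (𝓞 K)) [h𝔮 : 𝔮.IsPrime] (h0 : 𝔮 ≠ ⊥)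
    (hmem : (q : 𝓞 K) ∈ 𝔮) : Ideal.absNorm 𝔮 = q ^ orderOf (q : ZMod p) := by
  have := Fact.mk hq
  have hL := stick_liesOver hq 𝔮 hmem
  have : 𝔮.IsMaximal := h𝔮.isMaximal h0
  rw [Ideal.absNorm_eq_pow_inertiaDeg' 𝔮 hq, ← IsCyclotomicExtension.Rat.inertiaDeg_eq_of_not_dvd q K 𝔮 hqp]
  rw [Ideal.inertiaDeg_eq_of_isMaximal (Ideal.span {(q : ℤ)}), Ideal.inertiaDeg'_algebraMap]

open IsDedekindDomain in
theorem stick_global {K : Type*} [Field K] [NumberField K] {p q f : ℕ} (hp : p.Prime) [IsCyclotomicExtension {p} ℚ K]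
    (hq : q.Prime) (hqodd : q ≠ 2) (hqp : q ≠ p) (hf : f = orderOf (q : ZMod p)) (hf1 : 1 < f)
    (𝔮 : HeightOneSpectrum (𝓞 K)) (hmem : (q : 𝓞 K) ∈ 𝔮.asIdeal)
    {z₀ : 𝓞 K} (hz₀ : IsPrimitiveRoot z₀ p) :
    ∃ γ : 𝓞 K, γ ∣ (q : 𝓞 K) ^ f ∧ ∀ (τ : 𝓞 K →+* 𝓞 K) (k C : ℕ), 0 < k → k < p → τ z₀ = z₀ ^ k →
      p * C = ∑ i ∈ range f, (k * q ^ i) % p → 𝔮.intValuation (τ γ) = 𝔮.intValuation (q : 𝓞 K) ^ C := by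
  have := Fact.mk hq
  have := Fact.mk hp
  have hqdp : ¬ q ∣ p := fun h => hqp ((Nat.prime_dvd_prime_iff_eq hq hp).1 h)
  have hmax : 𝔮.asIdeal.IsMaximal := 𝔮.isMaximal
  have hnorm : Ideal.absNorm 𝔮.asIdeal = q ^ f := by
    rw [hf]; exact stick_absNorm hq hqdp _ 𝔮.ne_bot hmem
  obtain ⟨n, hn⟩ : ∃ n, q ^ f = p * n + 1 := by
    have h1 : ((q ^ f : ℕ) : ZMod p) = ((1 : ℕ) : ZMod p) := by
      push_cast; rw [hf]; exact pow_orderOf_eq_one _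
    have h2 := (ZMod.natCast_eq_natCast_iff' _ _ _).1 h1
    have h3 : p ∣ q ^ f - 1 := (Nat.modEq_iff_dvd' (Nat.one_le_pow _ _ hq.pos)).1 (show 1 % p = _ from h2.symm)
    obtain ⟨n, hn⟩ := h3
    exact ⟨n, by have := Nat.one_le_pow f _ hq.pos; omega⟩
  have hpq : ¬ p ∣ q - 1 := by
    intro h
    have h1 : (q : ZMod p) = 1 := by
      have : ((q - 1 : ℕ) : ZMod p) = 0 := (ZMod.natCast_eq_zero_iff _ _).2 h
      rw [Nat.cast_sub hq.one_lt.le, Nat.cast_one] at this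
      exact sub_eq_zero.1 this
    rw [h1, orderOf_one] at hf
    omega
  have hn0 : 0 < n := by
    rcases Nat.eq_zero_or_pos n with h | h
    · subst h
      have := Nat.one_lt_pow (by omega : f ≠ 0) hq.one_lt
      omega
    · exact h
  have hN : NeZero (p * n * q) := ⟨by have := hp.pos; have := hq.pos; positivity⟩
  have hN' : NeZero (p * n) := ⟨by have := hp.pos; positivity⟩
  let L := CyclotomicField (p * n * q) K
  have : NumberField L := inferInstance
  obtain ⟨𝔓, h𝔓, hlies⟩ := Ideal.exists_maximal_ideal_liesOver_of_isIntegral (S := 𝓞 L) 𝔮.asIdeal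
  have hbot : 𝔓 ≠ ⊥ := Ideal.ne_bot_of_liesOver_of_ne_bot 𝔮.ne_bot 𝔓
  let w : HeightOneSpectrum (𝓞 L) := ⟨𝔓, h𝔓.isPrime, hbot⟩
  have hlies' : w.asIdeal.LiesOver 𝔮.asIdeal := hlies
  let _ : Field (𝓞 K ⧸ 𝔮.asIdeal) := Ideal.Quotient.field _
  let _ : Field (𝓞 L ⧸ 𝔓) := Ideal.Quotient.field _
  let _ : Finite (𝓞 K ⧸ 𝔮.asIdeal) := Ideal.finiteQuotientOfFreeOfNeBot _ 𝔮.ne_bot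
  let _ : Fintype (𝓞 K ⧸ 𝔮.asIdeal) := Fintype.ofFinite _
  have : CharP (𝓞 K ⧸ 𝔮.asIdeal) q := by
    have : (q : 𝓞 K ⧸ 𝔮.asIdeal) = 0 := by
      have := Ideal.Quotient.eq_zero_iff_mem.2 hmem
      simpa using this
    exact (CharP.charP_iff_prime_eq_zero hq).2 this
  let _ : Algebra (ZMod q) (𝓞 K ⧸ 𝔮.asIdeal) := ZMod.algebra _ q
  have hcard : Fintype.card (𝓞 K ⧸ 𝔮.asIdeal) = q ^ f := by
    rw [← hnorm, Ideal.absNorm_apply, Submodule.cardQuot_apply, Nat.card_eq_fintype_card]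
  have hη : IsPrimitiveRoot (IsCyclotomicExtension.zeta (p * n * q) K L) (p * n * q) :=
    IsCyclotomicExtension.zeta_spec _ _ _
  have hη' := hη.toInteger_isPrimitiveRoot
  have hθ := hη'.pow (NeZero.pos _) (show p * n * q = q * (p * n) by ring)
  have hζ := hη'.pow (NeZero.pos _) (show p * n * q = (p * n) * q by ring)
  have hqP : (q : 𝓞 L) ∈ 𝔓 := by
    have := hlies.over
    rw [this] at hmem
    simpa [Ideal.under] using hmem
  have hnormP : ∃ s, Ideal.absNorm 𝔓 = q ^ s := by
    have := stick_liesOver hq 𝔓 hqP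
    exact ⟨_, Ideal.absNorm_eq_pow_inertiaDeg' 𝔓 hq⟩
  obtain ⟨s, hs⟩ := hnormP
  have hρθ := IsPrimitiveRoot.idealQuotient_mk (I := 𝔓) hθ
    (by rw [Ne, Ideal.absNorm_eq_one_iff]; exact h𝔓.ne_top)
    (by
      rw [hs]
      apply Nat.Coprime.pow_left
      rw [hq.coprime_iff_not_dvd]
      intro h
      have h1 : q ∣ p * n + 1 := hn ▸ dvd_pow_self q (by omega)
      exact hq.one_lt.ne' (Nat.dvd_one.1 ((Nat.dvd_add_right h).1 h1)))
  obtain ⟨γ, h1, h2⟩ := stick_global_aux (algebraMap (𝓞 K) (𝓞 L)) (FaithfulSMul.algebraMap_injective _ _)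
    w.intValuation (fun x => w.intValuation_le_one x) (fun x hx => by
      by_contra h; exact w.intValuation_ne_zero x h hx) (Ideal.Quotient.mk 𝔓)
    (fun x => by rw [w.intValuation_lt_one_iff_mem, Ideal.Quotient.eq_zero_iff_mem])
    hp (by omega) hqodd hn hpq hcard (algebraMap (𝓞 K ⧸ 𝔮.asIdeal) (𝓞 L ⧸ 𝔓)) hθ hρθ hζ hz₀
  refine ⟨γ, h1, fun τ k C hk hk' hτ hC => ?_⟩
  have h3 := h2 τ k C hk hk' hτ hC
  rw [← map_natCast (algebraMap (𝓞 K) (𝓞 L)) q, ← HeightOneSpectrum.intValuation_liesOver 𝔮 w,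
    ← HeightOneSpectrum.intValuation_liesOver 𝔮 w, pow_right_comm] at h3
  exact (pow_left_inj₀ zero_le zero_le (Ideal.IsDedekindDomain.ramificationIdx'_ne_zero_of_liesOver w.asIdeal 𝔮.ne_bot)).1 h3

end Partc

section Partd

/-- Over a field `k` containing an element `g` of order `m`: any polynomial without zeros among the nontrivial
powers of `g` is coprime to `1 + X + ... + X^(m-1)`. -/
theorem stick_coprime {k : Type*} [Field k] {m : ℕ} (hm : 0 < m) {g : k} (hg : IsPrimitiveRoot g m)
    (hmk : (m : k) ≠ 0)
    (P : Polynomial k) (hP : ∀ l, 1 ≤ l → l < m → P.eval (g ^ l) ≠ 0) :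
    IsCoprime P (∑ i ∈ range m, Polynomial.X ^ i) := by
  classical
  have h1 : (∑ i ∈ range m, (Polynomial.X : Polynomial k) ^ i) = ∏ l ∈ Finset.Ico 1 m, (Polynomial.X - Polynomial.C (g ^ l)) := by
    have h2 := Polynomial.X_pow_sub_one_eq_prod hm hg
    have h3 : Polynomial.nthRootsFinset m (1 : k) = (range m).image (fun l => g ^ l) := by
      symm
      apply Finset.eq_of_subset_of_card_le
      · intro x hx
        obtain ⟨l, hl, rfl⟩ := Finset.mem_image.1 hx
        rw [Polynomial.mem_nthRootsFinset hm, ← pow_mul, mul_comm, pow_mul, hg.pow_eq_one, one_pow]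
      · rw [hg.card_nthRootsFinset, Finset.card_image_of_injOn, Finset.card_range]
        intro a ha b hb hab
        exact hg.pow_inj (by simpa using ha) (by simpa using hb) hab
    rw [h3, Finset.prod_image (by
        intro a ha b hb hab
        exact hg.pow_inj (by simpa using ha) (by simpa using hb) hab), Finset.range_eq_Ico,
        Finset.prod_eq_prod_Ico_succ_bot hm] at h2
    have h4 := geom_sum_mul (Polynomial.X : Polynomial k) m
    rw [h2, mul_comm] at h4
    simp only [pow_zero, Polynomial.C_1] at h4
    have := mul_left_cancel₀ (Polynomial.X_sub_C_ne_zero (1:k)) (by simpa using h4)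
    simpa using this
  rw [h1]
  apply IsCoprime.prod_right
  intro l hl
  rw [Finset.mem_Ico] at hl
  rw [isCoprime_comm]
  refine (Polynomial.irreducible_X_sub_C _).coprime_iff_not_dvd.2 ?_
  rw [Polynomial.dvd_iff_isRoot]
  exact hP l hl.1 hl.2

theorem stick_abstract {M : Type*} [CommGroup M] [Finite M] {p m : ℕ} [Fact p.Prime] (hm : 0 < m)
    {g : ℤ} (hg : IsPrimitiveRoot (g : ZMod p) m) (hmk : (m : ZMod p) ≠ 0) (y : ℕ → M) (c : ℕ → ℤ)
    (h1 : ∀ k, ∏ i ∈ range m, y (i + k) ^ c i = 1)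
    (h2 : ∀ k, ∏ i ∈ range m, y (i + k) = 1)
    (hc : ∀ l, 1 ≤ l → l < m → ¬ (p : ℤ) ∣ ∑ i ∈ range m, c i * g ^ (l * i)) :
    Nat.Coprime (orderOf (y 0)) p := by
  classical
  let φ : Polynomial ℤ →+ Additive M := 
    (Polynomial.lsum (fun n => LinearMap.toSpanSingleton ℤ (Additive M) (Additive.ofMul (y n)))).toAddMonoidHom
  have hφ : ∀ n a, φ (Polynomial.monomial n a) = a • Additive.ofMul (y n) := by
    intro n a
    simp [φ, Polynomial.lsum_apply]
  let P : Polynomial ℤ := ∑ i ∈ range m, Polynomial.monomial i (c i)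
  let Φ : Polynomial ℤ := ∑ i ∈ range m, Polynomial.monomial i 1
  have key : ∀ Q : Polynomial ℤ, (∀ k, φ (Polynomial.monomial k 1 * Q) = 0) → ∀ R, φ (R * Q) = 0 := by
    intro Q hQ R
    induction R using Polynomial.induction_on' with
    | add a b ha hb => rw [add_mul, map_add, ha, hb, add_zero]
    | monomial n a =>
      have : Polynomial.monomial n a = a • (Polynomial.monomial n 1 : Polynomial ℤ) := by
        simp [Polynomial.smul_monomial]
      rw [this, smul_mul_assoc, map_zsmul, hQ, smul_zero]
  have hP : ∀ R, φ (R * P) = 0 := by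
    apply key
    intro k
    have := h1 k
    simp only [P, Finset.mul_sum, map_sum, Polynomial.monomial_mul_monomial, hφ, one_mul]
    rw [← ofMul_one, ← h1 k, ofMul_prod]
    refine Finset.sum_congr rfl fun i _ => ?_
    rw [ofMul_zpow, add_comm]
  have hΦ : ∀ R, φ (R * Φ) = 0 := by
    apply key
    intro k
    simp only [Φ, Finset.mul_sum, map_sum, Polynomial.monomial_mul_monomial, hφ, one_mul]
    rw [← ofMul_one, ← h2 k, ofMul_prod]
    refine Finset.sum_congr rfl fun i _ => ?_
    rw [one_smul, add_comm]
  let r := Polynomial.mapRingHom (Int.castRingHom (ZMod p))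
  have hcop : IsCoprime (r P) (r Φ) := by
    have e : r Φ = ∑ i ∈ range m, Polynomial.X ^ i := by
      simp [r, Φ, Polynomial.map_sum, Polynomial.monomial_one_right_eq_X_pow]
    rw [e]
    refine stick_coprime hm hg hmk _ fun l hl hl' h0 => hc l hl hl' ?_
    rw [← ZMod.intCast_zmod_eq_zero_iff_dvd] 
    rw [← h0]
    simp [r, P, Polynomial.map_sum, Polynomial.eval_finsetSum, pow_mul]
  obtain ⟨a, b, hab⟩ := hcop
  have hsurj : Function.Surjective r := Polynomial.map_surjective _ (ZMod.ringHom_surjective _)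
  obtain ⟨A, rfl⟩ := hsurj a
  obtain ⟨B, rfl⟩ := hsurj b
  have hR : ∃ R, A * P + B * Φ - 1 = Polynomial.C (p : ℤ) * R := by
    have h0 : r (A * P + B * Φ - 1) = 0 := by rw [map_sub, map_add, map_mul, map_mul, hab, map_one, sub_self]
    have : Polynomial.C (p : ℤ) ∣ A * P + B * Φ - 1 := by
      rw [Polynomial.C_dvd_iff_dvd_coeff]
      intro i
      rw [← ZMod.intCast_zmod_eq_zero_iff_dvd]
      have := congrArg (fun s => Polynomial.coeff s i) h0
      rw [show r (A * P + B * Φ - 1) = Polynomial.map (Int.castRingHom (ZMod p)) (A * P + B * Φ - 1) from rfl] at this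
      rw [Polynomial.coeff_map] at this
      exact this
    exact this
  obtain ⟨R, hR⟩ := hR
  have step : ∀ Q, φ Q = (p : ℤ) • φ (-(R * Q)) := by
    intro Q
    have : Q = Q * A * P + Q * B * Φ + (p : ℤ) • (-(R * Q)) := by
      rw [zsmul_eq_mul]
      have e : (A * P + B * Φ - 1) = ((p : ℤ) : Polynomial ℤ) * R := by rw [hR]; simp
      linear_combination (-Q) * e
    conv_lhs => rw [this]
    rw [map_add, map_add, hP, hΦ, map_zsmul, zero_add, zero_add]
  have step' : ∀ k : ℕ, ∀ Q, ∃ z, φ Q = (p : ℤ) ^ k • z := by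
    intro k
    induction k with
    | zero => intro Q; exact ⟨φ Q, by simp⟩
    | succ k ih =>
      intro Q
      obtain ⟨z, hz⟩ := ih (-(R * Q))
      exact ⟨z, by rw [step, hz, smul_smul, pow_succ']⟩
  obtain ⟨k, h', hh', hcard⟩ := Nat.exists_eq_pow_mul_and_not_dvd (Nat.card_pos (α := M)).ne' p
    (Fact.out : p.Prime).ne_one
  obtain ⟨z, hz⟩ := step' k (Polynomial.monomial 0 1)
  rw [hφ, one_smul] at hz
  have hy : y 0 = (Additive.toMul z) ^ (p ^ k) := by
    have := congrArg Additive.toMul hz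
    rw [toMul_ofMul, toMul_zsmul, ← Nat.cast_pow, zpow_natCast] at this
    exact this
  have hord : orderOf (y 0) ∣ h' := by
    apply orderOf_dvd_of_pow_eq_one
    rw [hy, ← pow_mul, ← hcard, pow_card_eq_one']
  refine Nat.Coprime.coprime_dvd_left hord ?_
  exact ((Nat.Prime.coprime_iff_not_dvd Fact.out).2 hh').symm

end Partd

section Parte
open Pointwise

theorem stick_factor {R : Type*} [CommRing R] [IsDedekindDomain R] {I : Ideal R} (hI : I ≠ ⊥) {m : ℕ}
    (Q : ℕ → Ideal R) (hQ : ∀ i < m, Prime (Q i)) (hinj : ∀ i < m, ∀ j < m, Q i = Q j → i = j)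
    (d : ℕ → ℕ) (hd : ∀ i < m, emultiplicity (Q i) I = d i)
    (hall : ∀ P : Ideal R, Prime P → P ∣ I → ∃ i < m, P = Q i) :
    I = ∏ i ∈ range m, Q i ^ d i := by
  have hne : ∏ i ∈ range m, Q i ^ d i ≠ 0 := by
    rw [Finset.prod_ne_zero_iff]
    intro i hi
    exact pow_ne_zero _ (hQ i (by simpa using hi)).ne_zero
  have hpq : ∀ i < m, ∀ P : Ideal R, Prime P → P ≠ Q i → emultiplicity P (Q i) = 0 := by
    intro i hi P hP hne
    rw [emultiplicity_eq_zero]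
    intro h
    exact hne (associated_iff_eq.1 (hP.associated_of_dvd (hQ i hi) h))
  have key : ∀ P : Ideal R, Prime P → emultiplicity P I = emultiplicity P (∏ i ∈ range m, Q i ^ d i) := by
    intro P hP
    rw [Finset.emultiplicity_prod hP]
    by_cases h : ∃ i < m, P = Q i
    · obtain ⟨i, hi, rfl⟩ := h
      rw [hd i hi, Finset.sum_eq_single i]
      · rw [(FiniteMultiplicity.of_prime_left hP (pow_ne_zero _ hP.ne_zero)).emultiplicity_eq_multiplicity,
          multiplicity_pow_self hP.ne_zero hP.not_isUnit]
      · intro j hj hji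
        have hj : j < m := by simpa using hj
        rw [emultiplicity_pow hP, hpq j hj _ hP (fun h => hji (hinj i hi j hj h).symm), mul_zero]
      · intro h; exact absurd (Finset.mem_range.2 hi) h
    · rw [Finset.sum_eq_zero, emultiplicity_eq_zero]
      · exact fun h' => h (hall P hP h')
      · intro j hj
        have hj : j < m := by simpa using hj
        rw [emultiplicity_pow hP, hpq j hj _ hP (fun h' => h ⟨j, hj, h'⟩), mul_zero]
  apply dvd_antisymm
  · rw [UniqueFactorizationMonoid.dvd_iff_emultiplicity_le hI]
    exact fun P hP => (key P hP).le
  · rw [UniqueFactorizationMonoid.dvd_iff_emultiplicity_le hne]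
    exact fun P hP => (key P hP).ge


theorem stick_smul_span {R G : Type*} [CommRing R] [Group G] [MulSemiringAction G R] (g : G) (x : R) :
    g • Ideal.span {x} = Ideal.span {g • x} := by
  rw [Ideal.smul_closure, Set.smul_set_singleton]

theorem stick_emult_smul {R G : Type*} [CommRing R] [Group G] [MulSemiringAction G R] (g : G) (I J : Ideal R) :
    emultiplicity (g • I) J = emultiplicity I (g⁻¹ • J) := by
  conv_lhs => rw [← smul_inv_smul g J]
  exact emultiplicity_map_eq (MulDistribMulAction.toMulEquiv (Ideal R) g)

/-- Ideal factorization in terms of the valuation at one prime. -/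
theorem stick_ideal {K : Type*} [Field K] [NumberField K] {p q f m : ℕ} (hp : p.Prime) [IsCyclotomicExtension {p} ℚ K]
    (hq : q.Prime) (hqp : q ≠ p) (hf : f = orderOf (q : ZMod p)) (hm : p - 1 = f * m)
    (σ : K ≃ₐ[ℚ] K) (hσ : orderOf σ = p - 1)
    (𝔮 : Ideal (𝓞 K)) [h𝔮 : 𝔮.IsPrime] (h0 : 𝔮 ≠ ⊥) (hmem : (q : 𝓞 K) ∈ 𝔮)
    (x : 𝓞 K) {N : ℕ} (hx : x ∣ (q : 𝓞 K) ^ N) (d : ℕ → ℕ)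
    (hd : ∀ i < m, emultiplicity 𝔮 (Ideal.span {(σ ^ i)⁻¹ • x}) = d i) :
    Ideal.span {x} = ∏ i ∈ range m, ((σ ^ i) • 𝔮) ^ d i := by
  have := Fact.mk hp
  have := Fact.mk hq
  have hqdp : ¬ q ∣ p := fun h => hqp ((Nat.prime_dvd_prime_iff_eq hq hp).1 h)
  have hgal : IsGalois ℚ K := IsCyclotomicExtension.isGalois {p} ℚ K
  have hL := stick_liesOver hq 𝔮 hmem
  have hcardG : Nat.card (K ≃ₐ[ℚ] K) = p - 1 := by
    rw [IsGalois.card_aut_eq_finrank, IsCyclotomicExtension.finrank (n := p) K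
      (Polynomial.cyclotomic.irreducible_rat hp.pos), Nat.totient_prime hp]
  have hf0 : 0 < f := by
    rcases Nat.eq_zero_or_pos f with h | h
    · have := hp.two_le
      rw [h] at hm; omega
    · exact h
  have hm0 : 0 < m := by
    rcases Nat.eq_zero_or_pos m with h | h
    · have := hp.two_le
      rw [h] at hm; omega
    · exact h
  have hpow : ∀ g : K ≃ₐ[ℚ] K, ∃ k : ℕ, σ ^ k = g := by
    intro g
    have htop : Subgroup.zpowers σ = ⊤ := by
      apply Subgroup.eq_top_of_card_eq
      rw [Nat.card_zpowers, hσ, hcardG]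
    have hg : g ∈ Subgroup.zpowers σ := by rw [htop]; exact Subgroup.mem_top g
    exact mem_powers_iff_mem_zpowers.2 hg
  have hstab : Nat.card (MulAction.stabilizer (K ≃ₐ[ℚ] K) 𝔮) = f := by
    rw [Ideal.card_stabilizer_eq (Ideal.span {(q : ℤ)}) 𝔮,
      IsCyclotomicExtension.Rat.inertiaDegIn_eq_of_not_dvd q K hqdp,
      IsCyclotomicExtension.Rat.ramificationIdxIn_eq_of_not_dvd q K hqdp, one_mul, hf]
  have hindex : (MulAction.stabilizer (K ≃ₐ[ℚ] K) 𝔮).index = m := by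
    have := (MulAction.stabilizer (K ≃ₐ[ℚ] K) 𝔮).card_mul_index
    rw [hstab, hcardG, hm] at this
    exact Nat.eq_of_mul_eq_mul_left hf0 this
  have hcomm : ∀ a b : K ≃ₐ[ℚ] K, a * b = b * a := by
    intro a b
    obtain ⟨k, rfl⟩ := hpow a
    obtain ⟨l, rfl⟩ := hpow b
    exact (Commute.refl σ).pow_pow k l
  have hnormal : (MulAction.stabilizer (K ≃ₐ[ℚ] K) 𝔮).Normal :=
    ⟨fun a ha b => by rw [hcomm b a, mul_assoc, mul_inv_cancel, mul_one]; exact ha⟩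
  have hσm : σ ^ m • 𝔮 = 𝔮 := by
    have := (MulAction.stabilizer (K ≃ₐ[ℚ] K) 𝔮).pow_index_mem σ
    rw [hindex] at this
    exact this
  have hqz : (q : 𝓞 K) ≠ 0 := by exact_mod_cast hq.ne_zero
  have hx0 : x ≠ 0 := by
    rintro rfl
    exact pow_ne_zero N hqz (zero_dvd_iff.1 hx)
  have hlt : ∀ i j, i ≤ j → j < m → σ ^ i • 𝔮 = σ ^ j • 𝔮 → i = j := by
    intro i j hij hj h
    have h1 : σ ^ (j - i) • 𝔮 = 𝔮 := by
      have : σ ^ j = σ ^ i * σ ^ (j - i) := by rw [← pow_add]; congr 1; omega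
      rw [this, mul_smul] at h
      exact (smul_left_cancel _ h).symm
    have h2 : (⟨σ ^ (j - i), h1⟩ : MulAction.stabilizer (K ≃ₐ[ℚ] K) 𝔮) ^ f = 1 := by
      rw [← hstab]; exact pow_card_eq_one'
    have h3 : σ ^ ((j - i) * f) = 1 := by
      have := congrArg Subtype.val h2
      rw [pow_mul]
      exact this
    have h4 := orderOf_dvd_of_pow_eq_one h3
    rw [hσ, hm, mul_comm f m] at h4
    have h5 := Nat.dvd_of_mul_dvd_mul_right hf0 h4
    have := Nat.eq_zero_of_dvd_of_lt h5 (by omega)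
    omega
  apply stick_factor (by simpa using hx0)
  · intro i hi
    apply Ideal.prime_of_isPrime
    · rw [Ne, smul_eq_iff_eq_inv_smul, Ideal.smul_bot]; exact h0
    · infer_instance
  · intro i hi j hj h
    rcases le_total i j with hij | hij
    · exact hlt i j hij hj h
    · exact (hlt j i hij hi h.symm).symm
  · intro i hi
    rw [stick_emult_smul, stick_smul_span]
    exact hd i hi
  · intro P hP hPx
    have hPp := Ideal.isPrime_of_prime hP
    have hqP : (q : 𝓞 K) ∈ P := by
      have : x ∈ P := by simpa using Ideal.dvd_iff_le.1 hPx
      obtain ⟨y, hy⟩ := hx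
      have h1 : (q : 𝓞 K) ^ N ∈ P := by rw [hy]; exact P.mul_mem_right _ this
      exact hPp.mem_of_pow_mem _ h1
    have hLP := stick_liesOver hq P hqP
    obtain ⟨τ, hτ⟩ := Ideal.exists_smul_eq_of_isGaloisGroup (Ideal.span {(q : ℤ)}) 𝔮 P (K ≃ₐ[ℚ] K)
    obtain ⟨k, rfl⟩ := hpow τ
    refine ⟨k % m, Nat.mod_lt _ hm0, ?_⟩
    rw [← hτ]
    have h1 : ∀ t : ℕ, σ ^ (m * t) • 𝔮 = 𝔮 := by
      intro t
      induction t with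
      | zero => simp
      | succ t ih => rw [mul_add, mul_one, pow_add, mul_smul, hσm, ih]
    conv_lhs => rw [← Nat.mod_add_div k m, pow_add, mul_smul, h1]

theorem stick_unram {K : Type*} [Field K] [NumberField K] {p q : ℕ} [NeZero p] [IsCyclotomicExtension {p} ℚ K]
    (hq : q.Prime) (hqp : ¬ q ∣ p) (𝔮 : IsDedekindDomain.HeightOneSpectrum (𝓞 K))
    (hmem : (q : 𝓞 K) ∈ 𝔮.asIdeal) : 𝔮.intValuation (q : 𝓞 K) = WithZero.exp (-1 : ℤ) := by
  have := Fact.mk hq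
  have hL := stick_liesOver hq 𝔮.asIdeal hmem
  have hqz : (q : ℤ) ≠ 0 := by exact_mod_cast hq.ne_zero
  have hb : Ideal.span {(q : ℤ)} ≠ ⊥ := by simpa using hq.ne_zero
  let v : IsDedekindDomain.HeightOneSpectrum ℤ := ⟨Ideal.span {(q : ℤ)}, inferInstance, hb⟩
  have : 𝔮.asIdeal.LiesOver v.asIdeal := hL
  have h1 := IsDedekindDomain.HeightOneSpectrum.intValuation_liesOver v 𝔮 (q : ℤ)
  rw [Ideal.ramificationIdx'_eq_ramificationIdx _ _ hb,
    IsCyclotomicExtension.Rat.ramificationIdx_eq_of_not_dvd q K 𝔮.asIdeal hqp, pow_one,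
    IsDedekindDomain.HeightOneSpectrum.intValuation_singleton v hqz rfl] at h1
  rw [h1]; simp

theorem stick_emult {R : Type*} [CommRing R] [IsDedekindDomain R] (v : IsDedekindDomain.HeightOneSpectrum R)
    {x : R} {C : ℕ} (h : v.intValuation x = WithZero.exp (-1 : ℤ) ^ C) : emultiplicity v.asIdeal (Ideal.span {x}) = C := by
  have hx : x ≠ 0 := by rintro rfl; rw [map_zero] at h; exact pow_ne_zero C (WithZero.exp_ne_zero) h.symm
  rw [v.intValuation_eq_exp_neg_multiplicity hx, ← WithZero.exp_nsmul, WithZero.exp_inj] at h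
  have hfin : FiniteMultiplicity v.asIdeal (Ideal.span {x}) :=
    FiniteMultiplicity.of_prime_left v.prime (by simpa using hx)
  rw [hfin.emultiplicity_eq_multiplicity]
  have : multiplicity v.asIdeal (Ideal.span {x}) = C := by
    simp at h; exact_mod_cast h
  rw [this]

end Parte

section Partf
open Pointwise

theorem stick_mk0 {R : Type*} [CommRing R] [IsDedekindDomain R] {m : ℕ} (J : ℕ → (Ideal R)⁰) (d : ℕ → ℕ) {x : R}
    (h : Ideal.span {x} = ∏ i ∈ range m, (J i : Ideal R) ^ d i) :
    ∏ i ∈ range m, ClassGroup.mk0 (J i) ^ d i = 1 := by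
  simp only [← map_pow]
  rw [← map_prod, ClassGroup.mk0_eq_one_iff]
  have : ((∏ i ∈ range m, J i ^ d i : (Ideal R)⁰) : Ideal R) = Ideal.span {x} := by
    rw [h]; simp
  rw [this]
  exact ⟨⟨x, rfl⟩⟩

theorem stick_sum_roots {k M : Type*} [Field k] [AddCommMonoid M] {f : ℕ} (hf : 0 < f) {a b : k} (ha : IsPrimitiveRoot a f)
    (hb : IsPrimitiveRoot b f) (F : k → M) : ∑ j ∈ range f, F (a ^ j) = ∑ j ∈ range f, F (b ^ j) := by
  classical
  have key : ∀ g : k, IsPrimitiveRoot g f → ∑ j ∈ range f, F (g ^ j) = ∑ x ∈ Polynomial.nthRootsFinset f (1 : k), F x := by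
    intro g hg
    have h3 : Polynomial.nthRootsFinset f (1 : k) = (range f).image (fun l => g ^ l) := by
      symm
      apply Finset.eq_of_subset_of_card_le
      · intro x hx
        obtain ⟨l, hl, rfl⟩ := Finset.mem_image.1 hx
        rw [Polynomial.mem_nthRootsFinset hf, ← pow_mul, mul_comm, pow_mul, hg.pow_eq_one, one_pow]
      · rw [hg.card_nthRootsFinset, Finset.card_image_of_injOn, Finset.card_range]
        intro a ha b hb hab
        exact hg.pow_inj (by simpa using ha) (by simpa using hb) hab
    rw [h3, Finset.sum_image (by
        intro a ha b hb hab
        exact hg.pow_inj (by simpa using ha) (by simpa using hb) hab)]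
  rw [key a ha, key b hb]

theorem stick_main
    (p : ℕ) (hp : p.Prime)
    (v : ℕ)
    (hv : orderOf (v : ZMod p) = p - 1)
    (vn : ℤ → ℕ)
    (hvn1 : ∀ n : ℤ, 1 ≤ vn n) (hvn2 : ∀ n : ℤ, vn n ≤ p - 1)
    (hvn0 : vn 0 = 1)
    (hvnrec : ∀ n : ℤ, (vn (n + 1) : ZMod p) = (v : ZMod p) * (vn n : ZMod p))
    (K : Type*) [Field K] [NumberField K]
    [IsCyclotomicExtension {p} ℚ K]
    (ζ : K) (hζ : IsPrimitiveRoot ζ p)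
    (σ : K ≃ₐ[ℚ] K) (hσ : σ ζ = ζ ^ v)
    (q : ℕ) (hq : q.Prime) (hqodd : q ≠ 2) (hqp : q ≠ p)
    (f : ℕ) (hf : f = orderOf ((q : ZMod p))) (hf1 : 1 < f)
    (m : ℕ) (hm : m = (p - 1) / f)
    (𝔮 : Ideal (𝓞 K)) (h𝔮prime : 𝔮.IsPrime)
    (h𝔮0 : 𝔮 ∈ (Ideal (𝓞 K))⁰)
    (h𝔮q : ((q : 𝓞 K)) ∈ 𝔮)
    (c : ℕ → ℤ)
    (hc : ∀ i : ℕ, (p : ℤ) * c i =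
      ∑ j ∈ Finset.range f, (vn (-((i : ℤ) + (j : ℤ) * (m : ℤ))) : ℤ))
    (hl : ∀ l : ℕ, 1 ≤ l → l < m →
        ¬ (p : ℤ) ∣ ∑ i ∈ Finset.range m, c i * (v : ℤ) ^ (l * f * i)) :
      Nat.Coprime (orderOf (ClassGroup.mk0 ⟨𝔮, h𝔮0⟩)) p := by
  have := Fact.mk hp
  have hp2 := hp.two_le
  have hqdp : ¬ q ∣ p := fun h => hqp ((Nat.prime_dvd_prime_iff_eq hq hp).1 h)
  have h0 : 𝔮 ≠ ⊥ := by simpa using h𝔮0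
  have hq0 : (q : ZMod p) ≠ 0 := by
    rw [Ne, ZMod.natCast_eq_zero_iff]
    intro h; exact hqp ((Nat.prime_dvd_prime_iff_eq hp hq).1 h).symm
  have hv0 : (v : ZMod p) ≠ 0 := by
    intro h
    have h1 := pow_orderOf_eq_one (v : ZMod p)
    rw [hv, h, zero_pow (by omega)] at h1
    exact zero_ne_one h1
  have hfm : p - 1 = f * m := by
    have : f ∣ p - 1 := by rw [hf]; exact ZMod.orderOf_dvd_card_sub_one hq0
    rw [hm, Nat.mul_div_cancel' this]
  have hm0 : 0 < m := by
    rcases Nat.eq_zero_or_pos m with h | h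
    · rw [h] at hfm; omega
    · exact h
  have hmp : m < p := by nlinarith [Nat.sub_add_cancel hp.one_lt.le]
  have hvprim : IsPrimitiveRoot (v : ZMod p) (p - 1) := hv ▸ IsPrimitiveRoot.orderOf _
  have hvz : ∀ n : ℤ, (vn n : ZMod p) = (v : ZMod p) ^ n := by
    intro n
    induction n with
    | zero => simp [hvn0]
    | succ n ih => rw [hvnrec, ih, zpow_add_one₀ hv0, mul_comm]
    | pred n ih =>
      have := hvnrec (-(n : ℤ) - 1)
      rw [sub_add_cancel, ih] at this
      rw [zpow_sub_one₀ hv0, this]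
      field_simp
  have hval : ∀ n : ℤ, vn n = ((v : ZMod p) ^ n).val := by
    intro n
    rw [← hvz, ZMod.val_natCast, Nat.mod_eq_of_lt]
    have := hvn2 n
    omega
  have hσpow : ∀ n : ℕ, (σ ^ n) ζ = ζ ^ (v ^ n) := by
    intro n
    induction n with
    | zero => simp
    | succ n ih => rw [pow_succ', AlgEquiv.mul_apply, ih, map_pow, hσ, ← pow_mul, pow_succ']
  have hζeq : ∀ a b : ℕ, (a : ZMod p) = b → ζ ^ a = ζ ^ b := by
    intro a b hab
    rw [← pow_mod_orderOf ζ a, ← pow_mod_orderOf ζ b, ← hζ.eq_orderOf,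
      (ZMod.natCast_eq_natCast_iff' _ _ _).1 hab]
  have hgal : IsGalois ℚ K := IsCyclotomicExtension.isGalois {p} ℚ K
  have hσord : orderOf σ = p - 1 := by
    apply Nat.dvd_antisymm
    · have : Nat.card (K ≃ₐ[ℚ] K) = p - 1 := by
        rw [IsGalois.card_aut_eq_finrank, IsCyclotomicExtension.finrank (n := p) K
          (Polynomial.cyclotomic.irreducible_rat hp.pos), Nat.totient_prime hp]
      rw [← this]; exact orderOf_dvd_natCard σ
    · rw [← hv]
      apply orderOf_dvd_of_pow_eq_one
      have h1 := hσpow (orderOf σ)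
      rw [pow_orderOf_eq_one, AlgEquiv.one_apply] at h1
      have h2 : ζ ^ 1 = ζ ^ (v ^ orderOf σ) := by rw [pow_one]; exact h1
      rw [← pow_mod_orderOf ζ 1, ← pow_mod_orderOf ζ (v ^ orderOf σ), ← hζ.eq_orderOf] at h2
      have h3 := hζ.pow_inj (Nat.mod_lt _ hp.pos) (Nat.mod_lt _ hp.pos) h2
      have h4 := (ZMod.natCast_eq_natCast_iff' _ _ p).2 h3
      push_cast at h4
      exact h4.symm
  have hz₀ : IsPrimitiveRoot hζ.toInteger p := hζ.toInteger_isPrimitiveRoot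
  have hτ : ∀ i : ℕ, (σ ^ i)⁻¹ • hζ.toInteger = hζ.toInteger ^ vn (-(i : ℤ)) := by
    intro i
    rw [inv_smul_eq_iff, smul_pow']
    apply RingOfIntegers.ext
    have h1 : ((σ ^ i) ζ) ^ vn (-(i : ℤ)) = ζ ^ 1 := by
      rw [hσpow, ← pow_mul]
      apply hζeq
      push_cast
      rw [hvz, zpow_neg, zpow_natCast, mul_inv_cancel₀ (pow_ne_zero _ hv0)]
    rw [pow_one] at h1
    exact h1.symm
  have hvm : IsPrimitiveRoot (((v : ZMod p) ^ m)⁻¹) f :=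
    (hvprim.pow (by omega) (show p - 1 = m * f by rw [hfm, mul_comm])).inv
  have hqprim : IsPrimitiveRoot (q : ZMod p) f := hf ▸ IsPrimitiveRoot.orderOf _
  have hCsum : ∀ i : ℕ, (p : ℤ) * c i = ((∑ j ∈ range f, (vn (-(i : ℤ)) * q ^ j) % p : ℕ) : ℤ) := by
    intro i
    rw [hc]
    rw [← Nat.cast_sum]
    congr 1
    have h1 := stick_sum_roots (by omega) hvm hqprim (fun x => ((v : ZMod p) ^ (-(i : ℤ)) * x).val)
    rw [Finset.sum_congr rfl (fun j _ => ?_), h1, Finset.sum_congr rfl (fun j _ => ?_)]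
    · rw [← ZMod.val_natCast]
      push_cast
      rw [hvz]
    · rw [hval]
      congr 1
      rw [neg_add, zpow_add₀ hv0, inv_pow, ← pow_mul, ← zpow_natCast, ← zpow_neg]
      push_cast
      rw [mul_comm (m : ℤ)]
  have hcnn : ∀ i, 0 ≤ c i := by
    intro i
    have h1 : (0 : ℤ) ≤ (p : ℤ) * c i := by rw [hCsum]; exact Nat.cast_nonneg _
    exact nonneg_of_mul_nonneg_right h1 (by exact_mod_cast hp.pos)
  let C : ℕ → ℕ := fun i => (c i).toNat
  have hC : ∀ i, (C i : ℤ) = c i := fun i => Int.toNat_of_nonneg (hcnn i)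
  have hCp : ∀ i, p * C i = ∑ j ∈ range f, (vn (-(i : ℤ)) * q ^ j) % p := by
    intro i
    have := hCsum i
    rw [← hC] at this
    exact_mod_cast this
  let w : IsDedekindDomain.HeightOneSpectrum (𝓞 K) := ⟨𝔮, h𝔮prime, h0⟩
  obtain ⟨γ, hγ, hγv⟩ := stick_global hp hq hqodd hqp hf hf1 w h𝔮q hz₀
  have hun := stick_unram (p := p) hq hqdp w h𝔮q
  have e1 := stick_ideal hp hq hqp hf hfm σ hσord 𝔮 h0 h𝔮q γ hγ C (by
    intro i hi
    apply stick_emult w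
    have := hγv (MulSemiringAction.toRingHom (K ≃ₐ[ℚ] K) (𝓞 K) (σ ^ i)⁻¹) (vn (-(i : ℤ))) (C i) (hvn1 _)
      (by have := hvn2 (-(i : ℤ)); omega) (hτ i) (hCp i)
    rw [hun] at this
    exact this)
  have e2 := stick_ideal hp hq hqp hf hfm σ hσord 𝔮 h0 h𝔮q (q : 𝓞 K) (N := 1) (by simp) (fun _ => 1) (by
    intro i hi
    apply stick_emult w
    have : (σ ^ i)⁻¹ • (q : 𝓞 K) = q := map_natCast (MulSemiringAction.toRingHom (K ≃ₐ[ℚ] K) (𝓞 K) (σ ^ i)⁻¹) q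
    rw [this, hun, pow_one])
  let J : ℕ → (Ideal (𝓞 K))⁰ := fun n => ⟨(σ ^ n • 𝔮 : Ideal (𝓞 K)), by
    rw [mem_nonZeroDivisors_iff_ne_zero, Ne, Ideal.zero_eq_bot, smul_eq_iff_eq_inv_smul, Ideal.smul_bot]; exact h0⟩
  have shift : ∀ (x : 𝓞 K) (d : ℕ → ℕ), Ideal.span {x} = ∏ i ∈ range m, ((σ ^ i) • 𝔮 : Ideal (𝓞 K)) ^ d i →
      ∀ k, ∏ i ∈ range m, ClassGroup.mk0 (J (i + k)) ^ d i = 1 := by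
    intro x d hx k
    apply stick_mk0 (fun i => J (i + k)) d (x := σ ^ k • x)
    rw [← stick_smul_span, hx, Finset.smul_prod']
    refine Finset.prod_congr rfl fun i _ => ?_
    rw [smul_pow', smul_smul, ← pow_add, add_comm k i]
  have hJ0 : J 0 = ⟨𝔮, h𝔮0⟩ := by
    apply Subtype.ext
    simp [J]
  rw [← hJ0]
  apply stick_abstract hm0 (g := (v : ℤ) ^ f) (p := p) (m := m) ?_ ?_ (fun n => ClassGroup.mk0 (J n)) c
  · intro k
    have := shift γ C e1 k
    rw [← this]
    refine Finset.prod_congr rfl fun i _ => ?_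
    rw [← hC i, zpow_natCast]
  · intro k
    have := shift _ _ e2 k
    simpa using this
  · intro l h1 h2
    have := hl l h1 h2
    convert this using 4 with i
    rw [← pow_mul]
    congr 1
    ring
  · push_cast
    exact hvprim.pow (by omega) hfm
  · rw [Ne, ZMod.natCast_eq_zero_iff]
    exact Nat.not_dvd_of_pos_of_lt hm0 hmp

end Partf

theorem statement9
    (p : ℕ) (hp : p.Prime) (hp2 : p ≠ 2)
    (v : ℕ) (hv1 : 1 ≤ v) (hv2 : v ≤ p - 1)
    (hv : orderOf (v : ZMod p) = p - 1)
    (vn : ℤ → ℕ)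
    (hvn1 : ∀ n : ℤ, 1 ≤ vn n) (hvn2 : ∀ n : ℤ, vn n ≤ p - 1)
    (hvn0 : vn 0 = 1)
    (hvnrec : ∀ n : ℤ, (vn (n + 1) : ZMod p) = (v : ZMod p) * (vn n : ZMod p))
    (K : Type*) [Field K] [NumberField K]
    [IsCyclotomicExtension {p} ℚ K]
    (ζ : K) (hζ : IsPrimitiveRoot ζ p)
    (σ : K ≃ₐ[ℚ] K) (hσ : σ ζ = ζ ^ v)
    (q : ℕ) (hq : q.Prime) (hqodd : q ≠ 2) (hqp : q ≠ p)
    (f : ℕ) (hf : f = orderOf ((q : ZMod p))) (hf1 : 1 < f)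
    (m : ℕ) (hm : m = (p - 1) / f)
    (𝔮 : Ideal (𝓞 K)) (h𝔮prime : 𝔮.IsPrime)
    (h𝔮0 : 𝔮 ∈ (Ideal (𝓞 K))⁰)
    (h𝔮q : ((q : 𝓞 K)) ∈ 𝔮)
    (c : ℕ → ℤ)
    (hc : ∀ i : ℕ, (p : ℤ) * c i =
      ∑ j ∈ Finset.range f, (vn (-((i : ℤ) + (j : ℤ) * (m : ℤ))) : ℤ)) :
    (¬ Nat.Coprime (orderOf (ClassGroup.mk0 ⟨𝔮, h𝔮0⟩)) p →
      ∃ l : ℕ, 1 ≤ l ∧ l < m ∧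
        (p : ℤ) ∣ ∑ i ∈ Finset.range m, c i * (v : ℤ) ^ (l * f * i))
    ∧
    ((∀ l : ℕ, 1 ≤ l → l < m →
        ¬ (p : ℤ) ∣ ∑ i ∈ Finset.range m, c i * (v : ℤ) ^ (l * f * i)) →
      Nat.Coprime (orderOf (ClassGroup.mk0 ⟨𝔮, h𝔮0⟩)) p) := by
  have main := stick_main p hp v hv vn hvn1 hvn2 hvn0 hvnrec K ζ hζ σ hσ q hq hqodd hqp f hf hf1 m hm
    𝔮 h𝔮prime h𝔮0 h𝔮q c hc
  refine ⟨fun h => ?_, main⟩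
  by_contra hcon
  exact h (main fun l h1 h2 h3 => hcon ⟨l, h1, h2, h3⟩)
end

section
/- Suppose c is an ideal class of O_K of order p² such that σ(c) = c^{μ + a·p} for integers μ, a with 1 ≤ μ ≤ p−1 and 1 ≤ a ≤ p−1. Then Σ_{i=1}^{p-2} μ^i·δ_i ≡ 0 (mod p), and Σ_{i=1}^{p-2} μ^{p-2+i}·δ_i + (μ^{p-1} − 1)·Σ_{i=1}^{p-2} i·μ^{i-1}·δ_i ≡ 0 (mod p²). -/
open NumberField Finset nonZeroDivisors

open scoped Pointwise

theorem s10_jac_zero {F O : Type*} [Field F] [Fintype F] [CommRing O] (π : O →+* F)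
    (χ : MulChar F O) (k : ℕ) (hχ : ∀ x, π (χ x) = x ^ k) (a b : ℕ) (ha : 1 ≤ a)
    (hb : 1 ≤ b) (h : k * (a + b) < Fintype.card F - 1) :
    π (jacobiSum (χ ^ a) (χ ^ b)) = 0 := by
  classical
  have h1 : π (jacobiSum (χ ^ a) (χ ^ b)) = ∑ x : F, x ^ (k * a) * (1 - x) ^ (k * b) := by
    rw [jacobiSum, map_sum]
    refine Finset.sum_congr rfl fun x _ => ?_
    rw [map_mul, MulChar.pow_apply' _ (by omega), MulChar.pow_apply' _ (by omega), map_pow,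
      map_pow, hχ, hχ, pow_mul, pow_mul]
  rw [h1]
  have h2 : ∀ f : Polynomial F, f.natDegree < Fintype.card F - 1 → ∑ x : F, f.eval x = 0 := by
    intro f hf
    simp_rw [Polynomial.eval_eq_sum_range]
    rw [Finset.sum_comm]
    refine Finset.sum_eq_zero fun i hi => ?_
    rw [← Finset.mul_sum, FiniteField.sum_pow_lt_card_sub_one, mul_zero]
    simp at hi
    omega
  have h3 := h2 (Polynomial.X ^ (k * a) * (1 - Polynomial.X) ^ (k * b)) (by
    refine lt_of_le_of_lt ?_ h
    refine Polynomial.natDegree_mul_le.trans ?_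
    rw [mul_add]
    refine add_le_add (by simp) ?_
    refine Polynomial.natDegree_pow_le.trans ?_
    have : (1 - Polynomial.X : Polynomial F).natDegree ≤ 1 := by
      refine (Polynomial.natDegree_sub_le _ _).trans (by simp)
    exact (Nat.mul_le_mul_left _ this).trans (by simp))
  simpa using h3

theorem s10_exists_char {O F : Type*} [CommRing O] [IsDomain O] [Field F] [Fintype F]
    (π : O →+* F)
    (p : ℕ) (hp : p.Prime) (ζ : O) (hζ : IsPrimitiveRoot ζ p) (h1 : π ζ ≠ 1) :
    ∃ (k : ℕ) (χ : MulChar F O), 1 ≤ k ∧ k * p = Fintype.card F - 1 ∧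
      (∀ x, π (χ x) = x ^ k) ∧ orderOf χ = p := by
  classical
  have : Fact p.Prime := ⟨hp⟩
  have hord : orderOf (π ζ) = p := orderOf_eq_prime (by rw [← map_pow, hζ.pow_eq_one, map_one]) h1
  have hprim : IsPrimitiveRoot (π ζ) p := IsPrimitiveRoot.iff_orderOf.mpr hord
  have hne : π ζ ≠ 0 := hprim.ne_zero hp.ne_zero
  have hcard : Fintype.card Fˣ = Fintype.card F - 1 := Fintype.card_units F
  obtain ⟨k, hk⟩ : p ∣ Fintype.card F - 1 := by
    rw [← hcard, ← hord, ← Units.val_mk0 hne, orderOf_units]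
    exact orderOf_dvd_card
  have hkpos : 1 ≤ k := by
    rcases Nat.eq_zero_or_pos k with h | h
    · have := Fintype.one_lt_card (α := F)
      subst h; omega
    · exact h
  obtain ⟨g, hg⟩ := IsCyclic.exists_generator (α := Fˣ)
  have hgord : orderOf g = p * k := by
    rw [orderOf_eq_card_of_forall_mem_zpowers hg, Nat.card_eq_fintype_card, hcard, hk]
  have hgk : ((g : F) ^ k) ^ p = 1 := by
    rw [← pow_mul, mul_comm, ← hgord, ← Units.val_pow_eq_pow_val, pow_orderOf_eq_one, Units.val_one]
  obtain ⟨i, hi, hgi⟩ := hprim.eq_pow_of_pow_eq_one hgk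
  have hu : IsUnit ζ := hζ.isUnit hp.ne_zero
  have hmem : hu.unit ^ i ∈ rootsOfUnity (Fintype.card Fˣ) O := by
    rw [mem_rootsOfUnity, hcard, hk, ← pow_mul]
    ext
    simp only [Units.val_pow_eq_pow_val, IsUnit.unit_spec, Units.val_one]
    rw [show i * (p * k) = p * (i * k) by ring, pow_mul, hζ.pow_eq_one, one_pow]
  set χ := MulChar.ofRootOfUnity hmem hg with hχdef
  have hχg : χ g = ζ ^ i := by
    rw [hχdef, MulChar.ofRootOfUnity_spec]
    simp
  have hπ : ∀ x, π (χ x) = x ^ k := by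
    intro x
    by_cases hx : x = 0
    · subst hx
      rw [MulChar.map_zero, map_zero, zero_pow (by omega)]
    · obtain ⟨n, hn⟩ := mem_powers_iff_mem_zpowers.mpr (hg (Units.mk0 x hx))
      have hxn : x = (g : F) ^ n := by
        have := congrArg Units.val hn
        simpa using this.symm
      rw [hxn, map_pow, hχg, map_pow, map_pow, hgi, ← pow_mul, ← pow_mul, mul_comm]
  refine ⟨k, χ, hkpos, by rw [mul_comm, hk], hπ, ?_⟩
  refine orderOf_eq_prime ?_ ?_
  · refine (MulChar.eq_iff hg _ _).mpr ?_
    rw [MulChar.pow_apply' _ hp.ne_zero, hχg, ← pow_mul, mul_comm, pow_mul, hζ.pow_eq_one, one_pow]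
    simp
  · intro h
    have h2 : π (χ g) = 1 := by rw [h]; simp
    rw [hπ] at h2
    have h3 : g ^ k = 1 := by ext; simpa using h2
    have := orderOf_dvd_of_pow_eq_one h3
    rw [hgord] at this
    have := Nat.le_of_dvd hkpos this
    have := hp.two_le
    nlinarith

theorem s10_jac_mul {O F : Type*} [CommRing O] [IsDomain O] [CharZero O] [Field F] [Fintype F]
    (χ φ : MulChar F O) (h1 : χ ≠ 1) (h2 : φ ≠ 1) (h3 : χ * φ ≠ 1) :
    jacobiSum χ φ * jacobiSum χ⁻¹ φ⁻¹ = Fintype.card F := by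
  classical
  let L := FractionRing O
  have hinj : Function.Injective (algebraMap O L) := IsFractionRing.injective O L
  have : CharZero L := charZero_of_injective_algebraMap hinj
  apply hinj
  have hc : ringChar L ≠ ringChar F := by
    rw [ringChar.eq_zero]
    exact (CharP.ringChar_ne_zero_of_finite F).symm
  have hne : ∀ ψ : MulChar F O, ψ ≠ 1 → ψ.ringHomComp (algebraMap O L) ≠ 1 := fun ψ h =>
    (MulChar.ringHomComp_ne_one_iff hinj).mpr h
  have := jacobiSum_mul_jacobiSum_inv hc (hne _ h1) (hne _ h2)
    (by rw [← MulChar.ringHomComp_mul]; exact hne _ h3)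
  rw [MulChar.ringHomComp_inv, MulChar.ringHomComp_inv, jacobiSum_ringHomComp,
    jacobiSum_ringHomComp] at this
  rw [map_mul, this, map_natCast]

theorem s10_absNorm_smul {O : Type*} [CommRing O] [IsDedekindDomain O]
    [Module.Free ℤ O] [Module.Finite ℤ O] (g : RingAut O) (Q : Ideal O) :
    Ideal.absNorm (g • Q) = Ideal.absNorm Q := by
  rw [Ideal.absNorm_apply, Ideal.absNorm_apply, Submodule.cardQuot_apply, Submodule.cardQuot_apply]
  refine Nat.card_congr (Ideal.quotientEquiv Q (g • Q) g ?_).symm.toEquiv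
  rw [Ideal.pointwise_smul_def]
  rfl

/-- telescoping count -/
theorem s10_count (p t v : ℕ) (hp : 0 < p) (ht : t < p) (hv : 1 ≤ v) :
    ∑ b ∈ Finset.Ico 1 v, (if p ≤ t + (b * t) % p then 1 else 0) = v * t / p := by
  induction v, hv using Nat.le_induction with
  | base => simp [Nat.div_eq_of_lt ht]
  | succ n hn ih =>
    rw [Finset.sum_Ico_succ_top hn, ih, add_mul, one_mul, Nat.add_div hp, Nat.mod_eq_of_lt ht,
      Nat.div_eq_of_lt ht, add_comm ((n * t) % p) t]
    rfl

theorem s10_prod_dvd {O : Type*} [CommRing O] [IsDedekindDomain O] (S : Finset ℕ)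
    (P : ℕ → Ideal O) (hP : ∀ i, (P i).IsMaximal) (hinj : Set.InjOn P S) (x : O)
    (hx : ∀ i ∈ S, x ∈ P i) : ∏ i ∈ S, P i ∣ Ideal.span {x} := by
  refine Finset.prod_dvd_of_coprime ?_ ?_
  · intro i hi j hj hij
    have := hP i
    have := hP j
    exact Ideal.isCoprime_of_isMaximal fun h => hij (hinj hi hj h)
  · intro i hi
    rw [Ideal.dvd_span_singleton]
    exact hx i hi

/-- Stickelberger's relation for a prime with trivial decomposition group. -/
theorem s10_stick {O : Type*} [CommRing O] [IsDedekindDomain O] [CharZero O]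
    [Module.Free ℤ O] [Module.Finite ℤ O] (p : ℕ) (hp : p.Prime)
    (hrank : Module.finrank ℤ O = p - 1) (ζ : O) (hζ : IsPrimitiveRoot ζ p)
    (s : RingAut O) (t : ℕ → ℕ) (ht0 : ∀ i, 1 ≤ t i) (ht : ∀ i, t i < p)
    (hst : ∀ i, (s ^ i) ζ ^ t i = ζ) (Q : Ideal O) (hQ : Q.IsPrime) (hQ0 : Q ≠ ⊥)
    (hQ1 : ζ - 1 ∉ Q)
    (hinj : Set.InjOn (fun i => s ^ i • Q) (Finset.range (p - 1) : Set ℕ))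
    (v : ℕ) (hv1 : 1 ≤ v) (hv : v < p) :
    ∃ x : O, x ≠ 0 ∧ ∏ i ∈ Finset.range (p - 1), (s ^ i • Q) ^ (v * t i / p) = Ideal.span {x} := by
  classical
  have hpf : Fact p.Prime := ⟨hp⟩
  have hQm : Q.IsMaximal := hQ.isMaximal hQ0
  have hcard0 : Ideal.absNorm Q ≠ 0 := by rwa [Ne, Ideal.absNorm_eq_zero_iff]
  have hfin : Finite (O ⧸ Q) := (Ideal.absNorm_ne_zero_iff Q).mp hcard0
  let _ : Field (O ⧸ Q) := Ideal.Quotient.field Q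
  let _ : Fintype (O ⧸ Q) := Fintype.ofFinite _
  let F := O ⧸ Q
  have hq : Fintype.card F = Ideal.absNorm Q := by
    rw [Ideal.absNorm_apply, Submodule.cardQuot_apply, Nat.card_eq_fintype_card]
  let π : O →+* F := Ideal.Quotient.mk Q
  obtain ⟨k, χ, hk1, hkp, hχ, hord⟩ := s10_exists_char π p hp ζ hζ (by
    intro h
    apply hQ1
    rw [← Ideal.Quotient.eq_zero_iff_mem]
    change π (ζ - 1) = 0
    rw [map_sub, h, map_one, sub_self])
  have hχp : χ ^ p = 1 := by rw [← hord, pow_orderOf_eq_one]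
  have hmax : ∀ i, (s ^ i • Q).IsMaximal := by
    intro i
    have : (s ^ i • Q).IsPrime := inferInstance
    refine this.isMaximal ?_
    intro h
    apply hQ0
    have := congrArg (fun I => (s ^ i)⁻¹ • I) h
    simpa using this
  -- character transformation
  have hcomp : ∀ i, (χ ^ t i).ringHomComp ((s ^ i : RingAut O) : O →+* O) = χ := by
    intro i
    ext x
    obtain ⟨j, _, hj⟩ := MulChar.exists_apply_eq_pow hχp hζ (Units.ne_zero x)
    rw [MulChar.ringHomComp_apply, MulChar.pow_apply' _ (by have := ht0 i; omega), hj, ← pow_mul,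
      map_pow, mul_comm, pow_mul]
    congr 1
    exact hst i
  have hmod : ∀ n, χ ^ n = χ ^ (n % p) := by
    intro n
    rw [← hord, pow_mod_orderOf]
  have hcompb : ∀ i b, (χ ^ ((b * t i) % p)).ringHomComp ((s ^ i : RingAut O) : O →+* O) = χ ^ b := by
    intro i b
    rw [← hmod, mul_comm, pow_mul, ← MulChar.ringHomComp_pow, hcomp]
  have hnd : ∀ i b, 1 ≤ b → b < p → 1 ≤ (b * t i) % p := by
    intro i b hb1 hb
    rw [Nat.one_le_iff_ne_zero]
    intro h
    rcases (hp.dvd_mul).mp (Nat.dvd_of_mod_eq_zero h) with h | h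
    · have := Nat.le_of_dvd (by omega) h; omega
    · have := Nat.le_of_dvd (ht0 i) h; have := ht i; omega
  have hinvp : ∀ n, n ≤ p → (χ ^ n)⁻¹ = χ ^ (p - n) := by
    intro n hn
    rw [inv_eq_iff_mul_eq_one, ← pow_add, Nat.add_sub_cancel' hn, hχp]
  have hmemsmul : ∀ i (x : O), π x = 0 → ((s ^ i : RingAut O) : O →+* O) x ∈ s ^ i • Q := by
    intro i x hx
    exact Ideal.smul_mem_pointwise_smul (s ^ i) x Q (Ideal.Quotient.eq_zero_iff_mem.mp hx)
  have hJ : ∀ b ∈ Finset.Ico 1 v,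
      ∃ x : O, x ≠ 0 ∧
        ∏ i ∈ (Finset.range (p - 1)).filter (fun i => p ≤ t i + (b * t i) % p), (s ^ i • Q)
          = Ideal.span {x} := by
    intro b hb
    obtain ⟨hb1, hbv⟩ := Finset.mem_Ico.mp hb
    have hJ1 : ∀ i, t i + (b * t i) % p < p → jacobiSum χ (χ ^ b) ∈ s ^ i • Q := by
      intro i hi
      have h0 := s10_jac_zero π χ k hχ (t i) ((b * t i) % p) (ht0 i)
        (hnd i b hb1 (by omega)) (by rw [← hkp]; exact Nat.mul_lt_mul_of_pos_left hi hk1)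
      have h1 := hmemsmul i _ h0
      rwa [← jacobiSum_ringHomComp, hcomp, hcompb] at h1
    have hJ2 : ∀ i, p ≤ t i + (b * t i) % p → jacobiSum χ⁻¹ (χ ^ b)⁻¹ ∈ s ^ i • Q := by
      intro i hi
      have hne : p ≠ t i + (b * t i) % p := by
        intro h
        have h1 := hnd i (b + 1) (by omega) (by omega)
        rw [add_mul, one_mul, Nat.add_mod, Nat.mod_eq_of_lt (ht i), add_comm, ← h, Nat.mod_self] at h1
        omega
      have hm : (b * t i) % p < p := Nat.mod_lt _ hp.pos
      have hti := ht i
      have h0 := s10_jac_zero π χ k hχ (p - t i) (p - (b * t i) % p) (by omega)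
        (by omega) (by rw [← hkp]; exact Nat.mul_lt_mul_of_pos_left (by omega) hk1)
      have h1 := hmemsmul i _ h0
      rw [← jacobiSum_ringHomComp, ← hinvp _ hti.le, ← hinvp _ hm.le] at h1
      rwa [← MulChar.ringHomComp_inv, ← MulChar.ringHomComp_inv, hcomp, hcompb] at h1
    have hpow : ∀ n, 1 ≤ n → n < p → χ ^ n ≠ 1 := by
      intro n hn1 hn
      exact pow_ne_one_of_lt_orderOf (by omega) (by rw [hord]; exact hn)
    have hmul := s10_jac_mul χ (χ ^ b) (by simpa using hpow 1 le_rfl hp.one_lt)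
      (hpow b hb1 (by omega)) (by rw [← pow_succ']; exact hpow _ (by omega) (by omega))
    set J' := jacobiSum χ (χ ^ b) with hJ'
    set J := jacobiSum χ⁻¹ (χ ^ b)⁻¹ with hJdef
    have hqne : ((Fintype.card F : ℕ) : O) ≠ 0 := by
      rw [hq]; exact_mod_cast hcard0
    refine ⟨J, fun h => hqne (by rw [← hmul, h, mul_zero]), ?_⟩
    obtain ⟨X, hX⟩ := s10_prod_dvd ((Finset.range (p - 1)).filter (fun i => p ≤ t i + (b * t i) % p))
      (fun i => s ^ i • Q) hmax (hinj.mono (Finset.coe_subset.mpr (Finset.filter_subset _ _))) J (by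
        intro i hi
        exact hJ2 i (Finset.mem_filter.mp hi).2)
    obtain ⟨Y, hY⟩ := s10_prod_dvd ((Finset.range (p - 1)).filter (fun i => ¬ p ≤ t i + (b * t i) % p))
      (fun i => s ^ i • Q) hmax (hinj.mono (Finset.coe_subset.mpr (Finset.filter_subset _ _))) J' (by
        intro i hi
        exact hJ1 i (not_le.mp (Finset.mem_filter.mp hi).2))
    have hXY : (∏ i ∈ Finset.range (p - 1), s ^ i • Q) * (X * Y)
        = Ideal.span {((Fintype.card F : ℕ) : O)} := by
      rw [← hmul, ← Ideal.span_singleton_mul_span_singleton, hX, hY,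
        ← Finset.prod_filter_mul_prod_filter_not (Finset.range (p - 1))
          (fun i => p ≤ t i + (b * t i) % p)]
      ring
    have hN := congrArg Ideal.absNorm hXY
    rw [map_mul, map_prod, Ideal.absNorm_span_natCast, hrank] at hN
    simp_rw [s10_absNorm_smul] at hN
    rw [Finset.prod_const, Finset.card_range, hq] at hN
    have h1 : Ideal.absNorm (X * Y) = 1 :=
      Nat.eq_of_mul_eq_mul_left (pow_pos (Nat.pos_of_ne_zero hcard0) (p - 1)) (by rw [hN, mul_one])
    rw [map_mul] at h1
    have hX1 : X = 1 := by
      have := Nat.eq_one_of_mul_eq_one_right h1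
      rwa [Ideal.absNorm_eq_one_iff, ← Ideal.one_eq_top] at this
    rw [hX, hX1, mul_one]
  choose! x hx0 hx using hJ
  refine ⟨∏ b ∈ Finset.Ico 1 v, x b, Finset.prod_ne_zero_iff.mpr hx0, ?_⟩
  rw [← Ideal.prod_span_singleton, ← Finset.prod_congr rfl hx]
  simp_rw [Finset.prod_filter]
  rw [Finset.prod_comm]
  refine Finset.prod_congr rfl fun i _ => ?_
  rw [← s10_count p (t i) v hp.pos (ht i) hv1, ← Finset.prod_pow_eq_pow_sum]
  refine Finset.prod_congr rfl fun b _ => ?_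
  split_ifs <;> simp

theorem s10_norm {O : Type*} [CommRing O] [IsDedekindDomain O] (τ : RingAut O) (n : ℕ)
    (hτ : τ ^ n = 1) (I : Ideal O) (hI : I ≠ ⊥) :
    ∃ a b : O, τ a = a ∧ τ b = b ∧
      Ideal.span {a} ⊔ Ideal.span {b} = ∏ i ∈ Finset.range n, τ ^ i • I := by
  have hfix : ∀ x : O, τ (∏ i ∈ Finset.range n, (τ ^ i) x) = ∏ i ∈ Finset.range n, (τ ^ i) x := by
    intro x
    have h1 : τ (∏ i ∈ Finset.range n, (τ ^ i) x) = ∏ i ∈ Finset.range n, (τ ^ (i + 1)) x := by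
      rw [map_prod]
      refine Finset.prod_congr rfl fun i _ => ?_
      rw [pow_succ', RingAut.mul_apply]
    rcases Nat.eq_zero_or_pos n with h | h
    · subst h; simp
    · obtain ⟨m, rfl⟩ : ∃ m, n = m + 1 := ⟨n - 1, by omega⟩
      rw [h1, Finset.prod_range_succ, hτ, Finset.prod_range_succ', pow_zero]
  have hspan : ∀ (g : RingAut O) (x : O), g • Ideal.span {x} = Ideal.span {g x} := by
    intro g x
    rw [Ideal.smul_closure]
    congr 1
    exact Set.smul_set_singleton
  have hprod : ∀ x : O, Ideal.span {∏ i ∈ Finset.range n, (τ ^ i) x}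
      = ∏ i ∈ Finset.range n, τ ^ i • Ideal.span {x} := by
    intro x
    rw [← Ideal.prod_span_singleton]
    refine Finset.prod_congr rfl fun i _ => ?_
    rw [hspan]
  obtain ⟨x, hxI, hx0⟩ := Submodule.exists_mem_ne_zero_of_ne_bot hI
  set a := ∏ i ∈ Finset.range n, (τ ^ i) x with ha
  have ha0 : a ≠ 0 := by
    rw [ha, Finset.prod_ne_zero_iff]
    intro i _
    exact (map_ne_zero_iff _ (τ ^ i).injective).mpr hx0
  have haM : Ideal.span {a} ≠ 0 := by simpa using ha0
  obtain ⟨y, hy⟩ := IsDedekindDomain.exists_sup_span_eq (I := Ideal.span {a} * I) (J := I)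
    Ideal.mul_le_right (mul_ne_zero haM hI)
  obtain ⟨A, hA⟩ : I ∣ Ideal.span {x} := by
    rw [Ideal.dvd_span_singleton]; exact hxI
  obtain ⟨B, hB⟩ : I ∣ Ideal.span {y} := by
    rw [Ideal.dvd_span_singleton, ← hy]
    exact Ideal.mem_sup_right (Ideal.mem_span_singleton_self y)
  have hcop : IsCoprime (Ideal.span {a}) B := by
    rw [Ideal.isCoprime_iff_sup_eq]
    rw [hB, mul_comm, ← Ideal.mul_sup] at hy
    have : I * (Ideal.span {a} ⊔ B) = I * ⊤ := by rw [hy, Ideal.mul_top]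
    exact mul_left_cancel₀ hI this
  have hpowa : ∀ i, (τ ^ i) a = a := by
    intro i
    induction i with
    | zero => simp
    | succ k ih => rw [pow_succ, RingAut.mul_apply, hfix, ih]
  have hcop' : IsCoprime (Ideal.span {a}) (∏ i ∈ Finset.range n, τ ^ i • B) := by
    refine IsCoprime.prod_right fun i _ => ?_
    rw [Ideal.isCoprime_iff_sup_eq] at hcop ⊢
    have := congrArg (fun J => τ ^ i • J) hcop
    simp only [Ideal.smul_sup, hspan, hpowa] at this
    rw [this, eq_top_iff, Ideal.subset_pointwise_smul_iff]
    exact le_top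
  refine ⟨a, ∏ i ∈ Finset.range n, (τ ^ i) y, hfix x, hfix y, ?_⟩
  have h1 : Ideal.span {a} = (∏ i ∈ Finset.range n, τ ^ i • I) * ∏ i ∈ Finset.range n, τ ^ i • A := by
    rw [ha, hprod, ← Finset.prod_mul_distrib, hA]
    simp_rw [smul_mul']
  have h2 : Ideal.span {∏ i ∈ Finset.range n, (τ ^ i) y}
      = (∏ i ∈ Finset.range n, τ ^ i • I) * ∏ i ∈ Finset.range n, τ ^ i • B := by
    rw [hprod, ← Finset.prod_mul_distrib, hB]
    simp_rw [smul_mul']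
  have h3 : IsCoprime (∏ i ∈ Finset.range n, τ ^ i • A) (∏ i ∈ Finset.range n, τ ^ i • B) :=
    hcop'.of_isCoprime_of_dvd_left (Dvd.intro_left _ h1.symm)
  rw [Ideal.isCoprime_iff_sup_eq] at h3
  rw [h1, h2, ← Ideal.mul_sup, h3, Ideal.mul_top]

theorem s10_prime {O : Type*} [CommRing O] [IsDedekindDomain O] (g : RingAut O)
    (N J Q : Ideal O) (a b ζ : O) (hN : N ≠ ⊥) (hab : Ideal.span {a} ⊔ Ideal.span {b} = N)
    (hga : g a = a) (hgb : g b = b) (hJ : N * J = Ideal.span {a + b * ζ}) (hQ : Q.IsPrime)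
    (hJQ : J ≤ Q) (hgQ : g • Q = Q) : ζ - g ζ ∈ Q := by
  have hspan : ∀ (x : O), g • Ideal.span {x} = Ideal.span {g x} := by
    intro x
    rw [Ideal.smul_closure]
    congr 1
    exact Set.smul_set_singleton
  have hgN : g • N = N := by
    rw [← hab, Ideal.smul_sup, hspan, hspan, hga, hgb]
  have hx : a + b * ζ ∈ N * Q := by
    have : a + b * ζ ∈ N * J := by rw [hJ]; exact Ideal.mem_span_singleton_self _
    exact Ideal.mul_mono_right hJQ this
  have hgx : a + b * g ζ ∈ N * Q := by
    have := Ideal.smul_mem_pointwise_smul g _ _ hx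
    rw [smul_mul', hgN, hgQ] at this
    have h2 : g • (a + b * ζ) = a + b * g ζ := by
      change g (a + b * ζ) = _
      rw [map_add, map_mul, hga, hgb]
    rwa [h2] at this
  have hd : b * (ζ - g ζ) ∈ N * Q := by
    have := (N * Q).sub_mem hx hgx
    convert this using 1
    ring
  obtain ⟨B, hB⟩ : N ∣ Ideal.span {b} := by
    rw [Ideal.dvd_span_singleton, ← hab]
    exact Ideal.mem_sup_right (Ideal.mem_span_singleton_self b)
  have h1 : N * Q ∣ N * (B * Ideal.span {ζ - g ζ}) := by
    rw [← mul_assoc, ← hB, Ideal.span_singleton_mul_span_singleton, Ideal.dvd_span_singleton]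
    exact hd
  have h2 : Q ∣ B * Ideal.span {ζ - g ζ} := (mul_dvd_mul_iff_left hN).mp h1
  rw [Ideal.dvd_iff_le, hQ.mul_le] at h2
  rcases h2 with h2 | h2
  · exfalso
    have hb : b ∈ N * Q := by
      have : Ideal.span {b} ≤ N * Q := by rw [hB]; exact Ideal.mul_mono_right h2
      exact this (Ideal.mem_span_singleton_self b)
    have ha : a ∈ N * Q := by
      have := (N * Q).sub_mem hx ((N * Q).mul_mem_right ζ hb)
      simpa using this
    have h3 : N ≤ N * Q := by
      conv_lhs => rw [← hab]
      refine sup_le ?_ ?_ <;> rw [Ideal.span_singleton_le_iff_mem] <;> assumption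
    have h4 : N * Q ∣ N * ⊤ := by
      rw [Ideal.dvd_iff_le, Ideal.mul_top]; exact h3
    have h5 := (mul_dvd_mul_iff_left hN).mp h4
    rw [Ideal.dvd_iff_le] at h5
    exact hQ.ne_top (top_le_iff.mp h5)
  · exact h2 (Ideal.mem_span_singleton_self _)

theorem s10_exists_J {O : Type*} [CommRing O] [IsDedekindDomain O] (τ : RingAut O) (n : ℕ)
    (hτ : τ ^ n = 1) (I : Ideal O) (hI : I ≠ ⊥) (ζ : O) :
    ∃ J : Ideal O, J ≠ ⊥ ∧ ∃ x : O, x ≠ 0 ∧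
      (∏ i ∈ Finset.range n, τ ^ i • I) * J = Ideal.span {x} ∧
      ∀ Q : Ideal O, Q.IsPrime → J ≤ Q → ∀ k, τ ^ k • Q = Q → ζ - (τ ^ k) ζ ∈ Q := by
  obtain ⟨a, b, ha, hb, hab⟩ := s10_norm τ n hτ I hI
  set N := ∏ i ∈ Finset.range n, τ ^ i • I with hNdef
  have hN : N ≠ ⊥ := by
    rw [hNdef, ← Ideal.zero_eq_bot, Finset.prod_ne_zero_iff]
    intro i _ h
    apply hI
    have := congrArg (fun I => (τ ^ i)⁻¹ • I) h
    simpa using this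
  have hpow : ∀ (x : O), τ x = x → ∀ i, (τ ^ i) x = x := by
    intro x hx i
    induction i with
    | zero => simp
    | succ k ih => rw [pow_succ, RingAut.mul_apply, hx, ih]
  by_cases h0 : a + b * ζ = 0
  · have hNb : N = Ideal.span {b} := by
      rw [← hab, sup_eq_right, Ideal.span_singleton_le_iff_mem, Ideal.mem_span_singleton]
      exact ⟨-ζ, by linear_combination h0⟩
    refine ⟨⊤, by simp, b, ?_, by rw [Ideal.mul_top, hNb], ?_⟩
    · rintro rfl
      apply hN
      rw [hNb]; simp
    · intro Q hQ h
      exact absurd (top_le_iff.mp h) hQ.ne_top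
  · obtain ⟨J, hJ⟩ : N ∣ Ideal.span {a + b * ζ} := by
      rw [Ideal.dvd_span_singleton, ← hab]
      exact Ideal.add_mem _ (Ideal.mem_sup_left (Ideal.mem_span_singleton_self a))
        (Ideal.mul_mem_right _ _ (Ideal.mem_sup_right (Ideal.mem_span_singleton_self b)))
    refine ⟨J, ?_, a + b * ζ, h0, hJ.symm, ?_⟩
    · rintro rfl
      rw [Ideal.mul_bot, Ideal.span_singleton_eq_bot] at hJ
      exact h0 hJ
    · intro Q hQ hJQ k hk
      exact s10_prime (τ ^ k) N J Q a b ζ hN hab (hpow a ha k) (hpow b hb k) hJ.symm hQ hJQ hk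

theorem s10_E {C : Type*} [CommGroup C] [Finite C] (T : MulAut C) (p : ℕ) (hp : p.Prime)
    (N : ℕ) (hN1 : 1 ≤ N) (hN : N < p) (hT : T ^ N = 1) (m : ℕ) (hm : (p : ℤ) ∣ (m : ℤ) ^ N - 1) :
    ∃ (e w : ℕ) (E : C →* C), w.Coprime p ∧
      (∀ d, E (T d) = E d ^ (m ^ p ^ e)) ∧
      (∀ c, T c = c ^ (m ^ p ^ e) → E c = c ^ w) ∧ (∀ d, E d ^ p ^ e = 1) := by
  obtain ⟨e, u, hu, hcard⟩ := Nat.exists_eq_pow_mul_and_not_dvd (Nat.card_pos (α := C)).ne' p hp.ne_one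
  set M := m ^ p ^ e with hM
  have hMN : (p ^ e : ℤ) ∣ (M : ℤ) ^ N - 1 := by
    have h1 := dvd_sub_pow_of_dvd_sub (R := ℤ) (p := p) (a := (m : ℤ) ^ N) (b := 1) hm e
    rw [one_pow, ← pow_mul, mul_comm, pow_mul] at h1
    rw [hM]
    push_cast
    exact (pow_dvd_pow _ (Nat.le_succ e)).trans h1
  have hpu : ∀ d : C, (d ^ u) ^ p ^ e = 1 := by
    intro d
    rw [← pow_mul, mul_comm, ← hcard, pow_card_eq_one']
  have hMd : ∀ d : C, (d ^ u) ^ (M ^ N) = d ^ u := by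
    intro d
    have : M ^ N ≡ 1 [MOD p ^ e] := by
      refine (Nat.modEq_iff_dvd.mpr ?_).symm
      push_cast
      exact hMN
    have h2 : M ^ N ≡ 1 [MOD orderOf (d ^ u)] := this.of_dvd (orderOf_dvd_of_pow_eq_one (hpu d))
    have h3 := (pow_eq_pow_iff_modEq (x := d ^ u)).mpr h2
    rwa [pow_one] at h3
  let E : C →* C :=
    { toFun := fun d => ∏ j ∈ Finset.range N, (((T ^ j) d) ^ u) ^ (M ^ (N - 1 - j))
      map_one' := by simp
      map_mul' := fun x y => by
        simp only [map_mul, mul_pow, Finset.prod_mul_distrib] }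
  have hE : ∀ d, E d = ∏ j ∈ Finset.range N, (((T ^ j) d) ^ u) ^ (M ^ (N - 1 - j)) := fun _ => rfl
  have hpM : ¬ p ∣ M := by
    intro h
    have h1 : (p : ℤ) ∣ (m : ℤ) ^ N :=
      dvd_pow (by exact_mod_cast hp.dvd_of_dvd_pow h) (by omega)
    have h2 : (p : ℤ) ∣ 1 := by
      have := dvd_sub h1 hm
      simpa using this
    have := Int.le_of_dvd one_pos h2
    have := hp.two_le
    omega
  refine ⟨e, N * u * M ^ (N - 1), E, ?_, ?_, ?_, ?_⟩
  · refine Nat.Coprime.mul_left (Nat.Coprime.mul_left ?_ ?_) (Nat.Coprime.pow_left _ ?_)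
    · exact (Nat.coprime_of_lt_prime (by omega) hN hp).symm
    · exact ((Nat.Prime.coprime_iff_not_dvd hp).mpr hu).symm
    · exact ((Nat.Prime.coprime_iff_not_dvd hp).mpr hpM).symm
  · intro d
    rw [hE, hE, ← Finset.prod_pow]
    obtain ⟨k, rfl⟩ : ∃ k, N = k + 1 := ⟨N - 1, by omega⟩
    rw [Finset.prod_range_succ, Finset.prod_range_succ']
    have hTk : (T ^ k) (T d) = d := by
      rw [← MulAut.mul_apply, ← pow_succ, hT, MulAut.one_apply]
    rw [hTk]
    congr 1
    · refine Finset.prod_congr rfl fun j hj => ?_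
      have hj' := Finset.mem_range.mp hj
      rw [← MulAut.mul_apply, ← pow_succ, ← pow_mul _ (M ^ _) M, ← pow_succ]
      congr 2
      omega
    · simp only [Nat.add_sub_cancel, Nat.sub_self, pow_zero, Nat.sub_zero, pow_one,
        MulAut.one_apply]
      rw [← pow_mul _ (M ^ _) M, ← pow_succ, hMd]
  · intro c hc
    have hTj : ∀ j, (T ^ j) c = c ^ (M ^ j) := by
      intro j
      induction j with
      | zero => simp
      | succ j ih => rw [pow_succ, MulAut.mul_apply, hc, map_pow, ih, ← pow_mul, ← pow_succ]
    rw [hE]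
    have : ∀ j ∈ Finset.range N, (((T ^ j) c) ^ u) ^ (M ^ (N - 1 - j)) = c ^ (u * M ^ (N - 1)) := by
      intro j hj
      have hj' := Finset.mem_range.mp hj
      rw [hTj, ← pow_mul, ← pow_mul]
      congr 1
      rw [mul_comm (M ^ j), mul_assoc, ← pow_add]
      congr 2
      omega
    rw [Finset.prod_congr rfl this, Finset.prod_const, Finset.card_range, ← pow_mul]
    congr 1
    ring
  · intro d
    rw [hE, ← Finset.prod_pow]
    refine Finset.prod_eq_one fun j _ => ?_
    rw [← pow_mul, mul_comm, pow_mul, hpu, one_pow]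

theorem s10_smul_ne_bot {O : Type*} [CommRing O] (g : RingAut O) {I : Ideal O} (hI : I ≠ ⊥) :
    g • I ≠ ⊥ := by
  intro h
  apply hI
  have := congrArg (fun I => g⁻¹ • I) h
  simpa using this

/-- The class of an ideal (trivial for the zero ideal). -/
noncomputable def s10_cl {O : Type*} [CommRing O] [IsDedekindDomain O] (I : Ideal O) :
    ClassGroup O :=
  open Classical in if h : I ∈ (Ideal O)⁰ then ClassGroup.mk0 ⟨I, h⟩ else 1

theorem s10_cl_of {O : Type*} [CommRing O] [IsDedekindDomain O] {I : Ideal O} (hI : I ≠ ⊥) :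
    s10_cl I = ClassGroup.mk0 ⟨I, mem_nonZeroDivisors_of_ne_zero hI⟩ := by
  rw [s10_cl, dif_pos]

theorem s10_cl_mul {O : Type*} [CommRing O] [IsDedekindDomain O] {I J : Ideal O} (hI : I ≠ ⊥)
    (hJ : J ≠ ⊥) : s10_cl (I * J) = s10_cl I * s10_cl J := by
  rw [s10_cl_of hI, s10_cl_of hJ, s10_cl_of (mul_ne_zero hI hJ), ← map_mul]
  rfl

theorem s10_cl_prin {O : Type*} [CommRing O] [IsDedekindDomain O] {I : Ideal O}
    (hI : I.IsPrincipal) : s10_cl I = 1 := by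
  by_cases h : I = ⊥
  · rw [s10_cl, dif_neg]
    rw [mem_nonZeroDivisors_iff_ne_zero]
    simpa using h
  · rw [s10_cl_of h, ClassGroup.mk0_eq_one_iff]
    exact hI

theorem s10_cl_one {O : Type*} [CommRing O] [IsDedekindDomain O] :
    s10_cl (1 : Ideal O) = 1 :=
  s10_cl_prin ⟨1, by rw [Ideal.submodule_span_eq, Ideal.span_singleton_one, Ideal.one_eq_top]⟩

theorem s10_cl_prod {O : Type*} [CommRing O] [IsDedekindDomain O] (S : Finset ℕ)
    (f : ℕ → Ideal O) (hf : ∀ i, f i ≠ ⊥) (d : ℕ → ℕ) :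
    s10_cl (∏ i ∈ S, f i ^ d i) = ∏ i ∈ S, s10_cl (f i) ^ d i := by
  classical
  have hpow : ∀ i k, s10_cl (f i ^ k) = s10_cl (f i) ^ k := by
    intro i k
    induction k with
    | zero => rw [pow_zero, pow_zero, s10_cl_one]
    | succ k ih => rw [pow_succ, pow_succ, s10_cl_mul (pow_ne_zero _ (hf i)) (hf i), ih]
  induction S using Finset.induction_on with
  | empty => rw [Finset.prod_empty, Finset.prod_empty, s10_cl_one]
  | insert a S ha ih =>
    rw [Finset.prod_insert ha, Finset.prod_insert ha, s10_cl_mul (pow_ne_zero _ (hf a)), ih, hpow]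
    exact Finset.prod_ne_zero_iff.mpr fun i _ => pow_ne_zero _ (hf i)

theorem s10_main {O : Type*} [CommRing O] [IsDedekindDomain O] [CharZero O]
    [Module.Free ℤ O] [Module.Finite ℤ O] [Finite (ClassGroup O)] (p : ℕ) (hp : p.Prime)
    (hp2 : p ≠ 2)
    (hrank : Module.finrank ℤ O = p - 1) (ζ : O) (hζ : IsPrimitiveRoot ζ p)
    (s : RingAut O) (hs : s ^ (p - 1) = 1) (v : ℕ) (hv1 : 1 ≤ v) (hv2 : v < p)
    (hv : orderOf (v : ZMod p) = p - 1) (hsv : s ζ = ζ ^ v)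
    (t : ℕ → ℕ) (ht0 : ∀ i, 1 ≤ t i) (ht : ∀ i, t i < p)
    (hst : ∀ i, (s ^ i) ζ ^ t i = ζ)
    (hprin : ∀ j, ¬ p ∣ j → ∀ Q : Ideal O, Q.IsPrime → ζ ^ j - 1 ∈ Q → Q.IsPrincipal ∨ Q = ⊥)
    (T : MulAut (ClassGroup O)) (hT : ∀ I : Ideal O, I ≠ ⊥ → T (s10_cl I) = s10_cl (s • I))
    (c : ClassGroup O) (hc : orderOf c = p ^ 2) (m : ℕ) (hTc : T c = c ^ m) :
    ((p : ℤ) ^ 2 ∣ (m : ℤ) ^ (p - 1) - 1) ∧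
    ((p : ℤ) ^ 2 ∣ ∑ i ∈ Finset.range (p - 1), (m : ℤ) ^ i * (v * t i / p : ℕ)) := by
  have hpf : Fact p.Prime := ⟨hp⟩
  have hp3 : 3 ≤ p := by have := hp.two_le; omega
  have hTj : ∀ j (I : Ideal O), I ≠ ⊥ → (T ^ j) (s10_cl I) = s10_cl (s ^ j • I) := by
    intro j I hI
    induction j with
    | zero => simp
    | succ j ih =>
      rw [pow_succ', MulAut.mul_apply, ih, hT _ (s10_smul_ne_bot _ hI), pow_succ', mul_smul]
  have hsurj : ∀ d : ClassGroup O, ∃ I : Ideal O, I ≠ ⊥ ∧ s10_cl I = d := by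
    intro d
    obtain ⟨⟨I, hI⟩, rfl⟩ := ClassGroup.mk0_surjective d
    have hI' : I ≠ ⊥ := nonZeroDivisors.ne_zero hI
    exact ⟨I, hI', s10_cl_of hI'⟩
  have hTp : T ^ (p - 1) = 1 := by
    ext d
    obtain ⟨I, hI, rfl⟩ := hsurj d
    rw [hTj _ _ hI, hs, one_smul, MulAut.one_apply]
  have hTcj : ∀ j, (T ^ j) c = c ^ (m ^ j) := by
    intro j
    induction j with
    | zero => simp
    | succ j ih => rw [pow_succ, MulAut.mul_apply, hTc, map_pow, ih, ← pow_mul, ← pow_succ]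
  have hm2 : (p : ℤ) ^ 2 ∣ (m : ℤ) ^ (p - 1) - 1 := by
    have h1 : c ^ (m ^ (p - 1)) = c ^ 1 := by rw [← hTcj, hTp, MulAut.one_apply, pow_one]
    rw [pow_eq_pow_iff_modEq, hc] at h1
    have := Nat.modEq_iff_dvd.mp h1.symm
    push_cast at this
    exact this
  refine ⟨hm2, ?_⟩
  have hm1 : (p : ℤ) ∣ (m : ℤ) ^ (p - 1) - 1 := (dvd_pow_self _ two_ne_zero).trans hm2
  obtain ⟨e, w, E, hw, hET, hEc, hEp⟩ := s10_E T p hp (p - 1) (by omega) (by omega) hTp m hm1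
  set M := m ^ p ^ e with hM
  have hTcM : T c = c ^ M := by
    have h1 : p - 1 ∣ p ^ e - 1 := by simpa using Nat.sub_dvd_pow_sub_pow p 1 e
    obtain ⟨k, hk⟩ := h1
    have h2 : p ^ e = (p - 1) * k + 1 := by have := Nat.pow_pos (n := e) hp.pos; omega
    rw [hM, ← hTcj, h2, pow_succ, pow_mul, hTp, one_pow, one_mul]
  have hMm : (p : ℤ) ^ 2 ∣ (m : ℤ) - M := by
    have h1 : c ^ M = c ^ m := by rw [← hTcM, hTc]
    rw [pow_eq_pow_iff_modEq, hc] at h1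
    have := Nat.modEq_iff_dvd.mp h1
    push_cast at this
    exact_mod_cast this
  have hETj : ∀ j d, E ((T ^ j) d) = E d ^ (M ^ j) := by
    intro j
    induction j with
    | zero => simp
    | succ j ih => intro d; rw [pow_succ, MulAut.mul_apply, ih, hET, ← pow_mul, ← pow_succ']
  -- order of M mod p
  have hMp : (M : ZMod p) ^ (p - 1) = 1 := by
    have h1 : ((((m : ℤ) ^ (p - 1) - 1 : ℤ)) : ZMod p) = 0 :=
      (ZMod.intCast_zmod_eq_zero_iff_dvd _ p).mpr hm1
    push_cast at h1
    rw [hM, Nat.cast_pow, ← pow_mul, mul_comm, pow_mul, sub_eq_zero.mp h1, one_pow]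
  set r := orderOf (M : ZMod p) with hr
  obtain ⟨n, hn⟩ : r ∣ p - 1 := orderOf_dvd_of_pow_eq_one hMp
  have hn1 : 1 ≤ n := by
    rcases Nat.eq_zero_or_pos n with h | h
    · subst h; omega
    · exact h
  have hr1 : 1 ≤ r := by
    rcases Nat.eq_zero_or_pos r with h | h
    · rw [h] at hn; omega
    · exact h
  have hnp : n < p := by nlinarith [Nat.sub_lt hp.pos one_pos]
  obtain ⟨I, hI, hIc⟩ := hsurj c
  obtain ⟨J, hJ0, x, hx0, hNJ, hJQ⟩ := s10_exists_J (s ^ r) n (by rw [← pow_mul, ← hn, hs]) I hI ζ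
  set D := ∑ i ∈ Finset.range (p - 1), M ^ i * (v * t i / p) with hD
  have hvpow : ∀ j, (s ^ j) ζ = ζ ^ (v ^ j) := by
    intro j
    induction j with
    | zero => simp
    | succ j ih => rw [pow_succ, RingAut.mul_apply, hsv, map_pow, ih, ← pow_mul, ← pow_succ]
  have hv0 : (v : ZMod p) ≠ 0 := by
    rw [Ne, ZMod.natCast_eq_zero_iff]
    exact fun h => absurd (Nat.le_of_dvd hv1 h) (by omega)
  -- each prime factor of J is fine
  have hgood : ∀ Q : Ideal O, Q.IsPrime → Q ≠ ⊥ → J ≤ Q → E (s10_cl Q) ^ D = 1 := by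
    intro Q hQ hQ0 hJle
    by_cases hz : ∃ j, ¬ p ∣ j ∧ ζ ^ j - 1 ∈ Q
    · obtain ⟨j, hj, hjQ⟩ := hz
      have := (hprin j hj Q hQ hjQ).resolve_right hQ0
      rw [s10_cl_prin this, map_one, one_pow]
    push Not at hz
    by_cases hstab : ∃ j, 0 < j ∧ j < p - 1 ∧ s ^ j • Q = Q
    · obtain ⟨j, hj0, hj1, hjQ⟩ := hstab
      by_cases hrj : r ∣ j
      · exfalso
        obtain ⟨k, rfl⟩ := hrj
        have h1 := hJQ Q hQ hJle k (by rw [← pow_mul]; exact hjQ)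
        rw [← pow_mul, hvpow] at h1
        have hvj : (v : ZMod p) ^ (r * k) ≠ 1 :=
          pow_ne_one_of_lt_orderOf (by omega) (by rw [hv]; exact hj1)
        have hvpos : 1 ≤ v ^ (r * k) := Nat.pow_pos hv1
        refine hz (v ^ (r * k) - 1) ?_ ?_
        · intro h
          apply hvj
          rw [← ZMod.natCast_eq_zero_iff, Nat.cast_sub hvpos, sub_eq_zero] at h
          simpa using h
        · have h2 : ζ - ζ ^ (v ^ (r * k)) = (-ζ) * (ζ ^ (v ^ (r * k) - 1) - 1) := by
            obtain ⟨l, hl⟩ : ∃ l, v ^ (r * k) = l + 1 := ⟨v ^ (r * k) - 1, by omega⟩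
            rw [hl, Nat.add_sub_cancel]
            ring
          rw [h2] at h1
          rcases hQ.mem_or_mem h1 with h | h
          · exfalso
            refine hQ.ne_top (Ideal.eq_top_of_isUnit_mem _ h ?_)
            exact (hζ.isUnit hp.ne_zero).neg
          · exact h
      · have h1 : E (s10_cl Q) ^ (M ^ j) = E (s10_cl Q) ^ 1 := by
          rw [← hETj, hTj _ _ hQ0, hjQ, pow_one]
        have h2 : ¬ p ∣ orderOf (E (s10_cl Q)) := by
          intro h
          rw [pow_eq_pow_iff_modEq] at h1
          have h3 := h1.of_dvd h
          rw [← ZMod.natCast_eq_natCast_iff] at h3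
          push_cast at h3
          exact hrj (orderOf_dvd_of_pow_eq_one h3)
        have h3 : orderOf (E (s10_cl Q)) ∣ p ^ e := orderOf_dvd_of_pow_eq_one (hEp _)
        have h4 : (orderOf (E (s10_cl Q))).Coprime (p ^ e) :=
          Nat.Coprime.pow_right _ ((Nat.Prime.coprime_iff_not_dvd hp).mpr h2).symm
        have h5 := Nat.Coprime.eq_one_of_dvd h4 h3
        rw [orderOf_eq_one_iff.mp h5, one_pow]
    · push Not at hstab
      have hinj : Set.InjOn (fun i => s ^ i • Q) (Finset.range (p - 1) : Set ℕ) := by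
        have key : ∀ i j, i < j → j < p - 1 → s ^ i • Q ≠ s ^ j • Q := by
          intro i j hij hj h
          apply hstab (j - i) (by omega) (by omega)
          have h1 : s ^ j = s ^ i * s ^ (j - i) := by rw [← pow_add]; congr 1; omega
          rw [h1, mul_smul] at h
          exact (smul_left_cancel _ h).symm
        intro i hi j hj h
        rw [Finset.mem_coe, Finset.mem_range] at hi hj
        rcases lt_trichotomy i j with h1 | h1 | h1
        · exact absurd h (key i j h1 hj)
        · exact h1
        · exact absurd h.symm (key j i h1 hi)
      obtain ⟨y, _, hy⟩ := s10_stick p hp hrank ζ hζ s t ht0 ht hst Q hQ hQ0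
        (by simpa using hz 1 (fun h => by have := Nat.le_of_dvd one_pos h; omega)) hinj v hv1 hv2
      have h1 := congrArg (fun I => E (s10_cl I)) hy
      rw [s10_cl_prin ⟨y, rfl⟩, map_one, s10_cl_prod _ _ (fun i => s10_smul_ne_bot _ hQ0),
        map_prod] at h1
      rw [hD, ← Finset.prod_pow_eq_pow_sum, ← h1]
      refine Finset.prod_congr rfl fun i _ => ?_
      rw [map_pow, ← hTj _ _ hQ0, hETj]
      exact pow_mul _ _ _
  have hgoodJ : ∀ J' : Ideal O, J' ≠ ⊥ → J' ∣ J → E (s10_cl J') ^ D = 1 := by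
    intro J'
    induction J' using UniqueFactorizationMonoid.induction_on_prime with
    | h₁ => intro h; exact absurd rfl h
    | h₂ J' hu =>
      intro _ _
      rw [isUnit_iff_eq_one.mp hu, s10_cl_one, map_one, one_pow]
    | h₃ J' Q hJ'0 hQ ih =>
      intro hne hdvd
      rw [s10_cl_mul hQ.ne_zero hJ'0, map_mul, mul_pow, ih hJ'0 ((Dvd.intro_left _ rfl).trans hdvd),
        hgood Q (Ideal.isPrime_of_prime hQ) hQ.ne_zero
          (Ideal.dvd_iff_le.mp ((Dvd.intro _ rfl).trans hdvd)), one_mul]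
  have hEJ := hgoodJ J hJ0 dvd_rfl
  have hN0 : ∏ i ∈ Finset.range n, (s ^ r) ^ i • I ≠ ⊥ :=
    Finset.prod_ne_zero_iff.mpr fun i _ => s10_smul_ne_bot _ hI
  have hEN : E (s10_cl (∏ i ∈ Finset.range n, (s ^ r) ^ i • I)) ^ D = 1 := by
    have h1 := congrArg (fun I => E (s10_cl I) ^ D) hNJ
    rw [s10_cl_mul hN0 hJ0, map_mul, mul_pow, hEJ, mul_one, s10_cl_prin ⟨x, rfl⟩, map_one,
      one_pow] at h1
    exact h1
  have hEN2 : E (s10_cl (∏ i ∈ Finset.range n, (s ^ r) ^ i • I))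
      = c ^ (w * ∑ i ∈ Finset.range n, M ^ (r * i)) := by
    have h1 := s10_cl_prod (Finset.range n) (fun i => (s ^ r) ^ i • I)
      (fun i => s10_smul_ne_bot _ hI) (fun _ => 1)
    simp only [pow_one] at h1
    rw [h1, map_prod, pow_mul, ← hEc c hTcM, ← Finset.prod_pow_eq_pow_sum]
    refine Finset.prod_congr rfl fun i _ => ?_
    rw [← pow_mul, ← hTj _ _ hI, hETj, hIc]
  rw [hEN2, ← pow_mul] at hEN
  have hdvd := orderOf_dvd_of_pow_eq_one hEN
  rw [hc] at hdvd
  have hScop : (∑ i ∈ Finset.range n, M ^ (r * i)).Coprime p := by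
    rw [Nat.coprime_comm, Nat.Prime.coprime_iff_not_dvd hp, ← ZMod.natCast_eq_zero_iff]
    push_cast
    have h1 : ∀ i ∈ Finset.range n, (M : ZMod p) ^ (r * i) = 1 := by
      intro i _
      rw [pow_mul, hr, pow_orderOf_eq_one, one_pow]
    rw [Finset.sum_congr rfl h1, Finset.sum_const, Finset.card_range, nsmul_one,
      ZMod.natCast_eq_zero_iff]
    intro h
    have := Nat.le_of_dvd hn1 h
    omega
  have hD2 : p ^ 2 ∣ D :=
    Nat.Coprime.dvd_of_dvd_mul_left (Nat.Coprime.pow_left 2 (hw.mul_left hScop).symm) hdvd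
  have hD3 : (p : ℤ) ^ 2 ∣ ∑ i ∈ Finset.range (p - 1), (M : ℤ) ^ i * (v * t i / p : ℕ) := by
    have : ((p ^ 2 : ℕ) : ℤ) ∣ (D : ℤ) := by exact_mod_cast hD2
    rw [hD] at this
    push_cast at this ⊢
    exact this
  have hdiff : (p : ℤ) ^ 2 ∣ ∑ i ∈ Finset.range (p - 1), (m : ℤ) ^ i * (v * t i / p : ℕ)
      - ∑ i ∈ Finset.range (p - 1), (M : ℤ) ^ i * (v * t i / p : ℕ) := by
    rw [← Finset.sum_sub_distrib]
    refine Finset.dvd_sum fun i _ => ?_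
    rw [← sub_mul]
    exact Dvd.dvd.mul_right (hMm.trans (sub_dvd_pow_sub_pow _ _ _)) _
  exact (dvd_iff_dvd_of_dvd_sub hdiff).mpr hD3


theorem s10_arith (p : ℕ) (hp : 2 ≤ p) (μ a : ℤ) (δ : ℕ → ℤ)
    (h1 : (p : ℤ) ^ 2 ∣ (μ + a * p) ^ (p - 1) - 1)
    (h2 : (p : ℤ) ^ 2 ∣ ∑ i ∈ Finset.Icc 1 (p - 2), (μ + a * p) ^ i * δ i) :
    ((p : ℤ) ∣ ∑ i ∈ Finset.Icc 1 (p - 2), μ ^ i * δ i)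
    ∧
    ((p : ℤ) ^ 2 ∣
      (∑ i ∈ Finset.Icc 1 (p - 2), μ ^ (p - 2 + i) * δ i)
      + (μ ^ (p - 1) - 1) *
          ∑ i ∈ Finset.Icc 1 (p - 2), (i : ℤ) * μ ^ (i - 1) * δ i) := by
  have hT : ∀ i : ℕ, ∃ k : ℤ, (μ + a * p) ^ i = μ ^ i + i * μ ^ (i - 1) * (a * p) + k * (a * p) ^ 2 :=
    fun i => ⟨_, (Polynomial.powAddExpansion μ (a * p) i).2⟩
  set S := ∑ i ∈ Finset.Icc 1 (p - 2), μ ^ i * δ i with hS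
  set S' := ∑ i ∈ Finset.Icc 1 (p - 2), (i : ℤ) * μ ^ (i - 1) * δ i with hS'
  have h3 : (p : ℤ) ^ 2 ∣ S + a * p * S' := by
    have : (p : ℤ) ^ 2 ∣ ∑ i ∈ Finset.Icc 1 (p - 2), (μ + a * p) ^ i * δ i - (S + a * p * S') := by
      rw [hS, hS', Finset.mul_sum, ← Finset.sum_add_distrib, ← Finset.sum_sub_distrib]
      refine Finset.dvd_sum fun i _ => ?_
      obtain ⟨k, hk⟩ := hT i
      rw [hk]
      exact ⟨k * a ^ 2 * δ i, by ring⟩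
    exact (dvd_iff_dvd_of_dvd_sub this).mp h2
  refine ⟨?_, ?_⟩
  · have h4 : (p : ℤ) ∣ S + a * p * S' := (dvd_pow_self _ two_ne_zero).trans h3
    have h5 : (p : ℤ) ∣ a * p * S' := ⟨a * S', by ring⟩
    exact (dvd_add_left h5).mp h4
  · have hsum : ∑ i ∈ Finset.Icc 1 (p - 2), μ ^ (p - 2 + i) * δ i = μ ^ (p - 2) * S := by
      rw [hS, Finset.mul_sum]
      refine Finset.sum_congr rfl fun i _ => ?_
      rw [pow_add, mul_assoc]
    obtain ⟨k, hk⟩ := hT (p - 1)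
    obtain ⟨l, hl⟩ := h1
    obtain ⟨q, hq⟩ := h3
    rw [hk, show p - 1 - 1 = p - 2 by omega, Nat.cast_sub (by omega), Nat.cast_one] at hl
    rw [hsum]
    refine ⟨μ ^ (p - 2) * q + (l - k * a ^ 2 - μ ^ (p - 2) * a) * S', ?_⟩
    linear_combination μ ^ (p - 2) * hq + S' * hl

theorem statement10
    (p : ℕ) (hp : p.Prime) (hp2 : p ≠ 2)
    (v : ℕ) (hv1 : 1 ≤ v) (hv2 : v ≤ p - 1)
    (hv : orderOf (v : ZMod p) = p - 1)
    (vn : ℤ → ℕ)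
    (hvn1 : ∀ n : ℤ, 1 ≤ vn n) (hvn2 : ∀ n : ℤ, vn n ≤ p - 1)
    (hvn0 : vn 0 = 1)
    (hvnrec : ∀ n : ℤ, (vn (n + 1) : ZMod p) = (v : ZMod p) * (vn n : ZMod p))
    (K : Type*) [Field K] [NumberField K]
    [IsCyclotomicExtension {p} ℚ K]
    (ζ : K) (hζ : IsPrimitiveRoot ζ p)
    (σ : K ≃ₐ[ℚ] K) (hσ : σ ζ = ζ ^ v)
    (σ' : 𝓞 K ≃+* 𝓞 K)
    (hσ' : ∀ x : 𝓞 K, algebraMap (𝓞 K) K (σ' x) = σ (algebraMap (𝓞 K) K x))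
    (T : MulAut (ClassGroup (𝓞 K)))
    (hT : ∀ I J : (Ideal (𝓞 K))⁰,
      Ideal.map σ' (I : Ideal (𝓞 K)) = (J : Ideal (𝓞 K)) →
      T (ClassGroup.mk0 I) = ClassGroup.mk0 J)
    (δ : ℕ → ℤ)
    (hδ : ∀ i : ℕ, (p : ℤ) * δ i = (vn (1 - (i : ℤ)) : ℤ) - (v : ℤ) * (vn (-(i : ℤ)) : ℤ))
    (c : ClassGroup (𝓞 K)) (hc : orderOf c = p ^ 2)
    (μ a : ℕ) (hμ1 : 1 ≤ μ) (hμ2 : μ ≤ p - 1) (ha1 : 1 ≤ a) (ha2 : a ≤ p - 1)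
    (hTc : T c = c ^ (μ + a * p)) :
    ((p : ℤ) ∣ ∑ i ∈ Finset.Icc 1 (p - 2), (μ : ℤ) ^ i * δ i)
    ∧
    ((p : ℤ) ^ 2 ∣
      (∑ i ∈ Finset.Icc 1 (p - 2), (μ : ℤ) ^ (p - 2 + i) * δ i)
      + ((μ : ℤ) ^ (p - 1) - 1) *
          ∑ i ∈ Finset.Icc 1 (p - 2), (i : ℤ) * (μ : ℤ) ^ (i - 1) * δ i) := by
  have hpf : Fact p.Prime := ⟨hp⟩
  have hp3 : 3 ≤ p := by have := hp.two_le; omega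
  have hinjO : Function.Injective (algebraMap (𝓞 K) K) := RingOfIntegers.coe_injective
  set z : 𝓞 K := hζ.toInteger with hz
  have hzK : algebraMap (𝓞 K) K z = ζ := rfl
  have hzp : IsPrimitiveRoot z p := hζ.toInteger_isPrimitiveRoot
  let s : RingAut (𝓞 K) := σ'
  have hsv : s z = z ^ v := by
    apply hinjO
    rw [map_pow, hzK]
    change algebraMap (𝓞 K) K (σ' z) = _
    rw [hσ', hzK, hσ]
  have hsj : ∀ j (x : 𝓞 K), algebraMap (𝓞 K) K ((s ^ j) x) = (σ ^ j) (algebraMap (𝓞 K) K x) := by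
    intro j
    induction j with
    | zero => intro x; simp
    | succ j ih =>
      intro x
      rw [pow_succ, RingAut.mul_apply, ih, pow_succ, AlgEquiv.mul_apply]
      congr 1
      exact hσ' x
  have hvz : ∀ j, (s ^ j) z = z ^ (v ^ j) := by
    intro j
    induction j with
    | zero => simp
    | succ j ih => rw [pow_succ, RingAut.mul_apply, hsv, map_pow, ih, ← pow_mul, ← pow_succ]
  have hzmod : ∀ k : ℕ, (k : ZMod p) = 1 → z ^ k = z := by
    intro k hk
    have h1 : k ≡ 1 [MOD p] := by
      rw [← ZMod.natCast_eq_natCast_iff]; simpa using hk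
    have h2 : k % p = 1 := by
      rw [h1, Nat.mod_eq_of_lt hp.one_lt]
    rw [← pow_mod_orderOf z k, ← hzp.eq_orderOf, h2, pow_one]
  have hs1 : s ^ (p - 1) = 1 := by
    have h1 : σ ^ (p - 1) = 1 := by
      have h2 : (σ ^ (p - 1)) ζ = ζ := by
        rw [← hzK, ← hsj, hvz, hzmod]
        push_cast
        rw [← hv, pow_orderOf_eq_one]
      have h3 : ((σ ^ (p - 1) : K ≃ₐ[ℚ] K) : K →ₐ[ℚ] K) = AlgHom.id ℚ K := by
        refine (hζ.powerBasis ℚ).algHom_ext ?_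
        rw [IsPrimitiveRoot.powerBasis_gen]
        exact h2
      ext x
      exact DFunLike.congr_fun h3 x
    ext x
    refine (hsj (p - 1) x).trans ?_
    rw [h1]
    rfl
  have hvt : ∀ i : ℕ, (v : ZMod p) ^ i * (vn (-(i : ℤ)) : ZMod p) = 1 := by
    intro i
    induction i with
    | zero => simp [hvn0]
    | succ i ih =>
      have h1 := hvnrec (-((i + 1 : ℕ) : ℤ))
      rw [show (-((i + 1 : ℕ) : ℤ)) + 1 = -(i : ℤ) by push_cast; ring] at h1
      rw [pow_succ, mul_assoc, ← h1, ih]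
  have hst : ∀ i : ℕ, (s ^ i) z ^ vn (-(i : ℤ)) = z := by
    intro i
    rw [hvz, ← pow_mul, hzmod]
    push_cast
    exact hvt i
  have hδ' : ∀ i : ℕ, ((v * vn (-(i : ℤ)) / p : ℕ) : ℤ) = -δ i := by
    intro i
    have h1 := hδ i
    have h2 := hvn2 (1 - (i : ℤ))
    have h3 : (v * vn (-(i : ℤ)) : ℤ) = vn (1 - (i : ℤ)) + p * (-δ i) := by linear_combination h1
    push_cast
    rw [h3, Int.add_mul_ediv_left _ _ (by exact_mod_cast hp.ne_zero), Int.ediv_eq_zero_of_lt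
      (by positivity) (by have := hp.pos; omega), zero_add]
  have hprin : ∀ j, ¬ p ∣ j → ∀ Q : Ideal (𝓞 K), Q.IsPrime → z ^ j - 1 ∈ Q →
      Q.IsPrincipal ∨ Q = ⊥ := by
    intro j hj Q hQ hjQ
    left
    have hζj : IsPrimitiveRoot (ζ ^ j) p :=
      hζ.pow_of_coprime j ((Nat.Prime.coprime_iff_not_dvd hp).mpr hj).symm
    have h1 := hζj.zeta_sub_one_prime'
    have h2 : hζj.toInteger = z ^ j := by
      apply hinjO
      rw [map_pow, hzK]
      rfl
    rw [h2] at h1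
    have h3 : (Ideal.span {z ^ j - 1}).IsPrime := (Ideal.span_singleton_prime h1.ne_zero).mpr h1
    have h4 : (Ideal.span {z ^ j - 1}).IsMaximal :=
      h3.isMaximal (by simpa using h1.ne_zero)
    have h5 := h4.eq_of_le hQ.ne_top ((Ideal.span_singleton_le_iff_mem _).mpr hjQ)
    exact ⟨z ^ j - 1, h5.symm⟩
  have hrank : Module.finrank ℤ (𝓞 K) = p - 1 := by
    rw [RingOfIntegers.rank, IsCyclotomicExtension.finrank (n := p) K
      (Polynomial.cyclotomic.irreducible_rat hp.pos), Nat.totient_prime hp]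
  have hT' : ∀ I : Ideal (𝓞 K), I ≠ ⊥ → T (s10_cl I) = s10_cl (s • I) := by
    intro I hI
    rw [s10_cl_of hI, s10_cl_of (s10_smul_ne_bot s hI)]
    refine hT _ _ ?_
    simp only [Ideal.pointwise_smul_def]
    rfl
  obtain ⟨hA, hB⟩ := s10_main p hp hp2 hrank z hzp s hs1 v hv1 (by omega) hv hsv
    (fun i => vn (-(i : ℤ))) (fun i => hvn1 _) (fun i => by have := hvn2 (-(i : ℤ)); omega)
    hst hprin T hT' c hc (μ + a * p) hTc
  simp only [hδ'] at hB
  push_cast at hA hB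
  refine s10_arith p hp.two_le μ a δ hA ?_
  have hδ0 : δ 0 = 0 := by
    have h1 := hδ' 0
    simp only [Nat.cast_zero, neg_zero, hvn0, mul_one] at h1
    rw [Nat.div_eq_of_lt (by omega)] at h1
    simpa using h1.symm
  rw [Finset.range_eq_Ico, Finset.sum_eq_sum_Ico_succ_bot (by omega), hδ0, neg_zero, mul_zero,
    zero_add] at hB
  have hIcc : Finset.Ico (0 + 1) (p - 1) = Finset.Icc 1 (p - 2) := by
    ext i; simp only [Finset.mem_Ico, Finset.mem_Icc]; omega
  rw [hIcc] at hB
  simpa [Finset.sum_neg_distrib] using hB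
end
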